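/- Let c : X × Y → ℝ be bounded measurable, let E^{(k)} := ∫ c dπ^{(k)} + D_KL(π^{(k)}, P) be the objective value of the Sinkhorn iterate π^{(k)}, let f̃^{(k)}, g̃^{(k)} be the normalized dual potentials of π^{(k)}, and let f̃*, g̃* be the normalized dual optimizers of E_•(μ, ν, c), where • = c (causal) or • = bc (bicausal) according to the choice of projection sets. Then there exist constants ρ ∈ (0, 1) and C > 0, depending only on ‖c‖_∞ and N, such that for all k: E_•(μ, ν, c) − E^{(k)} ≤ ρ^k (E_•(μ, ν, c) − E^{(0)}) and ‖f̃^{(k)} − f̃*‖²_{L²(P)} + ‖g̃^{(k)} − g̃*‖²_{L²(P)} ≤ C ρ^k (E_•(μ, ν, c) − E^{(0)}). -/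

import Mathlib

open MeasureTheory ProbabilityTheory Filter Set
open scoped ENNReal NNReal Topology ProbabilityTheory

noncomputable section

namespace AOT

variable {N : ℕ}

/-- The σ-algebra on a path space generated by the `t`-th coordinate. -/
def coordσ (X : Fin N → Type*) [∀ t, MeasurableSpace (X t)] (t : Fin N) :
    MeasurableSpace (∀ s, X s) :=
  MeasurableSpace.comap (fun x => x t) inferInstance

/-- The σ-algebra generated by the coordinates (strictly) before time `t`, from a family
of coordinate σ-algebras. -/
def pastσOf {A : Type*} (m : Fin N → MeasurableSpace A) (t : ℕ) : MeasurableSpace A :=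
  ⨆ s : Fin N, ⨆ _ : (s : ℕ) < t, m s

/-- The σ-algebra on a path space generated by the coordinates before time `t`. -/
def pastσ (X : Fin N → Type*) [∀ t, MeasurableSpace (X t)] (t : ℕ) :
    MeasurableSpace (∀ s, X s) :=
  pastσOf (coordσ X) t

/-- Conditional independence of the sub-σ-algebras `m₁` and `m₂` given `m₃`, under the
measure `π`: for all sets `A ∈ m₁`, `B ∈ m₂`, the conditional expectation (given `m₃`)
of the indicator of `A ∩ B` is a.s. the product of those of `A` and of `B`. -/
def CondIndepσ {Ω : Type*} {mΩ : MeasurableSpace Ω} (m₁ m₂ m₃ : MeasurableSpace Ω)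
    (π : @Measure Ω mΩ) : Prop :=
  ∀ A B : Set Ω, MeasurableSet[m₁] A → MeasurableSet[m₂] B →
    (π[(A ∩ B).indicator (fun _ => (1 : ℝ)) | m₃]) =ᵐ[π]
      (π[A.indicator (fun _ => (1 : ℝ)) | m₃]) * (π[B.indicator (fun _ => (1 : ℝ)) | m₃])

/-- Causality of a measure on `A × B` relative to families of coordinate σ-algebras
`mA` on `A` and `mB` on `B`: for every time `t`, the `t`-th coordinate of the first
component is conditionally independent of the (strict) past of the second component,
given the (strict) past of the first component. -/
def IsCausalFor {A B : Type*} [MeasurableSpace A] [MeasurableSpace B]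
    (mA : Fin N → MeasurableSpace A) (mB : Fin N → MeasurableSpace B)
    (π : Measure (A × B)) : Prop :=
  ∀ t : Fin N,
    CondIndepσ ((mA t).comap Prod.fst)
      ((pastσOf mB (t : ℕ)).comap Prod.snd)
      ((pastσOf mA (t : ℕ)).comap Prod.fst) π

/-- Anticausality: causality with the roles of the two components exchanged. -/
def IsAnticausalFor {A B : Type*} [MeasurableSpace A] [MeasurableSpace B]
    (mA : Fin N → MeasurableSpace A) (mB : Fin N → MeasurableSpace B)
    (π : Measure (A × B)) : Prop :=
  IsCausalFor mB mA (π.map Prod.swap)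

/-- A coupling of a measure on `X₁ × ⋯ × X_N` and a measure on `Y₁ × ⋯ × Y_N` is causal if
under it, for every `t`, `Y_{1:t}` is conditionally independent of `X_{t+1}` given `X_{1:t}`. -/
def IsCausal {X Y : Fin N → Type*} [∀ t, MeasurableSpace (X t)] [∀ t, MeasurableSpace (Y t)]
    (π : Measure ((∀ t, X t) × (∀ t, Y t))) : Prop :=
  IsCausalFor (coordσ X) (coordσ Y) π

def IsAnticausal {X Y : Fin N → Type*} [∀ t, MeasurableSpace (X t)] [∀ t, MeasurableSpace (Y t)]
    (π : Measure ((∀ t, X t) × (∀ t, Y t))) : Prop :=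
  IsAnticausalFor (coordσ X) (coordσ Y) π

def IsBicausal {X Y : Fin N → Type*} [∀ t, MeasurableSpace (X t)] [∀ t, MeasurableSpace (Y t)]
    (π : Measure ((∀ t, X t) × (∀ t, Y t))) : Prop :=
  IsCausal π ∧ IsAnticausal π

/-- `π` is a coupling of `μ` and `ν`. -/
def IsCoupling {A B : Type*} [MeasurableSpace A] [MeasurableSpace B]
    (μ : Measure A) (ν : Measure B) (π : Measure (A × B)) : Prop :=
  π.map Prod.fst = μ ∧ π.map Prod.snd = ν

/-- The four flavors of (adapted) optimal transport: plain, causal, anticausal, bicausal. -/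
inductive Flavor | plain | causal | anticausal | bicausal

/-- The adaptedness constraint corresponding to a flavor. -/
def IsAdapted {X Y : Fin N → Type*} [∀ t, MeasurableSpace (X t)] [∀ t, MeasurableSpace (Y t)] :
    Flavor → Measure ((∀ t, X t) × (∀ t, Y t)) → Prop
  | .plain => fun _ => True
  | .causal => fun π => IsCausal π
  | .anticausal => fun π => IsAnticausal π
  | .bicausal => fun π => IsBicausal π

/-- The set `Π_•(μ, ν)` of couplings of `μ` and `ν` with the adaptedness constraint
given by the flavor `b`. -/
def aCouplings {X Y : Fin N → Type*} [∀ t, MeasurableSpace (X t)] [∀ t, MeasurableSpace (Y t)]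
    (b : Flavor) (μ : Measure (∀ t, X t)) (ν : Measure (∀ t, Y t)) :
    Set (Measure ((∀ t, X t) × (∀ t, Y t))) :=
  {π | IsCoupling μ ν π ∧ IsAdapted b π}

/-- `p`-th power transport cost of a coupling. -/
def lcost (p : ℝ) {A : Type*} [MeasurableSpace A] [PseudoEMetricSpace A]
    (π : Measure (A × A)) : ℝ≥0∞ :=
  ∫⁻ z, edist z.1 z.2 ^ p ∂π

/-- The (adapted) Wasserstein distance `W_{p,•}` between two measures on a path space. -/
def W {X : Fin N → Type*} [∀ t, MeasurableSpace (X t)] [∀ t, PseudoEMetricSpace (X t)]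
    (p : ℝ) (b : Flavor) (μ ν : Measure (∀ t, X t)) : ℝ≥0∞ :=
  (⨅ π : aCouplings b μ ν, lcost p π.1) ^ (1 / p)

/-- Coordinate σ-algebras on `X × Y` viewed as a single path space with
coordinates `X_t × Y_t`. -/
def coordσ2 (X Y : Fin N → Type*) [∀ t, MeasurableSpace (X t)] [∀ t, MeasurableSpace (Y t)]
    (t : Fin N) : MeasurableSpace ((∀ s, X s) × (∀ s, Y s)) :=
  ((coordσ X t).comap Prod.fst) ⊔ ((coordσ Y t).comap Prod.snd)

/-- Adaptedness for measures on `(X × Y) × (X × Y)`, where `X × Y` is regarded as a single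
path space with `N` time steps, the `t`-th coordinate being `X_t × Y_t`. -/
def IsAdapted2 {X Y : Fin N → Type*} [∀ t, MeasurableSpace (X t)] [∀ t, MeasurableSpace (Y t)] :
    Flavor → Measure (((∀ t, X t) × (∀ t, Y t)) × ((∀ t, X t) × (∀ t, Y t))) → Prop
  | .plain => fun _ => True
  | .causal => fun θ => IsCausalFor (coordσ2 X Y) (coordσ2 X Y) θ
  | .anticausal => fun θ => IsAnticausalFor (coordσ2 X Y) (coordσ2 X Y) θ
  | .bicausal => fun θ => IsCausalFor (coordσ2 X Y) (coordσ2 X Y) θ ∧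
      IsAnticausalFor (coordσ2 X Y) (coordσ2 X Y) θ

/-- The set `Π_•(π, π̃)` of couplings of two measures on `X × Y`, with adaptedness understood
for `X × Y` as one path space. -/
def aCouplings2 {X Y : Fin N → Type*} [∀ t, MeasurableSpace (X t)] [∀ t, MeasurableSpace (Y t)]
    (b : Flavor) (π ρ : Measure ((∀ t, X t) × (∀ t, Y t))) :
    Set (Measure (((∀ t, X t) × (∀ t, Y t)) × ((∀ t, X t) × (∀ t, Y t)))) :=
  {θ | IsCoupling π ρ θ ∧ IsAdapted2 b θ}

/-- `p`-th power transport cost `∫ d_X(x,x̃)^p + d_Y(y,ỹ)^p dθ` for couplings of couplings. -/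
def lcost2 (p : ℝ) {A B : Type*} [MeasurableSpace A] [MeasurableSpace B]
    [PseudoEMetricSpace A] [PseudoEMetricSpace B]
    (θ : Measure ((A × B) × (A × B))) : ℝ≥0∞ :=
  ∫⁻ z, (edist z.1.1 z.2.1 ^ p + edist z.1.2 z.2.2 ^ p) ∂θ

/-- The (adapted) Wasserstein distance `W_{p,•}(π, π̃)` between couplings, with cost
`d_X^p + d_Y^p` and `X × Y` regarded as one path space. -/
def W2 {X Y : Fin N → Type*} [∀ t, MeasurableSpace (X t)] [∀ t, MeasurableSpace (Y t)]
    [∀ t, PseudoEMetricSpace (X t)] [∀ t, PseudoEMetricSpace (Y t)]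
    (p : ℝ) (b : Flavor) (π ρ : Measure ((∀ t, X t) × (∀ t, Y t))) : ℝ≥0∞ :=
  (⨅ θ : aCouplings2 b π ρ, lcost2 p θ.1) ^ (1 / p)

/- Relative entropy (Kullback-Leibler divergence): `D_KL(π, ρ) = ∫ log (dπ/dρ) dπ` if
`π ≪ ρ` and the integral is defined, and `∞` otherwise. -/
open Classical in
def KL {Ω : Type*} [MeasurableSpace Ω] (π ρ : Measure Ω) : ℝ≥0∞ :=
  if π ≪ ρ ∧ Integrable (llr π ρ) π then ENNReal.ofReal (∫ ω, llr π ρ ω ∂π) else ⊤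

/-- The transport value `V_•(μ, ν, c)`. -/
def V {X Y : Fin N → Type*} [∀ t, MeasurableSpace (X t)] [∀ t, MeasurableSpace (Y t)]
    (b : Flavor) (μ : Measure (∀ t, X t)) (ν : Measure (∀ t, Y t))
    (c : (∀ t, X t) × (∀ t, Y t) → ℝ) : ℝ :=
  ⨅ π : aCouplings b μ ν, ∫ z, c z ∂π.1

/-- The entropic objective `∫ c dπ + ε D_KL(π, P)`, valued in `EReal`. -/
def entObj {Ω : Type*} [MeasurableSpace Ω] (c : Ω → ℝ) (ε : ℝ) (P : Measure Ω)
    (π : Measure Ω) : EReal :=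
  ((∫ z, c z ∂π : ℝ) : EReal) + (ε : EReal) * ((KL π P : ℝ≥0∞) : EReal)

/-- The entropic transport value `E_•^ε(μ, ν, c)`, valued in `EReal`. -/
def EE {X Y : Fin N → Type*} [∀ t, MeasurableSpace (X t)] [∀ t, MeasurableSpace (Y t)]
    (b : Flavor) (μ : Measure (∀ t, X t)) (ν : Measure (∀ t, Y t))
    (c : (∀ t, X t) × (∀ t, Y t) → ℝ) (ε : ℝ) : EReal :=
  ⨅ π : aCouplings b μ ν, entObj c ε (μ.prod ν) π.1

/-- The kernel `K(x, y) := K^μ(x) ⊗ K^ν(y)` used to build the shadow. -/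
def shadowKernel {A A' B B' : Type*} [MeasurableSpace A] [MeasurableSpace A']
    [MeasurableSpace B] [MeasurableSpace B']
    (Kμ : Kernel A A') (Kν : Kernel B B') : Kernel (A × B) (A' × B') :=
  (Kμ.comap Prod.fst measurable_fst) ×ₖ (Kν.comap Prod.snd measurable_snd)

/-- The `(K^μ, K^ν)`-shadow of `π`: the second marginal of `π ⊗ (K^μ ⊗ K^ν)`. -/
def shadow {A A' B B' : Type*} [MeasurableSpace A] [MeasurableSpace A']
    [MeasurableSpace B] [MeasurableSpace B']
    (π : Measure (A × B)) (Kμ : Kernel A A') (Kν : Kernel B B') : Measure (A' × B') :=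
  (π ⊗ₘ (shadowKernel Kμ Kν)).map Prod.snd

/-- `μ` has a finite `p`-th moment. -/
def MemPp {A : Type*} [MeasurableSpace A] [PseudoEMetricSpace A] (p : ℝ) (μ : Measure A) :
    Prop :=
  ∀ x₀ : A, ∫⁻ x, edist x₀ x ^ p ∂μ ≠ ⊤

/-- `c` has growth of order at most `p`. -/
def GrowthLE {A B : Type*} [PseudoEMetricSpace A] [PseudoEMetricSpace B]
    (p : ℝ) (c : A × B → ℝ) : Prop :=
  ∃ (x₀ : A) (y₀ : B) (M : ℝ), ∀ z : A × B,
    |c z| ≤ M * (1 + (edist x₀ z.1).toReal ^ p + (edist y₀ z.2).toReal ^ p)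

/-- Weak convergence of a sequence of measures (testing against bounded continuous
functions). -/
def WeakTendsto {A : Type*} [MeasurableSpace A] [TopologicalSpace A]
    (πs : ℕ → Measure A) (π : Measure A) : Prop :=
  ∀ f : BoundedContinuousFunction A ℝ,
    Tendsto (fun n => ∫ x, f x ∂(πs n)) atTop (𝓝 (∫ x, f x ∂π))

/-- A finitely supported (discrete) measure. -/
def FinitelySupported {A : Type*} [MeasurableSpace A] (μ : Measure A) : Prop :=
  ∃ s : Finset A, μ (↑s)ᶜ = 0


/-- `K` is a version of the conditional distribution of the random element `V` given the
sub-σ-algebra `m`, under the measure `ρ`. -/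
def IsCondDistrib' {Ω E : Type*} {mΩ : MeasurableSpace Ω} [MeasurableSpace E]
    (ρ : @Measure Ω mΩ) (V : Ω → E) (m : MeasurableSpace Ω) (K : Ω → Measure E) : Prop :=
  (∀ ω, IsProbabilityMeasure (K ω)) ∧
  (∀ A : Set E, MeasurableSet A → Measurable[m] (fun ω => (K ω A).toReal)) ∧
  (∀ A : Set E, MeasurableSet A →
    (ρ[(V ⁻¹' A).indicator (fun _ => (1 : ℝ)) | m]) =ᵐ[ρ] fun ω => (K ω A).toReal)

/-- `Kμ` is a family of disintegration kernels of `μ` on a path space: `Kμ t` is a version of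
the conditional distribution of the `t`-th coordinate given the past before `t`. -/
def IsDisintegration {X : Fin N → Type*} [∀ t, MeasurableSpace (X t)]
    (μ : Measure (∀ t, X t)) (Kμ : ∀ t : Fin N, (∀ s, X s) → Measure (X t)) : Prop :=
  ∀ t : Fin N, IsCondDistrib' μ (fun x => x t) (pastσ X (t : ℕ)) (Kμ t)

variable {X Y : Fin N → Type*} [∀ t, MeasurableSpace (X t)] [∀ t, MeasurableSpace (Y t)]

open Classical in
/-- Membership in the dual building block `A_{X,μ,t}` (relative to a fixed family `Kμ` of
disintegration kernels of `μ`): for `t = 1` the bounded measurable functions of `x₁`; for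
`t ≥ 2` functions `a_t(x_{1:t}, y_{1:t-1}) - ∫ a_t(x_{1:t-1}, x̃_t, y_{1:t-1}) μ_t^{x_{1:t-1}}(dx̃_t)`
with `a_t` bounded measurable. (Here `τ` is the 0-based coordinate index, `τ = t - 1`.) -/
def MemAX (Kμ : ∀ t : Fin N, (∀ s, X s) → Measure (X t)) (τ : Fin N)
    (f : (∀ t, X t) × (∀ t, Y t) → ℝ) : Prop :=
  if (τ : ℕ) = 0 then
    ∃ a : (∀ t, X t) × (∀ t, Y t) → ℝ,
      Measurable[(coordσ X τ).comap Prod.fst] a ∧ (∃ M, ∀ ω, |a ω| ≤ M) ∧ f = a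
  else
    ∃ a : (∀ t, X t) × (∀ t, Y t) → ℝ,
      Measurable[((pastσ X (τ : ℕ) ⊔ coordσ X τ).comap Prod.fst) ⊔
        ((pastσ Y (τ : ℕ)).comap Prod.snd)] a ∧ (∃ M, ∀ ω, |a ω| ≤ M) ∧
      f = fun ω => a ω - ∫ x', a (Function.update ω.1 τ x', ω.2) ∂(Kμ τ ω.1)

open Classical in
/-- Membership in the dual building block `A_{Y,ν,t}` (symmetric to `MemAX`). -/
def MemAY (Kν : ∀ t : Fin N, (∀ s, Y s) → Measure (Y t)) (τ : Fin N)
    (f : (∀ t, X t) × (∀ t, Y t) → ℝ) : Prop :=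
  if (τ : ℕ) = 0 then
    ∃ a : (∀ t, X t) × (∀ t, Y t) → ℝ,
      Measurable[(coordσ Y τ).comap Prod.snd] a ∧ (∃ M, ∀ ω, |a ω| ≤ M) ∧ f = a
  else
    ∃ a : (∀ t, X t) × (∀ t, Y t) → ℝ,
      Measurable[((pastσ X (τ : ℕ)).comap Prod.fst) ⊔
        ((pastσ Y (τ : ℕ) ⊔ coordσ Y τ).comap Prod.snd)] a ∧ (∃ M, ∀ ω, |a ω| ≤ M) ∧
      f = fun ω => a ω - ∫ y', a (ω.1, Function.update ω.2 τ y') ∂(Kν τ ω.2)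

/-- The dual space `S_{X,μ}`: sums `∑_{t=1}^N f_t` with `f_t ∈ A_{X,μ,t}`. -/
def MemSXμ (Kμ : ∀ t : Fin N, (∀ s, X s) → Measure (X t))
    (s : (∀ t, X t) × (∀ t, Y t) → ℝ) : Prop :=
  ∃ f : Fin N → ((∀ t, X t) × (∀ t, Y t) → ℝ),
    (∀ τ, MemAX Kμ τ (f τ)) ∧ s = fun ω => ∑ τ, f τ ω

/-- The dual space `S_{Y,ν}`: sums `∑_{t=1}^N g_t` with `g_t ∈ A_{Y,ν,t}`. -/
def MemSYν (Kν : ∀ t : Fin N, (∀ s, Y s) → Measure (Y t))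
    (s : (∀ t, X t) × (∀ t, Y t) → ℝ) : Prop :=
  ∃ g : Fin N → ((∀ t, X t) × (∀ t, Y t) → ℝ),
    (∀ τ, MemAY Kν τ (g τ)) ∧ s = fun ω => ∑ τ, g τ ω

/-- The space `S_X` of bounded measurable functions depending only on `x`. -/
def MemSX (s : (∀ t, X t) × (∀ t, Y t) → ℝ) : Prop :=
  ∃ g : (∀ t, X t) → ℝ, Measurable g ∧ (∃ M, ∀ x, |g x| ≤ M) ∧ s = fun ω => g ω.1

/-- The space `S_Y` of bounded measurable functions depending only on `y`. -/
def MemSY (s : (∀ t, X t) × (∀ t, Y t) → ℝ) : Prop :=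
  ∃ g : (∀ t, Y t) → ℝ, Measurable g ∧ (∃ M, ∀ y, |g y| ≤ M) ∧ s = fun ω => g ω.2

/-- The dual space `H_•`: `H = S_X ⊕ S_Y`, `H_c = S_{X,μ} ⊕ S_Y`, `H_{ac} = S_X ⊕ S_{Y,ν}`,
`H_{bc} = S_{X,μ} ⊕ S_{Y,ν}`. -/
def MemH (Kμ : ∀ t : Fin N, (∀ s, X s) → Measure (X t))
    (Kν : ∀ t : Fin N, (∀ s, Y s) → Measure (Y t)) :
    Flavor → ((∀ t, X t) × (∀ t, Y t) → ℝ) → Prop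
  | .plain => fun h => ∃ sX sY, MemSX (X := X) (Y := Y) sX ∧ MemSY sY ∧
      h = fun ω => sX ω + sY ω
  | .causal => fun h => ∃ sX sY, MemSXμ Kμ sX ∧ MemSY sY ∧ h = fun ω => sX ω + sY ω
  | .anticausal => fun h => ∃ sX sY, MemSX (X := X) (Y := Y) sX ∧ MemSYν Kν sY ∧
      h = fun ω => sX ω + sY ω
  | .bicausal => fun h => ∃ sX sY, MemSXμ Kμ sX ∧ MemSYν Kν sY ∧ h = fun ω => sX ω + sY ω

/-- The set `Π_c(μ, ∗)` of causal measures with first marginal `μ` and arbitrary second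
marginal. -/
def causalFirst (μ : Measure (∀ t, X t)) : Set (Measure ((∀ t, X t) × (∀ t, Y t))) :=
  {π | π.map Prod.fst = μ ∧ IsCausal π}

/-- The set `Π(∗, ν)` of couplings with arbitrary first marginal and second marginal `ν`. -/
def secondMarg (ν : Measure (∀ t, Y t)) : Set (Measure ((∀ t, X t) × (∀ t, Y t))) :=
  {π | π.map Prod.snd = ν}

/-- The set `Π_{ac}(∗, ν)` of anticausal measures with second marginal `ν`. -/
def anticausalSecond (ν : Measure (∀ t, Y t)) : Set (Measure ((∀ t, X t) × (∀ t, Y t))) :=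
  {π | π.map Prod.snd = ν ∧ IsAnticausal π}

/-- The reference measure `P_c` with `dP_c/dP = exp(-c)/∫ exp(-c) dP`. -/
def Pc {Ω : Type*} [MeasurableSpace Ω] (P : Measure Ω) (c : Ω → ℝ) : Measure Ω :=
  P.withDensity
    (fun ω => ENNReal.ofReal (Real.exp (-c ω)) / ∫⁻ ω', ENNReal.ofReal (Real.exp (-c ω')) ∂P)

/-- Sinkhorn's algorithm: `full 0 = π0`; `half k` is the `D_KL`-projection of `full k`
onto `Q1`, and `full (k+1)` is the `D_KL`-projection of `half k` onto `Q2`. -/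
structure IsSinkhorn {Ω : Type*} [MeasurableSpace Ω] (Q1 Q2 : Set (Measure Ω))
    (π0 : Measure Ω) (full half : ℕ → Measure Ω) : Prop where
  init : full 0 = π0
  half_mem : ∀ k, half k ∈ Q1
  half_opt : ∀ k, ∀ ρ ∈ Q1, KL (half k) (full k) ≤ KL ρ (full k)
  full_mem : ∀ k, full (k + 1) ∈ Q2
  full_opt : ∀ k, ∀ ρ ∈ Q2, KL (full (k + 1)) (half k) ≤ KL ρ (half k)

/-- The second projection set of Sinkhorn's algorithm: `Π(∗, ν)` for the causal problem and
`Π_{ac}(∗, ν)` for the bicausal problem. -/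
def sinkQ2 (b : Flavor) (ν : Measure (∀ t, Y t)) : Set (Measure ((∀ t, X t) × (∀ t, Y t))) :=
  match b with
  | .bicausal => anticausalSecond ν
  | _ => secondMarg ν

/-- The dual class of the second Sinkhorn potential: `S_Y` for the causal problem,
`S_{Y,ν}` for the bicausal problem. -/
def MemG (Kν : ∀ t : Fin N, (∀ s, Y s) → Measure (Y t)) :
    Flavor → ((∀ t, X t) × (∀ t, Y t) → ℝ) → Prop
  | .bicausal => fun g => MemSYν Kν g
  | _ => fun g => MemSY g

/-- Real-valued entropic transport value (`ε = 1`), the infimum being taken over couplings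
with finite relative entropy. -/
def Efin (b : Flavor) (μ : Measure (∀ t, X t)) (ν : Measure (∀ t, Y t))
    (c : (∀ t, X t) × (∀ t, Y t) → ℝ) : ℝ :=
  ⨅ π : {π : Measure ((∀ t, X t) × (∀ t, Y t)) //
      π ∈ aCouplings b μ ν ∧ KL π (μ.prod ν) ≠ ⊤},
    (∫ z, c z ∂π.1 + (KL π.1 (μ.prod ν)).toReal)

section Scalar

lemma exp_sub_one_sub_ge (u : ℝ) (hu : 0 ≤ u) : u ^ 2 / 4 ≤ Real.exp u - 1 - u := by
  have h1 : Real.exp u = Real.exp (u / 2) ^ 2 := by rw [← Real.exp_nat_mul]; ring_nf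
  have h2 := Real.add_one_le_exp (u / 2)
  nlinarith

lemma exp_sub_one_sub_ge_of_nonpos (u : ℝ) (hu : u ≤ 0) :
    Real.exp u * (u ^ 2 / 4) ≤ Real.exp u - 1 - u := by
  have h1 : Real.exp u = Real.exp (u / 2) ^ 2 := by rw [← Real.exp_nat_mul]; ring_nf
  have h2 := Real.add_one_le_exp (u / 2)
  have h3 := Real.add_one_le_exp (-(u / 2))
  have h4 : Real.exp (u / 2) * Real.exp (-(u / 2)) = 1 := by rw [← Real.exp_add]; simp
  have h5 := Real.exp_pos (u / 2)
  have h6 : Real.exp (u / 2) * (-(u / 2)) ≤ 1 - Real.exp (u / 2) := by nlinarith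
  have h7 : 0 ≤ Real.exp (u / 2) * (-(u / 2)) := mul_nonneg h5.le (by linarith)
  have h8 : (Real.exp (u / 2) * (-(u / 2))) ^ 2 ≤ (1 - Real.exp (u / 2)) ^ 2 :=
    pow_le_pow_left₀ h7 h6 2
  rw [h1]
  nlinarith

/-- Strong convexity of the exponential on a bounded set. -/
lemma exp_strong_convex {K a b : ℝ} (ha : |a| ≤ K) (hb : |b| ≤ K) :
    Real.exp a + Real.exp a * (b - a) + Real.exp (-K) / 4 * (b - a) ^ 2 ≤ Real.exp b := by
  have hab : Real.exp b = Real.exp a * Real.exp (b - a) := by rw [← Real.exp_add]; ring_nf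
  have hKa : Real.exp (-K) ≤ Real.exp a := Real.exp_le_exp.2 (abs_le.1 ha).1
  have hKb : Real.exp (-K) ≤ Real.exp b := Real.exp_le_exp.2 (abs_le.1 hb).1
  have hsq := sq_nonneg (b - a)
  have ha0 := Real.exp_pos a
  rcases le_total 0 (b - a) with h | h
  · have := mul_le_mul_of_nonneg_left (exp_sub_one_sub_ge _ h) ha0.le
    nlinarith
  · have := mul_le_mul_of_nonneg_left (exp_sub_one_sub_ge_of_nonpos _ h) ha0.le
    have h2 : Real.exp a * (Real.exp (b - a) * ((b - a) ^ 2 / 4))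
        = Real.exp b * ((b - a) ^ 2 / 4) := by rw [hab]; ring
    nlinarith

lemma abs_exp_sub_exp_le {K a b : ℝ} (ha : |a| ≤ K) (hb : |b| ≤ K) :
    |Real.exp b - Real.exp a| ≤ Real.exp K * |b - a| := by
  wlog h : a ≤ b generalizing a b
  · rw [abs_sub_comm, abs_sub_comm b a]; exact this hb ha (le_of_not_ge h)
  have hba : Real.exp a ≤ Real.exp b := Real.exp_le_exp.2 h
  rw [abs_of_nonneg (by linarith), abs_of_nonneg (by linarith)]
  have h1 := Real.add_one_le_exp (a - b)
  have h2 : Real.exp a = Real.exp b * Real.exp (a - b) := by rw [← Real.exp_add]; ring_nf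
  have h3 : Real.exp b ≤ Real.exp K := Real.exp_le_exp.2 (abs_le.1 hb).2
  have h4 := Real.exp_pos b
  nlinarith

lemma mul_le_young {K s x y z : ℝ} (hK : 0 ≤ K) (hs : 0 < s) (hz : |z| ≤ K * |y|) :
    x * z ≤ K * (s / 2 * x ^ 2 + 1 / (2 * s) * y ^ 2) := by
  have h1 : x * z ≤ |x| * |z| := by rw [← abs_mul]; exact le_abs_self _
  have h2 : |x| * |z| ≤ K * (|x| * |y|) := by
    nlinarith [mul_le_mul_of_nonneg_left hz (abs_nonneg x)]
  have h3 : |x| * |y| ≤ s / 2 * x ^ 2 + 1 / (2 * s) * y ^ 2 := by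
    rw [← sq_abs x, ← sq_abs y]
    have : s / 2 * |x| ^ 2 + 1 / (2 * s) * |y| ^ 2 - |x| * |y|
        = (s * |x| - |y|) ^ 2 / (2 * s) := by field_simp; ring
    have h0 : 0 ≤ (s * |x| - |y|) ^ 2 / (2 * s) := by positivity
    linarith
  exact h1.trans (h2.trans (mul_le_mul_of_nonneg_left h3 hK))

end Scalar

section Bounded

variable {Ω : Type*} [MeasurableSpace Ω] {P : Measure Ω} {φ ψ : Ω → ℝ}

/-- Almost everywhere measurable and essentially bounded functions. -/
def Bdd (P : Measure Ω) (φ : Ω → ℝ) : Prop :=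
  AEStronglyMeasurable φ P ∧ ∃ K, ∀ᵐ ω ∂P, |φ ω| ≤ K

lemma Bdd.of_bound {K : ℝ} (h : AEStronglyMeasurable φ P) (hK : ∀ᵐ ω ∂P, |φ ω| ≤ K) :
    Bdd P φ := ⟨h, K, hK⟩

lemma Bdd.congr (h : Bdd P φ) (he : φ =ᵐ[P] ψ) : Bdd P ψ := by
  obtain ⟨h1, K, hK⟩ := h
  refine ⟨h1.congr he, K, ?_⟩
  filter_upwards [hK, he] with ω h h'
  rwa [← h']

lemma Bdd.const (a : ℝ) : Bdd P (fun _ => a) :=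
  ⟨aestronglyMeasurable_const, |a|, Eventually.of_forall fun _ => le_rfl⟩

lemma Bdd.add (hφ : Bdd P φ) (hψ : Bdd P ψ) : Bdd P (fun ω => φ ω + ψ ω) := by
  obtain ⟨h1, K, hK⟩ := hφ
  obtain ⟨h2, K', hK'⟩ := hψ
  refine ⟨h1.add h2, K + K', ?_⟩
  filter_upwards [hK, hK'] with ω h h'
  exact (abs_add_le _ _).trans (add_le_add h h')

lemma Bdd.neg (hφ : Bdd P φ) : Bdd P (fun ω => -φ ω) := by
  obtain ⟨h1, K, hK⟩ := hφ
  exact ⟨h1.neg, K, by simpa using hK⟩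

lemma Bdd.sub (hφ : Bdd P φ) (hψ : Bdd P ψ) : Bdd P (fun ω => φ ω - ψ ω) := by
  simpa [sub_eq_add_neg] using hφ.add hψ.neg

lemma Bdd.mul (hφ : Bdd P φ) (hψ : Bdd P ψ) : Bdd P (fun ω => φ ω * ψ ω) := by
  obtain ⟨h1, K, hK⟩ := hφ
  obtain ⟨h2, K', hK'⟩ := hψ
  refine ⟨h1.mul h2, |K| * |K'|, ?_⟩
  filter_upwards [hK, hK'] with ω h h'
  rw [abs_mul]
  exact mul_le_mul (h.trans (le_abs_self _)) (h'.trans (le_abs_self _)) (abs_nonneg _)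
    (abs_nonneg _)

lemma Bdd.sq (hφ : Bdd P φ) : Bdd P (fun ω => φ ω ^ 2) := by
  simpa [pow_two] using hφ.mul hφ

lemma Bdd.const_mul (a : ℝ) (hφ : Bdd P φ) : Bdd P (fun ω => a * φ ω) :=
  (Bdd.const a).mul hφ

lemma Bdd.exp (hφ : Bdd P φ) : Bdd P (fun ω => Real.exp (φ ω)) := by
  obtain ⟨h1, K, hK⟩ := hφ
  refine ⟨Real.continuous_exp.comp_aestronglyMeasurable h1, Real.exp K, ?_⟩
  filter_upwards [hK] with ω h
  rw [abs_of_pos (Real.exp_pos _)]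
  exact Real.exp_le_exp.2 ((le_abs_self _).trans h)

lemma Bdd.sum {ι : Type*} (s : Finset ι) {φ : ι → Ω → ℝ} (h : ∀ i ∈ s, Bdd P (φ i)) :
    Bdd P (fun ω => ∑ i ∈ s, φ i ω) := by
  classical
  induction s using Finset.induction_on with
  | empty => simpa using Bdd.const 0
  | insert i s hi ih =>
    simp only [Finset.sum_insert hi]
    exact (h i (by simp)).add (ih fun j hj => h j (by simp [hj]))

lemma Bdd.integrable [IsFiniteMeasure P] (h : Bdd P φ) : Integrable φ P := by
  obtain ⟨h1, K, hK⟩ := h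
  exact Integrable.of_bound h1 K (by simpa using hK)

lemma Bdd.mono_ac {Q : Measure Ω} (h : Bdd P φ) (hQ : Q ≪ P) : Bdd Q φ := by
  obtain ⟨h1, K, hK⟩ := h
  exact ⟨h1.mono_ac hQ, K, hQ.ae_le hK⟩

end Bounded

section Dual

variable {Ω : Type*} [MeasurableSpace Ω]

/-- `Z` acts on the class `F` as the constant `1`. -/
def Ann (P : Measure Ω) (F : (Ω → ℝ) → Prop) (Z : Ω → ℝ) : Prop :=
  ∀ φ, F φ → ∫ ω, φ ω * Z ω ∂P = ∫ ω, φ ω ∂P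

/-- A linear class of bounded functions which contains the constants. -/
structure IsClass (P : Measure Ω) (F : (Ω → ℝ) → Prop) : Prop where
  bdd : ∀ φ, F φ → Bdd P φ
  sub : ∀ φ ψ, F φ → F ψ → F (fun ω => φ ω - ψ ω)
  smul : ∀ (a : ℝ) φ, F φ → F (fun ω => a * φ ω)
  const : ∀ a : ℝ, F (fun _ => a)
  congr : ∀ φ ψ, F φ → φ =ᵐ[P] ψ → F ψ

lemma IsClass.add {P : Measure Ω} {F : (Ω → ℝ) → Prop} (h : IsClass P F) {φ ψ : Ω → ℝ}
    (hφ : F φ) (hψ : F ψ) : F (fun ω => φ ω + ψ ω) := by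
  have := h.sub _ _ hφ (h.smul (-1) _ hψ)
  simpa [sub_eq_add_neg] using this

/-- Two classes which are orthogonal modulo constants. -/
def Orth (P : Measure Ω) (F G : (Ω → ℝ) → Prop) : Prop :=
  ∀ φ ψ, F φ → G ψ → ∫ ω, φ ω * ψ ω ∂P = (∫ ω, φ ω ∂P) * ∫ ω, ψ ω ∂P

variable {P : Measure Ω} [IsProbabilityMeasure P] {F G : (Ω → ℝ) → Prop} {c : Ω → ℝ}

lemma Ann.integral_eq_one (hF : IsClass P F) {Z : Ω → ℝ} (h : Ann P F Z) : ∫ ω, Z ω ∂P = 1 := by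
  simpa using h _ (hF.const 1)

/-- Uniqueness of the decomposition of a sum of elements of two orthogonal classes. -/
lemma Orth.ae_eq_const (hF : IsClass P F) (hO : Orth P F G) {φ ψ : Ω → ℝ}
    (hφ : F φ) (hψ : G ψ) (h : ∀ᵐ ω ∂P, φ ω + ψ ω = 0) :
    ∃ a : ℝ, ∀ᵐ ω ∂P, φ ω = a ∧ ψ ω = -a := by
  have hb := hF.bdd _ hφ
  set a := ∫ ω, φ ω ∂P with ha
  have h1 : ∫ ω, ψ ω ∂P = -a := by
    rw [ha, ← integral_neg]
    apply integral_congr_ae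
    filter_upwards [h] with ω h; linarith
  have h2 : ∫ ω, φ ω * ψ ω ∂P = - ∫ ω, φ ω ^ 2 ∂P := by
    rw [← integral_neg]
    apply integral_congr_ae
    filter_upwards [h] with ω h
    rw [show ψ ω = - φ ω by linarith]; ring
  have h3 : ∫ ω, φ ω ^ 2 ∂P = a ^ 2 := by
    have := hO _ _ hφ hψ
    rw [h1, h2] at this
    nlinarith
  have h4 : ∫ ω, (φ ω - a) ^ 2 ∂P = 0 := by
    have : ∀ ω, (φ ω - a) ^ 2 = φ ω ^ 2 - (2 * a) * φ ω + a ^ 2 := fun ω => by ring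
    simp_rw [this]
    rw [integral_add (hb.sq.sub (hb.const_mul _)).integrable (Bdd.const _).integrable,
      integral_sub hb.sq.integrable (hb.const_mul _).integrable, integral_const_mul, h3, ← ha]
    simp; ring
  rw [integral_eq_zero_iff_of_nonneg (fun ω => sq_nonneg _)
    (hb.sub (Bdd.const a)).sq.integrable] at h4
  refine ⟨a, ?_⟩
  filter_upwards [h, h4] with ω h h'
  have : φ ω - a = 0 := by simpa using h'
  exact ⟨by linarith, by linarith⟩

/-- Uniqueness of the projection onto a dual class. -/
lemma Ann.unique (hF : IsClass P F) {w f f' : Ω → ℝ} (hw : Bdd P w) (hf : F f) (hf' : F f')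
    (h : Ann P F (fun ω => Real.exp (f ω + w ω))) (h' : Ann P F (fun ω => Real.exp (f' ω + w ω))) :
    f =ᵐ[P] f' := by
  have hb := (hF.bdd _ hf)
  have hb' := (hF.bdd _ hf')
  have hd := hF.sub _ _ hf hf'
  have h1 : ∫ ω, (f ω - f' ω) * (Real.exp (f ω + w ω) - Real.exp (f' ω + w ω)) ∂P = 0 := by
    simp_rw [mul_sub]
    rw [integral_sub ((hF.bdd _ hd).mul (hb.add hw).exp).integrable
      ((hF.bdd _ hd).mul (hb'.add hw).exp).integrable, h _ hd, h' _ hd, sub_self]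
  have h0 : ∀ ω, 0 ≤ (f ω - f' ω) * (Real.exp (f ω + w ω) - Real.exp (f' ω + w ω)) := by
    intro ω
    rcases le_total (f ω) (f' ω) with h | h
    · exact mul_nonneg_of_nonpos_of_nonpos (by linarith)
        (sub_nonpos.2 (Real.exp_le_exp.2 (by linarith)))
    · exact mul_nonneg (by linarith) (sub_nonneg.2 (Real.exp_le_exp.2 (by linarith)))
  rw [integral_eq_zero_iff_of_nonneg h0
    ((hF.bdd _ hd).mul ((hb.add hw).exp.sub (hb'.add hw).exp)).integrable] at h1
  filter_upwards [h1] with ω h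
  rcases mul_eq_zero.1 h with h | h
  · linarith
  · have := Real.exp_injective (sub_eq_zero.1 h); linarith

/-- Strong concavity of the dual functional. -/
lemma dual_strong_concave {K : ℝ} {h h' : Ω → ℝ} (hb : Bdd P h) (hb' : Bdd P h') (hc : Bdd P c)
    (hK : ∀ᵐ ω ∂P, |h ω - c ω| ≤ K) (hK' : ∀ᵐ ω ∂P, |h' ω - c ω| ≤ K) :
    ∫ ω, (h' ω - Real.exp (h' ω - c ω)) ∂P + Real.exp (-K) / 4 * ∫ ω, (h' ω - h ω) ^ 2 ∂P ≤
      ∫ ω, (h ω - Real.exp (h ω - c ω)) ∂P +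
        ∫ ω, (h' ω - h ω) * (1 - Real.exp (h ω - c ω)) ∂P := by
  have e := (hb.sub hc).exp
  have e' := (hb'.sub hc).exp
  have d := hb'.sub hb
  rw [← integral_const_mul, ← integral_add (hb'.sub e').integrable (d.sq.const_mul _).integrable,
    ← integral_add (hb.sub e).integrable (d.mul ((Bdd.const 1).sub e)).integrable]
  apply integral_mono_ae ((hb'.sub e').add (d.sq.const_mul _)).integrable
    ((hb.sub e).add (d.mul ((Bdd.const 1).sub e))).integrable
  filter_upwards [hK, hK'] with ω h1 h2
  have := exp_strong_convex h1 h2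
  have e2 : h' ω - c ω - (h ω - c ω) = h' ω - h ω := by ring
  rw [e2] at this
  nlinarith

lemma integral_mul_exp_sub_le {K s : ℝ} (hs : 0 < s) {h h' φ : Ω → ℝ} (hφ : Bdd P φ)
    (hb : Bdd P h) (hb' : Bdd P h') (hc : Bdd P c)
    (hK : ∀ᵐ ω ∂P, |h ω - c ω| ≤ K) (hK' : ∀ᵐ ω ∂P, |h' ω - c ω| ≤ K) :
    ∫ ω, φ ω * (Real.exp (h' ω - c ω) - Real.exp (h ω - c ω)) ∂P ≤
      Real.exp K * (s / 2 * ∫ ω, φ ω ^ 2 ∂P + 1 / (2 * s) * ∫ ω, (h' ω - h ω) ^ 2 ∂P) := by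
  have e := (hb.sub hc).exp
  have e' := (hb'.sub hc).exp
  have d := hb'.sub hb
  rw [← integral_const_mul, ← integral_const_mul, ← integral_add (hφ.sq.const_mul _).integrable
    (d.sq.const_mul _).integrable, ← integral_const_mul]
  apply integral_mono_ae (hφ.mul (e'.sub e)).integrable
    (((hφ.sq.const_mul _).add (d.sq.const_mul _)).const_mul _).integrable
  filter_upwards [hK, hK'] with ω h1 h2
  have := abs_exp_sub_exp_le h1 h2
  have e2 : h' ω - c ω - (h ω - c ω) = h' ω - h ω := by ring
  rw [e2] at this
  exact mul_le_young (Real.exp_pos _).le hs this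

end Dual

section Ascent

variable {Ω : Type*} [MeasurableSpace Ω] {P : Measure Ω} [IsProbabilityMeasure P]
  {F G : (Ω → ℝ) → Prop} {c : Ω → ℝ}

lemma Ann.integral_mul_one_sub {Z φ : Ω → ℝ} (hF : IsClass P F) (hZ : Bdd P Z) (h : Ann P F Z)
    (hφ : F φ) : ∫ ω, φ ω * (1 - Z ω) ∂P = 0 := by
  simp_rw [mul_sub, mul_one]
  rw [integral_sub (hF.bdd _ hφ).integrable ((hF.bdd _ hφ).mul hZ).integrable, h _ hφ, sub_self]

/-- The first order condition for a maximizer of the dual functional. -/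
lemma ann_of_optimal (hF : IsClass P F) {h : Ω → ℝ} (hb : Bdd P h) (hc : Bdd P c)
    (hopt : ∀ φ, F φ → ∫ ω, (h ω + φ ω - Real.exp (h ω + φ ω - c ω)) ∂P ≤
      ∫ ω, (h ω - Real.exp (h ω - c ω)) ∂P) :
    Ann P F (fun ω => Real.exp (h ω - c ω)) := by
  intro φ hφ
  have bφ := hF.bdd _ hφ
  obtain ⟨-, K1, hK1⟩ := hb.sub hc
  obtain ⟨-, K2, hK2⟩ := hF.bdd _ hφ
  have e := (hb.sub hc).exp
  set K := |K1| + |K2|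
  set X := ∫ ω, φ ω * (1 - Real.exp (h ω - c ω)) ∂P with hX
  set Y := Real.exp K * ∫ ω, φ ω ^ 2 ∂P with hY
  have key : ∀ s : ℝ, |s| ≤ 1 → s * X ≤ s ^ 2 * Y := by
    intro s hs
    have bs := bφ.const_mul s
    have h1 := hopt _ (hF.smul s _ hφ)
    have h2 : ∫ ω, (h ω - Real.exp (h ω - c ω)) ∂P + s * X - s ^ 2 * Y ≤
        ∫ ω, (h ω + s * φ ω - Real.exp (h ω + s * φ ω - c ω)) ∂P := by
      rw [hX, hY, ← integral_const_mul, ← integral_const_mul, ← integral_const_mul,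
        ← integral_add (hb.sub e).integrable
          ((bφ.mul ((Bdd.const 1).sub e)).const_mul s).integrable,
        ← integral_sub ((hb.sub e).add ((bφ.mul ((Bdd.const 1).sub e)).const_mul s)).integrable
          ((bφ.sq.const_mul _).const_mul _).integrable]
      apply integral_mono_ae (((hb.sub e).add
        ((bφ.mul ((Bdd.const 1).sub e)).const_mul s)).sub
          ((bφ.sq.const_mul _).const_mul _)).integrable
        ((hb.add bs).sub ((hb.add bs).sub hc).exp).integrable
      filter_upwards [hK1, hK2] with ω h3 h4
      have h5 : |h ω - c ω| ≤ K := by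
        have := le_abs_self K1; have := abs_nonneg K2; simp only [K]; linarith
      have h6 : |h ω + s * φ ω - c ω| ≤ K := by
        have e1 : h ω + s * φ ω - c ω = (h ω - c ω) + s * φ ω := by ring
        rw [e1]
        refine (abs_add_le _ _).trans (add_le_add (h3.trans (le_abs_self _)) ?_)
        rw [abs_mul]
        calc |s| * |φ ω| ≤ 1 * |φ ω| := by gcongr
          _ ≤ |K2| := by rw [one_mul]; exact h4.trans (le_abs_self _)
      have h7 := abs_exp_sub_exp_le h5 h6
      have h8 : Real.exp (h ω + s * φ ω - c ω) * (-(s * φ ω)) ≤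
          Real.exp (h ω - c ω) - Real.exp (h ω + s * φ ω - c ω) := by
        have e1 : Real.exp (h ω - c ω)
            = Real.exp (h ω + s * φ ω - c ω) * Real.exp (-(s * φ ω)) := by
          rw [← Real.exp_add]; ring_nf
        have := mul_le_mul_of_nonneg_left (Real.add_one_le_exp (-(s * φ ω)))
          (Real.exp_pos (h ω + s * φ ω - c ω)).le
        nlinarith
      have h9 : (Real.exp (h ω + s * φ ω - c ω) - Real.exp (h ω - c ω)) * (s * φ ω)
          ≤ Real.exp K * (s * φ ω) ^ 2 := by
        have e1 : h ω + s * φ ω - c ω - (h ω - c ω) = s * φ ω := by ring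
        rw [e1] at h7
        calc _ ≤ |Real.exp (h ω + s * φ ω - c ω) - Real.exp (h ω - c ω)| * |s * φ ω| := by
              rw [← abs_mul]; exact le_abs_self _
          _ ≤ (Real.exp K * |s * φ ω|) * |s * φ ω| := by gcongr
          _ = _ := by rw [mul_assoc, ← pow_two, sq_abs]
      nlinarith
    linarith
  have hX0 : X = 0 := by
    have hY0 : 0 ≤ Y := mul_nonneg (Real.exp_pos _).le (integral_nonneg fun ω => sq_nonneg _)
    by_contra hne
    have hXp : 0 < |X| := abs_pos.2 hne
    have hYp : 0 < Y + |X| + 1 := by positivity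
    set s := X / (Y + |X| + 1)
    have hs : |s| ≤ 1 := by
      simp only [s]; rw [abs_div, abs_of_pos hYp, div_le_one hYp]; linarith
    have h1 := key s hs
    have h2 : X = s * (Y + |X| + 1) := by simp only [s]; field_simp
    have h3 : s ≠ 0 := by intro h0; rw [h0, zero_mul] at h2; exact hne h2
    have h4 : 0 < s ^ 2 := by positivity
    have h5 : s * X = s ^ 2 * (Y + |X| + 1) := by
      calc s * X = s * (s * (Y + |X| + 1)) := by rw [← h2]
        _ = _ := by ring
    nlinarith
  change ∫ ω, φ ω * Real.exp (h ω - c ω) ∂P = ∫ ω, φ ω ∂P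
  rw [hX] at hX0
  simp_rw [mul_sub, mul_one] at hX0
  rw [integral_sub bφ.integrable (bφ.mul e).integrable] at hX0
  linarith

/-- The contraction factor of one cycle of alternating maximization. -/
def ascentRate (K : ℝ) : ℝ := 4 * Real.exp (4 * K) / (1 + 4 * Real.exp (4 * K))

lemma ascentRate_pos (K : ℝ) : 0 < ascentRate K := by unfold ascentRate; positivity

lemma ascentRate_lt_one (K : ℝ) : ascentRate K < 1 := by
  unfold ascentRate
  have := Real.exp_pos (4 * K)
  rw [div_lt_one (by positivity)]; linarith

lemma integral_centered_sq_le (hF : IsClass P F) (hG : IsClass P G) (hO : Orth P F G)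
    {φ ψ : Ω → ℝ} (hφ : F φ) (hψ : G ψ) :
    ∫ ω, (ψ ω - ∫ ω', ψ ω' ∂P) ^ 2 ∂P ≤ ∫ ω, (φ ω + ψ ω) ^ 2 ∂P := by
  have bφ := hF.bdd _ hφ
  have bψ := hG.bdd _ hψ
  set b := ∫ ω', ψ ω' ∂P with hb
  have hχ : F (fun ω => φ ω + b) := hF.add hφ (hF.const b)
  have hψ' : G (fun ω => ψ ω - b) := hG.sub _ _ hψ (hG.const b)
  have bχ := hF.bdd _ hχ
  have bψ' := hG.bdd _ hψ'
  have h0 : ∫ ω, (ψ ω - b) ∂P = 0 := by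
    rw [integral_sub bψ.integrable (Bdd.const b).integrable]; simp [hb]
  have h1 := hO _ _ hχ hψ'
  rw [h0, mul_zero] at h1
  have h2 : ∀ ω, (φ ω + ψ ω) ^ 2
      = (φ ω + b) ^ 2 + 2 * ((φ ω + b) * (ψ ω - b)) + (ψ ω - b) ^ 2 := fun ω => by ring
  simp_rw [h2]
  rw [integral_add (bχ.sq.add ((bχ.mul bψ').const_mul 2)).integrable bψ'.sq.integrable,
    integral_add bχ.sq.integrable ((bχ.mul bψ').const_mul 2).integrable, integral_const_mul, h1]
  have : 0 ≤ ∫ ω, (φ ω + b) ^ 2 ∂P := integral_nonneg fun ω => sq_nonneg _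
  linarith

/-- One cycle of alternating maximization contracts the dual gap. -/
lemma ascent_step {K : ℝ} (hF : IsClass P F) (hG : IsClass P G) (hO : Orth P F G)
    (hc : Bdd P c) {h hm h1 hs φ ψ : Ω → ℝ}
    (b : Bdd P h) (bm : Bdd P hm) (b1 : Bdd P h1) (bs : Bdd P hs)
    (hK : ∀ᵐ ω ∂P, |h ω - c ω| ≤ K) (hKm : ∀ᵐ ω ∂P, |hm ω - c ω| ≤ K)
    (hK1 : ∀ᵐ ω ∂P, |h1 ω - c ω| ≤ K) (hKs : ∀ᵐ ω ∂P, |hs ω - c ω| ≤ K)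
    (hF0 : F (fun ω => h ω - hm ω)) (hG1 : G (fun ω => hm ω - h1 ω))
    (hφ : F φ) (hψ : G ψ) (hd : ∀ᵐ ω ∂P, hs ω - hm ω = φ ω + ψ ω)
    (am : Ann P F (fun ω => Real.exp (hm ω - c ω)))
    (a1 : Ann P G (fun ω => Real.exp (h1 ω - c ω))) :
    ∫ ω, (hs ω - Real.exp (hs ω - c ω)) ∂P - ∫ ω, (h1 ω - Real.exp (h1 ω - c ω)) ∂P ≤
      ascentRate K * (∫ ω, (hs ω - Real.exp (hs ω - c ω)) ∂P
        - ∫ ω, (h ω - Real.exp (h ω - c ω)) ∂P) := by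
  have em := (bm.sub hc).exp
  have e1 := (b1.sub hc).exp
  have i0 := dual_strong_concave bm b hc hKm hK
  rw [am.integral_mul_one_sub hF em hF0] at i0
  have i1 := dual_strong_concave b1 bm hc hK1 hKm
  rw [a1.integral_mul_one_sub hG e1 hG1] at i1
  have is := dual_strong_concave bm bs hc hKm hKs
  have n0 : 0 ≤ ∫ ω, (h ω - hm ω) ^ 2 ∂P := integral_nonneg fun ω => sq_nonneg _
  set Q := ∫ ω, (hm ω - h1 ω) ^ 2 ∂P with hQ
  set S := ∫ ω, (hs ω - hm ω) ^ 2 ∂P with hS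
  set β := ∫ ω, ψ ω ∂P with hβ
  have bφ := hF.bdd _ hφ
  have bψ := hG.bdd _ hψ
  have hψ' : G (fun ω => ψ ω - β) := hG.sub _ _ hψ (hG.const β)
  have bψ' := hG.bdd _ hψ'
  have hS2 : ∫ ω, (ψ ω - β) ^ 2 ∂P ≤ S := by
    refine (integral_centered_sq_le hF hG hO hφ hψ).trans (le_of_eq ?_)
    apply integral_congr_ae
    filter_upwards [hd] with ω h; rw [h]
  have hgrad : ∫ ω, (hs ω - hm ω) * (1 - Real.exp (hm ω - c ω)) ∂P
      = ∫ ω, (ψ ω - β) * (Real.exp (h1 ω - c ω) - Real.exp (hm ω - c ω)) ∂P := by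
    have t1 : ∫ ω, (hs ω - hm ω) * (1 - Real.exp (hm ω - c ω)) ∂P
        = ∫ ω, ((φ ω + β) * (1 - Real.exp (hm ω - c ω))
          + (ψ ω - β) * (1 - Real.exp (hm ω - c ω))) ∂P := by
      apply integral_congr_ae
      filter_upwards [hd] with ω h; rw [h]; ring
    have t2 : ∫ ω, (ψ ω - β) * (Real.exp (h1 ω - c ω) - Real.exp (hm ω - c ω)) ∂P
        = ∫ ω, ((ψ ω - β) * (1 - Real.exp (hm ω - c ω))
          - (ψ ω - β) * (1 - Real.exp (h1 ω - c ω))) ∂P := by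
      congr 1; ext ω; ring
    have hφβ : F (fun ω => φ ω + β) := hF.add hφ (hF.const β)
    rw [t1, t2, integral_add ((hF.bdd _ hφβ).mul ((Bdd.const 1).sub em)).integrable
        (bψ'.mul ((Bdd.const 1).sub em)).integrable,
      integral_sub (bψ'.mul ((Bdd.const 1).sub em)).integrable
        (bψ'.mul ((Bdd.const 1).sub e1)).integrable,
      am.integral_mul_one_sub hF em hφβ, a1.integral_mul_one_sub hG e1 hψ']
    ring
  have hQ' : ∫ ω, (h1 ω - hm ω) ^ 2 ∂P = Q := by
    rw [hQ]; congr 1; ext ω; ring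
  have hy := integral_mul_exp_sub_le (K := K) (s := Real.exp (-K) * Real.exp (-K) / 2)
    (by positivity) bψ' bm b1 hc hKm hK1
  rw [hQ', ← hgrad] at hy
  have hE : Real.exp K * Real.exp (-K) = 1 := by rw [← Real.exp_add]; simp
  set x := Real.exp K with hx
  have hx0 : 0 < x := Real.exp_pos K
  have hEinv : Real.exp (-K) = x⁻¹ := by rw [Real.exp_neg]
  have hE4 : Real.exp (4 * K) = x ^ 4 := by rw [hx, ← Real.exp_nat_mul]; norm_num
  rw [hEinv] at hy is i0 i1
  have hy2 : ∫ ω, (hs ω - hm ω) * (1 - Real.exp (hm ω - c ω)) ∂P ≤ x⁻¹ / 4 * S + x ^ 3 * Q := by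
    refine hy.trans ?_
    have : x * (x⁻¹ * x⁻¹ / 2 / 2 * ∫ ω, (ψ ω - β) ^ 2 ∂P + 1 / (2 * (x⁻¹ * x⁻¹ / 2)) * Q)
        = x⁻¹ / 4 * ∫ ω, (ψ ω - β) ^ 2 ∂P + x ^ 3 * Q := by field_simp; ring
    rw [this]
    gcongr
  set Ds := ∫ ω, (hs ω - Real.exp (hs ω - c ω)) ∂P
  set D1 := ∫ ω, (h1 ω - Real.exp (h1 ω - c ω)) ∂P
  set Dm := ∫ ω, (hm ω - Real.exp (hm ω - c ω)) ∂P
  set D0 := ∫ ω, (h ω - Real.exp (h ω - c ω)) ∂P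
  have k0 : D0 ≤ Dm := by
    have : 0 ≤ x⁻¹ / 4 * ∫ ω, (h ω - hm ω) ^ 2 ∂P := by positivity
    linarith
  have k1 : Q ≤ 4 * x * (D1 - Dm) := by
    have : x⁻¹ / 4 * Q ≤ D1 - Dm := by linarith
    have h2 := mul_le_mul_of_nonneg_left this (show 0 ≤ 4 * x by positivity)
    have h3 : 4 * x * (x⁻¹ / 4 * Q) = Q := by field_simp
    linarith
  have k2 : Ds - Dm ≤ 4 * x ^ 4 * (D1 - Dm) := by
    have h2 := mul_le_mul_of_nonneg_left k1 (show 0 ≤ x ^ 3 by positivity)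
    have h3 : x ^ 3 * (4 * x * (D1 - Dm)) = 4 * x ^ 4 * (D1 - Dm) := by ring
    linarith
  unfold ascentRate
  rw [hE4, div_mul_eq_mul_div, le_div_iff₀ (by positivity)]
  have hx4 : 0 < x ^ 4 := by positivity
  have k3 : Dm ≤ D1 := by
    have : 0 ≤ Q := integral_nonneg fun ω => sq_nonneg _
    have : 0 ≤ x⁻¹ / 4 * Q := by positivity
    linarith
  nlinarith [mul_le_mul_of_nonneg_left k0 hx4.le, mul_le_mul_of_nonneg_left k3 hx4.le]

/-- Comparison of the dual gap with the primal objective values. -/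
lemma gap_comparison {K : ℝ} (hF : IsClass P F) (hG : IsClass P G)
    (hc : Bdd P c) {hk hs φ ψ : Ω → ℝ} {γ : ℝ}
    (bk : Bdd P hk) (bs : Bdd P hs)
    (hKk : ∀ᵐ ω ∂P, |hk ω - c ω| ≤ K) (hKs : ∀ᵐ ω ∂P, |hs ω - c ω| ≤ K)
    (hφ : F φ) (hψ : G ψ) (hd : ∀ᵐ ω ∂P, hk ω - γ = φ ω + ψ ω)
    (h1 : ∫ ω, Real.exp (hk ω - c ω) ∂P = 1)
    (aF : Ann P F (fun ω => Real.exp (hs ω - c ω)))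
    (aG : Ann P G (fun ω => Real.exp (hs ω - c ω))) {s : ℝ} (hs0 : 0 < s) :
    γ - ∫ ω, hk ω * Real.exp (hk ω - c ω) ∂P ≤ γ - ∫ ω, hk ω ∂P + Real.exp K *
      (s / 2 * ∫ ω, (hk ω - γ) ^ 2 ∂P + 1 / (2 * s) * ∫ ω, (hs ω - hk ω) ^ 2 ∂P) := by
  have ek := (bk.sub hc).exp
  have es := (bs.sub hc).exp
  have bφ := hF.bdd _ hφ
  have bψ := hG.bdd _ hψ
  have hy := integral_mul_exp_sub_le (K := K) hs0 (bk.sub (Bdd.const γ)) bk bs hc hKk hKs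
  have t : ∫ ω, (hk ω - γ) * (Real.exp (hs ω - c ω) - Real.exp (hk ω - c ω)) ∂P
      = ∫ ω, hk ω ∂P - ∫ ω, hk ω * Real.exp (hk ω - c ω) ∂P := by
    have t1 : ∫ ω, (hk ω - γ) * (Real.exp (hs ω - c ω) - Real.exp (hk ω - c ω)) ∂P
        = ∫ ω, (φ ω * Real.exp (hs ω - c ω) + ψ ω * Real.exp (hs ω - c ω)
          - (hk ω * Real.exp (hk ω - c ω) - γ * Real.exp (hk ω - c ω))) ∂P := by
      apply integral_congr_ae
      filter_upwards [hd] with ω h; rw [mul_sub, h, ← add_mul, ← sub_mul, h]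
    have t2 : ∫ ω, hk ω ∂P = ∫ ω, (φ ω + ψ ω + γ) ∂P := by
      apply integral_congr_ae
      filter_upwards [hd] with ω h; linarith
    rw [t1, t2, integral_sub ((bφ.mul es).add (bψ.mul es)).integrable
      ((bk.mul ek).sub (ek.const_mul γ)).integrable, integral_add (bφ.mul es).integrable
      (bψ.mul es).integrable, integral_sub (bk.mul ek).integrable (ek.const_mul γ).integrable,
      integral_const_mul, h1, aF _ hφ, aG _ hψ, integral_add (bφ.add bψ).integrable
      (Bdd.const γ).integrable, integral_add bφ.integrable bψ.integrable]
    simp; ring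
  rw [t] at hy
  linarith

end Ascent

section Rate

/-- Geometric decay without prefactor, from geometric decay with a prefactor and a uniform
decrease from the second term on. -/
lemma exists_rate {r A δ : ℝ} (hr0 : 0 < r) (hr1 : r < 1) (hδ0 : 0 < δ) (hδ1 : δ < 1) :
    ∃ ρ : ℝ, r ≤ ρ ∧ ρ < 1 ∧ ∀ (e : ℕ → ℝ) (Δ : ℝ), 0 ≤ Δ → e 0 ≤ Δ →
      (∀ k, e k ≤ A * r ^ k * Δ) → (∀ k, 1 ≤ k → e k ≤ (1 - δ) * Δ) →
      ∀ k, e k ≤ ρ ^ k * Δ := by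
  set q := Real.sqrt r with hq
  have hq0 : 0 < q := Real.sqrt_pos.2 hr0
  have hqq : q * q = r := Real.mul_self_sqrt hr0.le
  have hq1 : q < 1 := by nlinarith
  have hrq : r ≤ q := by nlinarith
  have ht : Tendsto (fun k : ℕ => A * q ^ k) atTop (𝓝 (A * 0)) :=
    (tendsto_pow_atTop_nhds_zero_of_lt_one hq0.le hq1).const_mul A
  rw [mul_zero] at ht
  obtain ⟨k0, hk0⟩ := eventually_atTop.1 (ht.eventually (gt_mem_nhds (zero_lt_one)))
  set p := 1 + -(δ / (k0 + 1)) with hp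
  have hk1 : (0 : ℝ) < k0 + 1 := by positivity
  have hd : 0 < δ / (k0 + 1) := by positivity
  have hd1 : δ / (k0 + 1) ≤ δ := div_le_self hδ0.le (by linarith [(Nat.cast_nonneg k0 : (0:ℝ) ≤ k0)])
  refine ⟨max q p, hrq.trans (le_max_left _ _), max_lt hq1 (by linarith), ?_⟩
  intro e Δ hΔ h0 h1 h2 k
  rcases Nat.eq_zero_or_pos k with rfl | hk
  · simpa using h0
  rcases le_total k0 k with hkk | hkk
  · refine (h1 k).trans (mul_le_mul_of_nonneg_right ?_ hΔ)
    calc A * r ^ k = (A * q ^ k) * q ^ k := by rw [← hqq, mul_pow]; ring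
      _ ≤ 1 * q ^ k := by gcongr; exact (hk0 k hkk).le
      _ ≤ max q p ^ k := by rw [one_mul]; gcongr; exact le_max_left _ _
  · refine (h2 k hk).trans (mul_le_mul_of_nonneg_right ?_ hΔ)
    have hb := one_add_mul_le_pow (a := -(δ / (k0 + 1))) (by linarith) k
    have hle : (k : ℝ) * (δ / (k0 + 1)) ≤ δ := by
      rw [mul_div_assoc', div_le_iff₀ hk1]
      have : (k : ℝ) ≤ k0 := by exact_mod_cast hkk
      nlinarith
    have hp0 : 0 ≤ p := by linarith
    calc 1 - δ ≤ p ^ k := by linarith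
      _ ≤ max q p ^ k := by gcongr; exact le_max_right _ _

variable {Ω : Type*} [MeasurableSpace Ω] {P : Measure Ω} [IsProbabilityMeasure P]
  {F G : (Ω → ℝ) → Prop} {c : Ω → ℝ}

lemma integral_mul_exp_ge {K γ : ℝ} {h : Ω → ℝ} (hb : Bdd P h) (hc : Bdd P c)
    (hK : ∀ᵐ ω ∂P, |h ω - c ω| ≤ K) (hγ : ∀ᵐ ω ∂P, |γ - c ω| ≤ K)
    (h1 : ∫ ω, Real.exp (h ω - c ω) ∂P = 1) (h0 : ∫ ω, Real.exp (γ - c ω) ∂P = 1) :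
    γ + Real.exp (-K) / 4 * ∫ ω, (h ω - γ) ^ 2 ∂P ≤ ∫ ω, h ω * Real.exp (h ω - c ω) ∂P := by
  have e := (hb.sub hc).exp
  have e0 := ((Bdd.const γ).sub hc).exp
  have bu := hb.sub (Bdd.const γ)
  have : ∫ ω, (Real.exp (h ω - c ω) - h ω * Real.exp (h ω - c ω) + γ * Real.exp (h ω - c ω)
      + Real.exp (-K) / 4 * (h ω - γ) ^ 2) ∂P ≤ ∫ ω, Real.exp (γ - c ω) ∂P := by
    apply integral_mono_ae (((e.sub (hb.mul e)).add (e.const_mul γ)).add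
      (bu.sq.const_mul _)).integrable e0.integrable
    filter_upwards [hK, hγ] with ω h2 h3
    have := exp_strong_convex h2 h3
    have e2 : γ - c ω - (h ω - c ω) = -(h ω - γ) := by ring
    rw [e2] at this
    nlinarith
  rw [integral_add ((e.sub (hb.mul e)).add (e.const_mul γ)).integrable
    (bu.sq.const_mul _).integrable, integral_add (e.sub (hb.mul e)).integrable
    (e.const_mul γ).integrable, integral_sub e.integrable (hb.mul e).integrable,
    integral_const_mul, integral_const_mul, h1, h0] at this
  linarith

lemma integral_sub_const_le {K γ s : ℝ} (hF : IsClass P F) (hG : IsClass P G)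
    {h hs φ ψ : Ω → ℝ} (hs0 : 0 < s) (hb : Bdd P h) (bs : Bdd P hs) (hc : Bdd P c)
    (hKs : ∀ᵐ ω ∂P, |hs ω - c ω| ≤ K) (hγ : ∀ᵐ ω ∂P, |γ - c ω| ≤ K)
    (hφ : F φ) (hψ : G ψ) (hd : ∀ᵐ ω ∂P, h ω - γ = φ ω + ψ ω)
    (h1 : ∫ ω, Real.exp (h ω - c ω) ∂P = 1) (h0 : ∫ ω, Real.exp (γ - c ω) ∂P = 1)
    (aF : Ann P F (fun ω => Real.exp (hs ω - c ω)))
    (aG : Ann P G (fun ω => Real.exp (hs ω - c ω))) :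
    ∫ ω, (h ω - γ) ∂P ≤ Real.exp K * (s / 2 * ∫ ω, (h ω - γ) ^ 2 ∂P
      + 1 / (2 * s) * ∫ ω, (hs ω - γ) ^ 2 ∂P) := by
  have e := (hb.sub hc).exp
  have e0 := ((Bdd.const γ).sub hc).exp
  have es := (bs.sub hc).exp
  have bu := hb.sub (Bdd.const γ)
  have bφ := hF.bdd _ hφ
  have bψ := hG.bdd _ hψ
  have hy := integral_mul_exp_sub_le (K := K) hs0 bu (Bdd.const γ) bs hc hγ hKs
  refine le_trans ?_ hy
  have t1 : ∫ ω, (h ω - γ) * Real.exp (γ - c ω) ∂P ≤ 0 := by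
    have : ∫ ω, (h ω - γ) * Real.exp (γ - c ω) ∂P
        ≤ ∫ ω, (Real.exp (h ω - c ω) - Real.exp (γ - c ω)) ∂P := by
      apply integral_mono (bu.mul e0).integrable (e.sub e0).integrable
      intro ω
      have e1 : Real.exp (h ω - c ω) = Real.exp (γ - c ω) * Real.exp (h ω - γ) := by
        rw [← Real.exp_add]; ring_nf
      have := mul_le_mul_of_nonneg_left (Real.add_one_le_exp (h ω - γ))
        (Real.exp_pos (γ - c ω)).le
      simp only
      nlinarith
    rwa [integral_sub e.integrable e0.integrable, h1, h0, sub_self] at this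
  have t2 : ∫ ω, (h ω - γ) * Real.exp (hs ω - c ω) ∂P = ∫ ω, (h ω - γ) ∂P := by
    have s1 : ∫ ω, (h ω - γ) * Real.exp (hs ω - c ω) ∂P
        = ∫ ω, (φ ω * Real.exp (hs ω - c ω) + ψ ω * Real.exp (hs ω - c ω)) ∂P := by
      apply integral_congr_ae
      filter_upwards [hd] with ω h; rw [h, add_mul]
    have s2 : ∫ ω, (h ω - γ) ∂P = ∫ ω, (φ ω + ψ ω) ∂P := integral_congr_ae hd
    rw [s1, s2, integral_add (bφ.mul es).integrable (bψ.mul es).integrable,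
      integral_add bφ.integrable bψ.integrable, aF _ hφ, aG _ hψ]
  simp_rw [mul_sub]
  rw [integral_sub (bu.mul es).integrable (bu.mul e0).integrable, t2]
  linarith

/-- The contraction factor for the primal objective values is the square root of the dual one. -/
def primalRate (K : ℝ) : ℝ := Real.sqrt (ascentRate K)

/-- A sequence of alternating maximizers of the dual functional. -/
structure IsAlternating (P : Measure Ω) (F G : (Ω → ℝ) → Prop) (c : Ω → ℝ) (K γ : ℝ)
    (hs : Ω → ℝ) (h hm : ℕ → Ω → ℝ) : Prop where
  classF : IsClass P F
  classG : IsClass P G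
  orth : Orth P F G
  bddc : Bdd P c
  bdds : Bdd P hs
  bdd : ∀ k, Bdd P (h k)
  bddm : ∀ k, Bdd P (hm k)
  les : ∀ᵐ ω ∂P, |hs ω - c ω| ≤ K
  le : ∀ k, ∀ᵐ ω ∂P, |h k ω - c ω| ≤ K
  lem : ∀ k, ∀ᵐ ω ∂P, |hm k ω - c ω| ≤ K
  decs : ∃ φ ψ, F φ ∧ G ψ ∧ ∀ᵐ ω ∂P, hs ω = φ ω + ψ ω
  dec : ∀ k, ∃ φ ψ, F φ ∧ G ψ ∧ ∀ᵐ ω ∂P, h k ω = φ ω + ψ ω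
  decm : ∀ k, ∃ φ ψ, F φ ∧ G ψ ∧ ∀ᵐ ω ∂P, hm k ω = φ ω + ψ ω
  subF : ∀ k, F (fun ω => h k ω - hm k ω)
  subG : ∀ k, G (fun ω => hm k ω - h (k + 1) ω)
  annF : ∀ k, Ann P F (fun ω => Real.exp (hm k ω - c ω))
  annG : ∀ k, Ann P G (fun ω => Real.exp (h (k + 1) ω - c ω))
  annFs : Ann P F (fun ω => Real.exp (hs ω - c ω))
  annGs : Ann P G (fun ω => Real.exp (hs ω - c ω))
  init : ∀ᵐ ω ∂P, h 0 ω = γ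
  one : ∫ ω, Real.exp (h 0 ω - c ω) ∂P = 1

section

omit [IsProbabilityMeasure P] in
lemma IsClass.exists_sub (hF : IsClass P F) (hG : IsClass P G) {h h' : Ω → ℝ}
    (d : ∃ φ ψ, F φ ∧ G ψ ∧ ∀ᵐ ω ∂P, h ω = φ ω + ψ ω)
    (d' : ∃ φ ψ, F φ ∧ G ψ ∧ ∀ᵐ ω ∂P, h' ω = φ ω + ψ ω) :
    ∃ φ ψ, F φ ∧ G ψ ∧ ∀ᵐ ω ∂P, h ω - h' ω = φ ω + ψ ω := by
  obtain ⟨φ, ψ, hφ, hψ, hd⟩ := d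
  obtain ⟨φ', ψ', hφ', hψ', hd'⟩ := d'
  refine ⟨_, _, hF.sub _ _ hφ hφ', hG.sub _ _ hψ hψ', ?_⟩
  filter_upwards [hd, hd'] with ω h h'
  rw [h, h']; ring

variable {K γ : ℝ} {hs : Ω → ℝ} {h hm : ℕ → Ω → ℝ} (H : IsAlternating P F G c K γ hs h hm)
include H

lemma IsAlternating.integral_exp (k : ℕ) : ∫ ω, Real.exp (h k ω - c ω) ∂P = 1 := by
  cases k with
  | zero => exact H.one
  | succ k => exact (H.annG k).integral_eq_one H.classG

lemma IsAlternating.integral_dual (k : ℕ) :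
    ∫ ω, (h k ω - Real.exp (h k ω - c ω)) ∂P = ∫ ω, h k ω ∂P - 1 := by
  rw [integral_sub (H.bdd k).integrable ((H.bdd k).sub H.bddc).exp.integrable, H.integral_exp]

lemma IsAlternating.integral_dual_star :
    ∫ ω, (hs ω - Real.exp (hs ω - c ω)) ∂P = ∫ ω, hs ω ∂P - 1 := by
  rw [integral_sub H.bdds.integrable (H.bdds.sub H.bddc).exp.integrable,
    H.annFs.integral_eq_one H.classF]

lemma IsAlternating.gap_le (k : ℕ) :
    ∫ ω, hs ω ∂P - ∫ ω, h k ω ∂P ≤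
      ascentRate K ^ k * (∫ ω, hs ω ∂P - ∫ ω, h 0 ω ∂P) := by
  induction k with
  | zero => simp
  | succ k ih =>
    obtain ⟨φ, ψ, hφ, hψ, hd⟩ := H.classF.exists_sub H.classG H.decs (H.decm k)
    have := ascent_step H.classF H.classG H.orth H.bddc (H.bdd k) (H.bddm k) (H.bdd (k + 1))
      H.bdds (H.le k) (H.lem k) (H.le (k + 1)) H.les (H.subF k) (H.subG k) hφ hψ hd (H.annF k)
      (H.annG k)
    rw [H.integral_dual, H.integral_dual, H.integral_dual_star] at this
    have h2 := mul_le_mul_of_nonneg_left ih (ascentRate_pos K).le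
    rw [pow_succ']
    linarith

lemma IsAlternating.sq_le (k : ℕ) :
    ∫ ω, (hs ω - h k ω) ^ 2 ∂P ≤
      4 * Real.exp K * (∫ ω, hs ω ∂P - ∫ ω, h k ω ∂P) := by
  have i := dual_strong_concave H.bdds (H.bdd k) H.bddc H.les (H.le k)
  obtain ⟨φ, ψ, hφ, hψ, hd⟩ := H.classF.exists_sub H.classG (H.dec k) H.decs
  have es := (H.bdds.sub H.bddc).exp
  have bφ := H.classF.bdd _ hφ
  have bψ := H.classG.bdd _ hψ
  have t : ∫ ω, (h k ω - hs ω) * (1 - Real.exp (hs ω - c ω)) ∂P = 0 := by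
    have t1 : ∫ ω, (h k ω - hs ω) * (1 - Real.exp (hs ω - c ω)) ∂P
        = ∫ ω, (φ ω * (1 - Real.exp (hs ω - c ω)) + ψ ω * (1 - Real.exp (hs ω - c ω))) ∂P := by
      apply integral_congr_ae
      filter_upwards [hd] with ω h; rw [h, add_mul]
    rw [t1, integral_add (bφ.mul ((Bdd.const 1).sub es)).integrable
      (bψ.mul ((Bdd.const 1).sub es)).integrable, H.annFs.integral_mul_one_sub H.classF es hφ,
      H.annGs.integral_mul_one_sub H.classG es hψ, add_zero]
  have t2 : ∫ ω, (h k ω - hs ω) ^ 2 ∂P = ∫ ω, (hs ω - h k ω) ^ 2 ∂P := by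
    congr 1; ext ω; ring
  rw [t, t2, H.integral_dual, H.integral_dual_star] at i
  set S := ∫ ω, (hs ω - h k ω) ^ 2 ∂P
  have hE : Real.exp K * Real.exp (-K) = 1 := by rw [← Real.exp_add]; simp
  have h2 := mul_le_mul_of_nonneg_left i (show 0 ≤ 4 * Real.exp K by positivity)
  have h3 : 4 * Real.exp K * (Real.exp (-K) / 4 * S) = S := by
    calc _ = (Real.exp K * Real.exp (-K)) * S := by ring
      _ = S := by rw [hE, one_mul]
  linarith

lemma IsAlternating.integral_init : ∫ ω, h 0 ω ∂P = γ := by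
  rw [integral_congr_ae H.init]; simp

omit [IsProbabilityMeasure P] in
lemma IsAlternating.integral_exp_const : ∫ ω, Real.exp (γ - c ω) ∂P = 1 := by
  rw [← H.one]
  apply integral_congr_ae
  filter_upwards [H.init] with ω h; rw [h]

omit [IsProbabilityMeasure P] in
lemma IsAlternating.const_le : ∀ᵐ ω ∂P, |γ - c ω| ≤ K := by
  filter_upwards [H.init, H.le 0] with ω h h'; rwa [h] at h'

lemma IsAlternating.gap_nonneg (k : ℕ) : 0 ≤ ∫ ω, hs ω ∂P - ∫ ω, h k ω ∂P := by
  have h1 : 0 ≤ ∫ ω, (hs ω - h k ω) ^ 2 ∂P := integral_nonneg fun ω => sq_nonneg _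
  have h2 := h1.trans (H.sq_le k)
  exact nonneg_of_mul_nonneg_right h2 (by positivity)

omit [IsProbabilityMeasure P] in
lemma IsAlternating.dec_sub_const (k : ℕ) :
    ∃ φ ψ, F φ ∧ G ψ ∧ ∀ᵐ ω ∂P, h k ω - γ = φ ω + ψ ω := by
  obtain ⟨φ, ψ, hφ, hψ, hd⟩ := H.classF.exists_sub H.classG (H.dec k) (H.dec 0)
  refine ⟨φ, ψ, hφ, hψ, ?_⟩
  filter_upwards [hd, H.init] with ω h h'
  rw [← h', h]

lemma IsAlternating.star_sub_const_sq_le :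
    ∫ ω, (hs ω - γ) ^ 2 ∂P ≤ 4 * Real.exp K * (∫ ω, hs ω ∂P - γ) := by
  have := H.sq_le 0
  rw [H.integral_init] at this
  refine le_trans (le_of_eq ?_) this
  apply integral_congr_ae
  filter_upwards [H.init] with ω h; rw [h]

lemma IsAlternating.primal_gap_le (k : ℕ) :
    ∫ ω, hs ω ∂P - ∫ ω, h k ω * Real.exp (h k ω - c ω) ∂P ≤
      (1 + 10 * Real.exp K ^ 2) * primalRate K ^ k * (∫ ω, hs ω ∂P - γ) := by
  set x := Real.exp K with hx
  set Δ := ∫ ω, hs ω ∂P - γ with hΔ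
  set r := primalRate K with hr
  have hx0 : 0 < x := Real.exp_pos K
  have hr0 : 0 < r := Real.sqrt_pos.2 (ascentRate_pos K)
  have hrr : r * r = ascentRate K := Real.mul_self_sqrt (ascentRate_pos K).le
  have hr1 : r ≤ 1 := by have := ascentRate_lt_one K; nlinarith
  have hrk : ascentRate K ^ k = r ^ k * r ^ k := by rw [← hrr, mul_pow]
  have hrk0 : 0 < r ^ k := by positivity
  have hrk1 : r ^ k ≤ 1 := pow_le_one₀ hr0.le hr1
  have g := H.gap_le k
  rw [H.integral_init, hrk] at g
  have hΔ0 : 0 ≤ Δ := by have := H.gap_nonneg 0; rwa [H.integral_init] at this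
  have S := H.sq_le k
  have S0 := H.star_sub_const_sq_le
  obtain ⟨φ, ψ, hφ, hψ, hd⟩ := H.dec_sub_const k
  have cmp := gap_comparison H.classF H.classG H.bddc (H.bdd k) H.bdds (H.le k) H.les hφ hψ hd
    (H.integral_exp k) H.annFs H.annGs hrk0
  have U : ∫ ω, (h k ω - γ) ^ 2 ∂P ≤ 2 * ∫ ω, (hs ω - h k ω) ^ 2 ∂P
      + 2 * ∫ ω, (hs ω - γ) ^ 2 ∂P := by
    have b1 := (H.bdds.sub (H.bdd k)).sq.const_mul 2
    have b2 := (H.bdds.sub (Bdd.const γ)).sq.const_mul 2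
    rw [← integral_const_mul, ← integral_const_mul, ← integral_add b1.integrable b2.integrable]
    apply integral_mono ((H.bdd k).sub (Bdd.const γ)).sq.integrable (b1.add b2).integrable
    intro ω
    simp only
    nlinarith [sq_nonneg (hs ω - h k ω + (hs ω - γ))]
  set Sk := ∫ ω, (hs ω - h k ω) ^ 2 ∂P
  set Sg := ∫ ω, (hs ω - γ) ^ 2 ∂P
  set Uk := ∫ ω, (h k ω - γ) ^ 2 ∂P
  set d := ∫ ω, hs ω ∂P - ∫ ω, h k ω ∂P with hd'
  set R := r ^ k
  have S' : Sk ≤ 4 * x * (R * R * Δ) := S.trans (by gcongr)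
  have RR : R * R * Δ ≤ R * Δ := by
    have : R * R ≤ R := by nlinarith
    gcongr
  have RΔ : R * Δ ≤ Δ := by nlinarith
  have U' : Uk ≤ 16 * x * Δ := by
    have : 4 * x * (R * R * Δ) ≤ 4 * x * Δ := by gcongr; linarith
    linarith
  have k1 : R / 2 * Uk ≤ R / 2 * (16 * x * Δ) := by gcongr
  have k2 : 1 / (2 * R) * Sk ≤ 1 / (2 * R) * (4 * x * (R * R * Δ)) := by gcongr
  have k3 : 1 / (2 * R) * (4 * x * (R * R * Δ)) = 2 * x * R * Δ := by field_simp; ring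
  have k4 : x * (R / 2 * Uk + 1 / (2 * R) * Sk) ≤ x * (R / 2 * (16 * x * Δ) + 2 * x * R * Δ) := by
    exact mul_le_mul_of_nonneg_left (by linarith) hx0.le
  have k5 : x * (R / 2 * (16 * x * Δ) + 2 * x * R * Δ) = 10 * x ^ 2 * R * Δ := by ring
  have k6 : (1 + 10 * x ^ 2) * R * Δ = R * Δ + 10 * x ^ 2 * R * Δ := by ring
  linarith

/-- The uniform decrease of the primal gap after at least one cycle. -/
def gapDrop (K : ℝ) : ℝ := (1 - ascentRate K) ^ 2 / (16 * Real.exp K ^ 4)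

omit H in
lemma gapDrop_pos (K : ℝ) : 0 < gapDrop K := by
  have := ascentRate_lt_one K
  have : 0 < 1 - ascentRate K := by linarith
  unfold gapDrop; positivity

lemma IsAlternating.primal_gap_le_drop {k : ℕ} (hk : 1 ≤ k) :
    ∫ ω, hs ω ∂P - ∫ ω, h k ω * Real.exp (h k ω - c ω) ∂P ≤
      (1 - gapDrop K) * (∫ ω, hs ω ∂P - γ) := by
  set x := Real.exp K with hx
  set Δ := ∫ ω, hs ω ∂P - γ with hΔ
  set a := 1 - ascentRate K with ha
  have hx0 : 0 < x := Real.exp_pos K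
  have ha0 : 0 < a := by have := ascentRate_lt_one K; linarith
  have hΔ0 : 0 ≤ Δ := by have := H.gap_nonneg 0; rwa [H.integral_init] at this
  have g := H.gap_le k
  rw [H.integral_init] at g
  have hp : ascentRate K ^ k ≤ ascentRate K :=
    pow_le_of_le_one (ascentRate_pos K).le (ascentRate_lt_one K).le (by omega)
  have g' : a * Δ ≤ ∫ ω, h k ω ∂P - γ := by
    have := mul_le_mul_of_nonneg_right hp hΔ0
    have e : a * Δ = Δ - ascentRate K * Δ := by rw [ha]; ring
    linarith
  obtain ⟨φ, ψ, hφ, hψ, hd⟩ := H.dec_sub_const k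
  have S0 := H.star_sub_const_sq_le
  have up := integral_sub_const_le (s := 4 * x ^ 2 / a) H.classF H.classG (by positivity) (H.bdd k)
    H.bdds H.bddc H.les H.const_le hφ hψ hd (H.integral_exp k) H.integral_exp_const H.annFs H.annGs
  rw [integral_sub (H.bdd k).integrable (Bdd.const γ).integrable] at up
  simp only [integral_const, probReal_univ, one_smul] at up
  have lo := integral_mul_exp_ge (H.bdd k) H.bddc (H.le k) H.const_le (H.integral_exp k)
    H.integral_exp_const
  set Sg := ∫ ω, (hs ω - γ) ^ 2 ∂P
  set U := ∫ ω, (h k ω - γ) ^ 2 ∂P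
  rw [Real.exp_neg, ← hx] at lo
  rw [← hx] at up S0
  have k1 : x * (4 * x ^ 2 / a / 2 * U + 1 / (2 * (4 * x ^ 2 / a)) * Sg)
      = 2 * x ^ 3 / a * U + a / (8 * x) * Sg := by field_simp; ring
  have k2 : a / (8 * x) * Sg ≤ a / (8 * x) * (4 * x * Δ) := by gcongr
  have k3 : a / (8 * x) * (4 * x * Δ) = a / 2 * Δ := by field_simp; ring
  have k4 : a / 2 * Δ ≤ 2 * x ^ 3 / a * U := by linarith
  have k5 : gapDrop K * Δ ≤ x⁻¹ / 4 * U := by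
    have := mul_le_mul_of_nonneg_left k4 (show 0 ≤ a / (8 * x ^ 4) by positivity)
    have e1 : a / (8 * x ^ 4) * (a / 2 * Δ) = gapDrop K * Δ := by
      unfold gapDrop; rw [← ha, ← hx]; field_simp; ring
    have e2 : a / (8 * x ^ 4) * (2 * x ^ 3 / a * U) = x⁻¹ / 4 * U := by field_simp; ring
    linarith
  have k6 : (1 - gapDrop K) * Δ = Δ - gapDrop K * Δ := by ring
  linarith

end

/-- Linear convergence of alternating maximization, with constants depending on a bound of the
iterates only. -/
theorem exists_rate_alternating.{w} (K : ℝ) : ∃ ρ : ℝ, 0 < ρ ∧ ρ < 1 ∧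
    ∀ {Ω : Type w} [MeasurableSpace Ω] {P : Measure Ω} [IsProbabilityMeasure P]
      {F G : (Ω → ℝ) → Prop} {c : Ω → ℝ} {γ : ℝ} {hs : Ω → ℝ} {h hm : ℕ → Ω → ℝ},
      IsAlternating P F G c K γ hs h hm → ∀ k,
        ∫ ω, hs ω ∂P - ∫ ω, h k ω * Real.exp (h k ω - c ω) ∂P ≤
          ρ ^ k * (∫ ω, hs ω ∂P - ∫ ω, h 0 ω * Real.exp (h 0 ω - c ω) ∂P) ∧
        ∫ ω, (h k ω - hs ω) ^ 2 ∂P ≤ 4 * Real.exp K *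
          ρ ^ k * (∫ ω, hs ω ∂P - ∫ ω, h 0 ω * Real.exp (h 0 ω - c ω) ∂P) := by
  have hr0 : 0 < primalRate K := Real.sqrt_pos.2 (ascentRate_pos K)
  have hrr : primalRate K * primalRate K = ascentRate K := Real.mul_self_sqrt (ascentRate_pos K).le
  have hr1 : primalRate K < 1 := by have := ascentRate_lt_one K; nlinarith
  obtain ⟨ρ, hρ, hρ1, hr⟩ := exists_rate (A := 1 + 10 * Real.exp K ^ 2)
    (δ := min (gapDrop K) (1 / 2)) hr0 hr1 (lt_min (gapDrop_pos K) (by norm_num))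
    (lt_of_le_of_lt (min_le_right _ _) (by norm_num))
  have hρ0 : 0 < ρ := hr0.trans_le hρ
  refine ⟨ρ, hρ0, hρ1, ?_⟩
  intro Ω _ P _ F G c γ hs h hm H k
  have hE0 : ∫ ω, h 0 ω * Real.exp (h 0 ω - c ω) ∂P = γ := by
    have : ∫ ω, h 0 ω * Real.exp (h 0 ω - c ω) ∂P = ∫ ω, γ * Real.exp (γ - c ω) ∂P := by
      apply integral_congr_ae
      filter_upwards [H.init] with ω h; rw [h]
    rw [this, integral_const_mul, H.integral_exp_const, mul_one]
  have hΔ0 : 0 ≤ ∫ ω, hs ω ∂P - γ := by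
    have := H.gap_nonneg 0; rwa [H.integral_init] at this
  rw [hE0]
  refine ⟨hr (fun k => ∫ ω, hs ω ∂P - ∫ ω, h k ω * Real.exp (h k ω - c ω) ∂P) _ hΔ0
    (by simp only [hE0]; exact le_rfl) (H.primal_gap_le) (fun k hk => ?_) k, ?_⟩
  · refine (H.primal_gap_le_drop hk).trans (mul_le_mul_of_nonneg_right ?_ hΔ0)
    linarith [min_le_left (gapDrop K) (1 / 2)]
  · have t2 : ∫ ω, (h k ω - hs ω) ^ 2 ∂P = ∫ ω, (hs ω - h k ω) ^ 2 ∂P := by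
      congr 1; ext ω; ring
    have g := H.gap_le k
    rw [H.integral_init] at g
    have hle : ascentRate K ^ k ≤ ρ ^ k := by
      apply pow_le_pow_left₀ (ascentRate_pos K).le
      nlinarith
    rw [t2, mul_assoc]
    refine (H.sq_le k).trans ?_
    have := mul_le_mul_of_nonneg_right hle hΔ0
    gcongr
    linarith

end Rate

section Entropy

open InformationTheory

variable {Ω : Type*} [MeasurableSpace Ω] {P π σ : Measure Ω} {w : Ω → ℝ}

lemma KL_eq_klDiv [IsProbabilityMeasure π] [IsProbabilityMeasure P] : KL π P = klDiv π P := by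
  unfold KL
  rw [klDiv_def]
  simp

lemma ac_of_KL_ne_top (h : KL π P ≠ ⊤) : π ≪ P := by
  unfold KL at h
  by_contra hac
  exact h (if_neg fun h' => hac h'.1)

lemma toReal_KL_tilted [IsProbabilityMeasure π] [IsProbabilityMeasure P] (hw : Bdd P w)
    (h : KL π P ≠ ⊤) : KL π (P.tilted w) ≠ ⊤ ∧
      (KL π (P.tilted w)).toReal
        = (KL π P).toReal - ∫ ω, w ω ∂π + Real.log (∫ ω, Real.exp (w ω) ∂P) := by
  have hi := hw.exp.integrable
  have := isProbabilityMeasure_tilted hi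
  have hac : π ≪ P := ac_of_KL_ne_top h
  have hint : Integrable (llr π P) π := by
    unfold KL at h
    by_contra hac
    exact h (if_neg fun h' => hac h'.2)
  have hwπ := (hw.mono_ac hac).integrable
  have hac' : π ≪ P.tilted w := hac.trans (absolutelyContinuous_tilted hi)
  have hint' := integrable_llr_tilted_right hac hwπ hint hi
  constructor
  · unfold KL
    rw [if_pos ⟨hac', hint'⟩]
    exact ENNReal.ofReal_ne_top
  · rw [KL_eq_klDiv, KL_eq_klDiv, toReal_klDiv_of_measure_eq hac' (by simp),
      toReal_klDiv_of_measure_eq hac (by simp), integral_llr_tilted_right hac hwπ hi hint]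

lemma tilted_tilted_neg [IsProbabilityMeasure P] (hw : Bdd P w) :
    (P.tilted w).tilted (fun ω => -w ω) = P := by
  have := tilted_neg_same hw.exp.integrable
  exact this

lemma KL_self [IsProbabilityMeasure P] : KL P P = 0 := by rw [KL_eq_klDiv, klDiv_self]

lemma KL_tilted_ne_top [IsProbabilityMeasure P] (hw : Bdd P w) : KL (P.tilted w) P ≠ ⊤ := by
  have := isProbabilityMeasure_tilted hw.exp.integrable
  have h := (toReal_KL_tilted (π := P.tilted w) (P := P.tilted w) (w := fun ω => -w ω)
    (hw.mono_ac (tilted_absolutelyContinuous P w)).neg (by rw [KL_self]; simp)).1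
  rwa [tilted_tilted_neg hw] at h

lemma eq_of_toReal_KL_le [IsProbabilityMeasure π] [IsProbabilityMeasure P] (h : KL π P ≠ ⊤)
    (h0 : (KL π P).toReal ≤ 0) : π = P := by
  have : KL π P = 0 := by
    rcases (ENNReal.toReal_eq_zero_iff _).1 (le_antisymm h0 ENNReal.toReal_nonneg) with h1 | h1
    · exact h1
    · exact absurd h1 h
  rw [KL_eq_klDiv] at this
  exact klDiv_eq_zero_iff.1 this

/-- A tilted measure is the entropic projection if the tilting function has constant
expectation on the set that one projects on. -/
lemma eq_tilted_of_KL_le [IsProbabilityMeasure P] (hw : Bdd P w)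
    (hσ : KL σ P ≤ KL (P.tilted w) P) (hprob : σ ≪ P → IsProbabilityMeasure σ)
    (hint : σ ≪ P → ∫ ω, w ω ∂σ = ∫ ω, w ω ∂(P.tilted w)) : σ = P.tilted w := by
  have htop := KL_tilted_ne_top hw
  have hσtop : KL σ P ≠ ⊤ := ne_top_of_le_ne_top htop hσ
  have hac := ac_of_KL_ne_top hσtop
  have := hprob hac
  have := isProbabilityMeasure_tilted hw.exp.integrable
  obtain ⟨h1, h2⟩ := toReal_KL_tilted hw hσtop
  obtain ⟨-, h4⟩ := toReal_KL_tilted hw htop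
  rw [KL_self] at h4
  apply eq_of_toReal_KL_le h1
  have h5 := ENNReal.toReal_mono htop hσ
  have h6 := hint hac
  simp only [ENNReal.toReal_zero] at h4
  linarith

/-- The Gibbs measure with log-density `w`. -/
def gibbs (P : Measure Ω) (w : Ω → ℝ) : Measure Ω :=
  P.withDensity (fun ω => ENNReal.ofReal (Real.exp (w ω)))

lemma gibbs_eq_tilted (h : ∫ ω, Real.exp (w ω) ∂P = 1) : gibbs P w = P.tilted w := by
  unfold gibbs Measure.tilted
  simp [h]

lemma gibbs_ac : gibbs P w ≪ P := withDensity_absolutelyContinuous _ _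

lemma gibbs_univ [IsProbabilityMeasure P] (hw : Bdd P w) :
    gibbs P w univ = ENNReal.ofReal (∫ ω, Real.exp (w ω) ∂P) := by
  unfold gibbs
  rw [withDensity_apply _ MeasurableSet.univ, Measure.restrict_univ,
    ofReal_integral_eq_lintegral_ofReal hw.exp.integrable
      (Eventually.of_forall fun ω => (Real.exp_pos _).le)]

lemma integral_exp_eq_one_of_gibbs [IsProbabilityMeasure P] (hw : Bdd P w)
    [IsProbabilityMeasure (gibbs P w)] : ∫ ω, Real.exp (w ω) ∂P = 1 := by
  have h := gibbs_univ hw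
  rw [measure_univ] at h
  exact (ENNReal.ofReal_eq_one.1 h.symm)

lemma isProbabilityMeasure_gibbs [IsProbabilityMeasure P] (hw : Bdd P w)
    (h : ∫ ω, Real.exp (w ω) ∂P = 1) : IsProbabilityMeasure (gibbs P w) :=
  ⟨by rw [gibbs_univ hw, h, ENNReal.ofReal_one]⟩

lemma integral_gibbs (h : ∫ ω, Real.exp (w ω) ∂P = 1) (φ : Ω → ℝ) :
    ∫ ω, φ ω ∂(gibbs P w) = ∫ ω, φ ω * Real.exp (w ω) ∂P := by
  rw [gibbs_eq_tilted h, integral_tilted, h]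
  congr 1; ext ω; simp [mul_comm]

lemma gibbs_inj [IsProbabilityMeasure P] {w' : Ω → ℝ} (hw : Bdd P w) (hw' : Bdd P w')
    (h : gibbs P w = gibbs P w') : w =ᵐ[P] w' := by
  have hm := hw.1
  have hm' := hw'.1
  have h1 := (withDensity_eq_iff (f := fun ω => ENNReal.ofReal (Real.exp (w ω)))
    (g := fun ω => ENNReal.ofReal (Real.exp (w' ω)))
    (hw.exp.1.aemeasurable.ennreal_ofReal) (hw'.exp.1.aemeasurable.ennreal_ofReal) (by
      rw [← ofReal_integral_eq_lintegral_ofReal hw.exp.integrable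
        (Eventually.of_forall fun ω => (Real.exp_pos _).le)]
      exact ENNReal.ofReal_ne_top)).1 h
  filter_upwards [h1] with ω h2
  have := (ENNReal.ofReal_eq_ofReal_iff (Real.exp_pos _).le (Real.exp_pos _).le).1 h2
  exact Real.exp_injective this

lemma Pc_eq_gibbs [IsProbabilityMeasure P] {c : Ω → ℝ} (hc : Bdd P c) :
    Pc P c = gibbs P (fun ω => -Real.log (∫ ω, Real.exp (-c ω) ∂P) - c ω) ∧
      ∫ ω, Real.exp (-Real.log (∫ ω, Real.exp (-c ω) ∂P) - c ω) ∂P = 1 := by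
  have hi := hc.neg.exp.integrable
  have hpos : 0 < ∫ ω, Real.exp (-c ω) ∂P := integral_exp_pos hi
  set I := ∫ ω, Real.exp (-c ω) ∂P with hI
  have he : ∀ ω, Real.exp (-Real.log I - c ω) = Real.exp (-c ω) / I := by
    intro ω
    rw [show -Real.log I - c ω = -c ω - Real.log I by ring, Real.exp_sub, Real.exp_log hpos]
  constructor
  · unfold Pc gibbs
    congr 1
    ext ω
    rw [← ofReal_integral_eq_lintegral_ofReal hi
      (Eventually.of_forall fun ω => (Real.exp_pos _).le), ← hI, he,
      ENNReal.ofReal_div_of_pos hpos]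
  · simp_rw [he]
    rw [integral_div, ← hI, div_self hpos.ne']

/-- The entropic objective value of a Gibbs measure. -/
lemma objective_gibbs [IsProbabilityMeasure P] {h c : Ω → ℝ} (hh : Bdd P h) (hc : Bdd P c)
    (h1 : ∫ ω, Real.exp (h ω - c ω) ∂P = 1) :
    ∫ ω, c ω ∂(gibbs P (fun ω => h ω - c ω))
      + (KL (gibbs P (fun ω => h ω - c ω)) P).toReal
      = ∫ ω, h ω * Real.exp (h ω - c ω) ∂P := by
  have hw := hh.sub hc
  have hp := isProbabilityMeasure_gibbs hw h1
  have hg := gibbs_eq_tilted h1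
  have htop : KL (gibbs P (fun ω => h ω - c ω)) P ≠ ⊤ := by rw [hg]; exact KL_tilted_ne_top hw
  have h2 := (toReal_KL_tilted hw htop).2
  rw [← hg, KL_self, h1, Real.log_one,
    integral_sub (hh.mono_ac gibbs_ac).integrable (hc.mono_ac gibbs_ac).integrable] at h2
  simp only [ENNReal.toReal_zero] at h2
  rw [← integral_gibbs h1]
  linarith

lemma le_objective [IsProbabilityMeasure P] {h c : Ω → ℝ} (hh : Bdd P h) (hc : Bdd P c)
    (h1 : ∫ ω, Real.exp (h ω - c ω) ∂P = 1) [IsProbabilityMeasure π] (hπ : KL π P ≠ ⊤) :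
    ∫ ω, h ω ∂π ≤ ∫ ω, c ω ∂π + (KL π P).toReal := by
  have hac := ac_of_KL_ne_top hπ
  have h2 := (toReal_KL_tilted (hh.sub hc) hπ).2
  rw [h1, Real.log_one, integral_sub (hh.mono_ac hac).integrable (hc.mono_ac hac).integrable] at h2
  have : 0 ≤ (KL π (P.tilted fun ω => h ω - c ω)).toReal := ENNReal.toReal_nonneg
  linarith

/-- Duality: the value of the entropic problem is the integral of the optimal potential. -/
lemma iInf_objective_eq [IsProbabilityMeasure P] {h c : Ω → ℝ} {S : Set (Measure Ω)}
    (hh : Bdd P h) (hc : Bdd P c) (h1 : ∫ ω, Real.exp (h ω - c ω) ∂P = 1)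
    (hmem : gibbs P (fun ω => h ω - c ω) ∈ S)
    (hprob : ∀ π ∈ S, π ≪ P → IsProbabilityMeasure π)
    (hint : ∀ π ∈ S, π ≪ P → ∫ ω, h ω ∂π = ∫ ω, h ω ∂P) :
    (⨅ π : {π : Measure Ω // π ∈ S ∧ KL π P ≠ ⊤}, (∫ ω, c ω ∂π.1 + (KL π.1 P).toReal))
      = ∫ ω, h ω ∂P := by
  have hlow : ∀ π : {π : Measure Ω // π ∈ S ∧ KL π P ≠ ⊤},
      ∫ ω, h ω ∂P ≤ ∫ ω, c ω ∂π.1 + (KL π.1 P).toReal := by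
    rintro ⟨π, hπ, htop⟩
    have hac := ac_of_KL_ne_top htop
    have := hprob π hπ hac
    have := le_objective hh hc h1 htop
    rwa [hint π hπ hac] at this
  have htop : KL (gibbs P (fun ω => h ω - c ω)) P ≠ ⊤ := by
    rw [gibbs_eq_tilted h1]; exact KL_tilted_ne_top (hh.sub hc)
  have : Nonempty {π : Measure Ω // π ∈ S ∧ KL π P ≠ ⊤} := ⟨⟨_, hmem, htop⟩⟩
  refine le_antisymm ?_ (le_ciInf hlow)
  refine (ciInf_le ⟨_, forall_mem_range.2 hlow⟩ ⟨_, hmem, htop⟩).trans (le_of_eq ?_)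
  rw [objective_gibbs hh hc h1, ← integral_gibbs h1, hint _ hmem gibbs_ac]

/-- Entropic projection of a Gibbs measure, in terms of a dual class. -/
lemma eq_gibbs_of_KL_le [IsProbabilityMeasure P] {F : (Ω → ℝ) → Prop} {h h' c : Ω → ℝ}
    {Q : Set (Measure Ω)} (hh : Bdd P h) (hh' : Bdd P h') (hc : Bdd P c)
    (h1 : ∫ ω, Real.exp (h ω - c ω) ∂P = 1) (h1' : ∫ ω, Real.exp (h' ω - c ω) ∂P = 1)
    (hF : F (fun ω => h' ω - h ω)) (hmem : gibbs P (fun ω => h' ω - c ω) ∈ Q)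
    (hprob : ∀ π ∈ Q, π ≪ P → IsProbabilityMeasure π)
    (hint : ∀ π ∈ Q, π ≪ P → ∀ φ, F φ → ∫ ω, φ ω ∂π = ∫ ω, φ ω ∂P)
    (hσQ : σ ∈ Q)
    (hopt : ∀ ρ ∈ Q, KL σ (gibbs P (fun ω => h ω - c ω)) ≤ KL ρ (gibbs P (fun ω => h ω - c ω))) :
    σ = gibbs P (fun ω => h' ω - c ω) := by
  have hp := isProbabilityMeasure_gibbs (hh.sub hc) h1
  have he : (gibbs P (fun ω => h ω - c ω)).tilted (fun ω => h' ω - h ω)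
      = gibbs P (fun ω => h' ω - c ω) := by
    rw [gibbs_eq_tilted h1, gibbs_eq_tilted h1', tilted_tilted (hh.sub hc).exp.integrable]
    congr 1
    ext ω
    simp
  have hac : gibbs P (fun ω => h ω - c ω) ≪ P := gibbs_ac
  rw [← he]
  refine eq_tilted_of_KL_le ((hh'.sub hh).mono_ac hac) ?_ (fun h => hprob σ hσQ (h.trans hac)) ?_
  · rw [he]; exact hopt _ hmem
  · intro h
    rw [he, hint σ hσQ (h.trans hac) _ hF, hint _ hmem gibbs_ac _ hF]

end Entropy

section CondExp

variable {Ω : Type*} {m : MeasurableSpace Ω} [mΩ : MeasurableSpace Ω] {P : Measure Ω}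
  [IsProbabilityMeasure P] {φ ψ w : Ω → ℝ}

omit [IsProbabilityMeasure P] in
lemma Bdd.condExp (hm : m ≤ mΩ) (h : Bdd P φ) : Bdd P (P[φ | m]) := by
  obtain ⟨-, K, hK⟩ := h
  exact ⟨(stronglyMeasurable_condExp.mono hm).aestronglyMeasurable, K,
    ae_bdd_abs_condExp_of_ae_bdd_abs hK⟩

lemma condExp_mul_left (hφ : Bdd P φ) (hφm : StronglyMeasurable[m] φ) (hψ : Bdd P ψ) :
    P[fun ω => φ ω * ψ ω | m] =ᵐ[P] fun ω => φ ω * (P[ψ | m]) ω :=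
  condExp_mul_of_stronglyMeasurable_left hφm (hφ.mul hψ).integrable hψ.integrable

lemma integral_mul_condExp (hm : m ≤ mΩ) (hφ : Bdd P φ) (hφm : StronglyMeasurable[m] φ)
    (hψ : Bdd P ψ) : ∫ ω, φ ω * (P[ψ | m]) ω ∂P = ∫ ω, φ ω * ψ ω ∂P := by
  rw [← integral_condExp hm (f := fun ω => φ ω * ψ ω)]
  exact integral_congr_ae (condExp_mul_left hφ hφm hψ).symm

lemma integral_condExp_mul_condExp (hm : m ≤ mΩ) (hφ : Bdd P φ) (hψ : Bdd P ψ) :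
    ∫ ω, φ ω * (P[ψ | m]) ω ∂P = ∫ ω, (P[φ | m]) ω * ψ ω ∂P := by
  have h1 := integral_mul_condExp hm (hψ.condExp hm) stronglyMeasurable_condExp hφ
  have h2 := integral_mul_condExp hm (hφ.condExp hm) stronglyMeasurable_condExp hψ
  rw [← h2]
  simp_rw [mul_comm] at h1 ⊢
  rw [← h1]

lemma condExp_ae_eq_self (hm : m ≤ mΩ) (hφ : Bdd P φ) (hφm : StronglyMeasurable[m] φ) :
    P[φ | m] = φ := condExp_of_stronglyMeasurable hm hφm hφ.integrable

/-- The conditional log-Laplace transform. -/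
lemma exists_log_condExp (hm : m ≤ mΩ) (hw : Bdd P w) : ∃ B : Ω → ℝ,
    StronglyMeasurable[m] B ∧ Bdd P B ∧
    (P[fun ω => Real.exp (w ω) | m] =ᵐ[P] fun ω => Real.exp (B ω)) ∧
    ∀ (v ψ : Ω → ℝ) (r : ℝ), Bdd P v → (∀ᵐ ω ∂P, |w ω - v ω| ≤ r) →
      (P[fun ω => Real.exp (v ω) | m] =ᵐ[P] fun ω => Real.exp (ψ ω)) →
      ∀ᵐ ω ∂P, |B ω - ψ ω| ≤ r := by
  have main : ∀ (v ψ : Ω → ℝ) (r : ℝ), Bdd P v → (∀ᵐ ω ∂P, |w ω - v ω| ≤ r) →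
      (P[fun ω => Real.exp (v ω) | m] =ᵐ[P] fun ω => Real.exp (ψ ω)) →
      ∀ᵐ ω ∂P, Real.exp (ψ ω - r) ≤ (P[fun ω => Real.exp (w ω) | m]) ω ∧
        (P[fun ω => Real.exp (w ω) | m]) ω ≤ Real.exp (ψ ω + r) := by
    intro v ψ r hv hr hψ
    have hs : ∀ a : ℝ, P[fun ω => Real.exp a * Real.exp (v ω) | m]
        =ᵐ[P] fun ω => Real.exp a * Real.exp (ψ ω) := by
      intro a
      filter_upwards [condExp_mul_left (m := m) (Bdd.const (Real.exp a))
        stronglyMeasurable_const hv.exp, hψ] with ω h1 h2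
      rw [h1, h2]
    have h1 : P[fun ω => Real.exp (-r) * Real.exp (v ω) | m]
        ≤ᵐ[P] P[fun ω => Real.exp (w ω) | m] := by
      apply condExp_mono (hv.exp.const_mul _).integrable hw.exp.integrable
      filter_upwards [hr] with ω h
      rw [← Real.exp_add]
      exact Real.exp_le_exp.2 (by linarith [(abs_le.1 h).1])
    have h2 : P[fun ω => Real.exp (w ω) | m] ≤ᵐ[P]
        P[fun ω => Real.exp r * Real.exp (v ω) | m] := by
      apply condExp_mono hw.exp.integrable (hv.exp.const_mul _).integrable
      filter_upwards [hr] with ω h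
      rw [← Real.exp_add]
      exact Real.exp_le_exp.2 (by linarith [(abs_le.1 h).2])
    filter_upwards [h1, h2, hs r, hs (-r)] with ω h1 h2 h3 h4
    rw [h3, ← Real.exp_add] at h2
    rw [h4, ← Real.exp_add] at h1
    exact ⟨by rwa [show ψ ω - r = -r + ψ ω by ring], by rwa [add_comm]⟩
  have hpos : ∀ᵐ ω ∂P, 0 < (P[fun ω => Real.exp (w ω) | m]) ω := by
    obtain ⟨-, K, hK⟩ := hw
    have h0 : P[fun ω => Real.exp ((fun _ => (0 : ℝ)) ω) | m]
        =ᵐ[P] fun ω => Real.exp ((fun _ => (0 : ℝ)) ω) := by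
      rw [condExp_const hm]
    filter_upwards [main (fun _ => 0) (fun _ => 0) K (Bdd.const 0) (by simpa using hK) h0]
      with ω h
    exact (Real.exp_pos _).trans_le h.1
  have bound : ∀ (v ψ : Ω → ℝ) (r : ℝ), Bdd P v → (∀ᵐ ω ∂P, |w ω - v ω| ≤ r) →
      (P[fun ω => Real.exp (v ω) | m] =ᵐ[P] fun ω => Real.exp (ψ ω)) →
      ∀ᵐ ω ∂P, |Real.log ((P[fun ω => Real.exp (w ω) | m]) ω) - ψ ω| ≤ r := by
    intro v ψ r hv hr hψ
    filter_upwards [main v ψ r hv hr hψ, hpos] with ω h1 h2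
    have h3 := (Real.le_log_iff_exp_le h2).2 h1.1
    have h4 := (Real.log_le_iff_le_exp h2).2 h1.2
    rw [abs_le]; constructor <;> linarith
  refine ⟨fun ω => Real.log ((P[fun ω => Real.exp (w ω) | m]) ω), ?_, ⟨?_, ?_⟩, ?_, bound⟩
  · exact (Real.measurable_log.comp
      (stronglyMeasurable_condExp (m := m)).measurable).stronglyMeasurable
  · exact (Real.measurable_log.comp
      (stronglyMeasurable_condExp.mono hm).measurable).aestronglyMeasurable
  · obtain ⟨-, K, hK⟩ := hw
    have h0 : P[fun ω => Real.exp ((fun _ => (0 : ℝ)) ω) | m]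
        =ᵐ[P] fun ω => Real.exp ((fun _ => (0 : ℝ)) ω) := by
      rw [condExp_const hm]
    have h1 := bound (fun _ => 0) (fun _ => 0) K (Bdd.const 0) (by simpa using hK) h0
    exact ⟨K, by simpa using h1⟩
  · filter_upwards [hpos] with ω h
    rw [Real.exp_log h]

end CondExp

section Tower

variable {Ω : Type*} [mΩ : MeasurableSpace Ω]

/-- Interlaced filtrations `G 0 ≤ A 0 ≤ G 1 ≤ A 1 ≤ ⋯`. -/
structure IsTower (A G : ℕ → MeasurableSpace Ω) : Prop where
  le : ∀ t, A t ≤ mΩ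
  bot : G 0 = ⊥
  le_A : ∀ t, G t ≤ A t
  le_G : ∀ t, A t ≤ G (t + 1)

variable {A G : ℕ → MeasurableSpace Ω}

lemma IsTower.G_le (h : IsTower A G) (t : ℕ) : G t ≤ mΩ := (h.le_A t).trans (h.le t)

lemma IsTower.A_le_G (h : IsTower A G) {s t : ℕ} (hst : s < t) : A s ≤ G t := by
  induction t with
  | zero => omega
  | succ t ih =>
    rcases Nat.lt_succ_iff_lt_or_eq.1 hst with h1 | rfl
    · exact (ih h1).trans ((h.le_A t).trans (h.le_G t))
    · exact h.le_G _

variable {P : Measure Ω} [IsProbabilityMeasure P]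

/-- Construction of the dual projection onto sums of martingale increments, together with a
priori bounds on these increments. -/
lemma IsTower.exists_projection (hT : IsTower A G) (V : ℕ → Ω → ℝ) (β : ℕ → ℝ)
    (hV : ∀ t, Bdd P (V t))
    (n : ℕ) (hβ : ∀ t < n, ∃ ψ : Ω → ℝ, StronglyMeasurable[G t] ψ ∧ Bdd P ψ ∧
      (P[fun ω => Real.exp (V (t + 1) ω) | A t] =ᵐ[P] fun ω => Real.exp (ψ ω)) ∧
      ∀ᵐ ω ∂P, |ψ ω - V t ω| ≤ β t) :
    ∀ (w : Ω → ℝ) (r : ℝ), StronglyMeasurable[G n] w → Bdd P w →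
      (∀ᵐ ω ∂P, |w ω - V n ω| ≤ r) →
      ∃ (γ : ℝ) (f : ℕ → Ω → ℝ),
        (∀ t < n, StronglyMeasurable[A t] (f t) ∧ Bdd P (f t) ∧ P[f t | G t] =ᵐ[P] 0 ∧
          ∀ᵐ ω ∂P, |f t ω| ≤ 2 * (r + ∑ s ∈ Finset.Ico (t + 1) n, β s)) ∧
        (∀ t < n, P[fun ω => Real.exp (w ω + (γ + ∑ s ∈ Finset.range n, f s ω)) | A t] =ᵐ[P]
          P[fun ω => Real.exp (w ω + (γ + ∑ s ∈ Finset.range n, f s ω)) | G t]) ∧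
        ∫ ω, Real.exp (w ω + (γ + ∑ s ∈ Finset.range n, f s ω)) ∂P = 1 := by
  induction n with
  | zero =>
    intro w r hw _ _
    rw [hT.bot, stronglyMeasurable_bot_iff] at hw
    obtain ⟨a, rfl⟩ := hw
    exact ⟨-a, fun _ _ => 0, by simp, by simp, by simp⟩
  | succ n ih =>
    intro w r hw bw hr
    obtain ⟨B, hBm, bB, hBe, hBc⟩ := exists_log_condExp (hT.le n) bw
    obtain ⟨ψ, hψm, bψ, hψ, hψV⟩ := hβ n (Nat.lt_succ_self n)
    have hBψ := hBc _ ψ r (hV (n + 1)) hr hψ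
    set C := P[B | G n] with hC
    have bC : Bdd P C := bB.condExp (hT.G_le n)
    have hCm : StronglyMeasurable[G n] C := stronglyMeasurable_condExp
    have hCψ : ∀ᵐ ω ∂P, |C ω - ψ ω| ≤ r := by
      have h1 := ae_bdd_abs_condExp_of_ae_bdd_abs (m := G n) hBψ
      have h2 := condExp_sub (m := G n) bB.integrable bψ.integrable
      rw [condExp_ae_eq_self (hT.G_le n) bψ hψm] at h2
      filter_upwards [h1, h2] with ω h1 h2
      have : (P[fun ω => B ω - ψ ω | G n]) ω = C ω - ψ ω := h2
      rwa [← this]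
    have hCV : ∀ᵐ ω ∂P, |C ω - V n ω| ≤ r + β n := by
      filter_upwards [hCψ, hψV] with ω h1 h2
      calc |C ω - V n ω| = |(C ω - ψ ω) + (ψ ω - V n ω)| := by ring_nf
        _ ≤ _ := (abs_add_le _ _).trans (add_le_add h1 h2)
    obtain ⟨γ, f, hf, hZ, hI⟩ := ih (fun t ht => hβ t (ht.trans (Nat.lt_succ_self n))) C _ hCm bC hCV
    set fn : Ω → ℝ := fun ω => C ω - B ω with hfn
    have hfnm : StronglyMeasurable[A n] fn := (hCm.mono (hT.le_A n)).sub hBm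
    have bfn : Bdd P fn := bC.sub bB
    set F : ℕ → Ω → ℝ := fun t => if t < n then f t else fn with hF
    have hFlt : ∀ t < n, F t = f t := fun t ht => if_pos ht
    have hFn : F n = fn := if_neg (lt_irrefl n)
    set S : Ω → ℝ := fun ω => γ + ∑ s ∈ Finset.range n, f s ω with hS
    have hSm : StronglyMeasurable[A n] S := by
      refine stronglyMeasurable_const.add (Finset.stronglyMeasurable_fun_sum _ fun s hs => ?_)
      have hs' := Finset.mem_range.1 hs
      exact (hf s hs').1.mono ((hT.A_le_G hs').trans (hT.le_A n))
    have hSmG : StronglyMeasurable[G n] S := by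
      refine stronglyMeasurable_const.add (Finset.stronglyMeasurable_fun_sum _ fun s hs => ?_)
      have hs' := Finset.mem_range.1 hs
      exact (hf s hs').1.mono (hT.A_le_G hs')
    have bS : Bdd P S :=
      (Bdd.const γ).add (Bdd.sum _ fun s hs => (hf s (Finset.mem_range.1 hs)).2.1)
    have hsum : ∀ ω, γ + ∑ s ∈ Finset.range (n + 1), F s ω = S ω + fn ω := by
      intro ω
      rw [Finset.sum_range_succ, hFn, Finset.sum_congr rfl
        fun s hs => by rw [hFlt s (Finset.mem_range.1 hs)], ← add_assoc]
    have hZeq : (fun ω => Real.exp (w ω + (γ + ∑ s ∈ Finset.range (n + 1), F s ω)))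
        = fun ω => Real.exp (S ω + fn ω) * Real.exp (w ω) := by
      ext ω; rw [hsum, ← Real.exp_add]; ring_nf
    set Z := fun ω => Real.exp (w ω + (γ + ∑ s ∈ Finset.range (n + 1), F s ω)) with hZdef
    set Z' := fun ω => Real.exp (C ω + S ω) with hZ'
    have bZ : Bdd P Z := by rw [hZeq]; exact (bS.add bfn).exp.mul bw.exp
    have bZ' : Bdd P Z' := (bC.add bS).exp
    have hZ'm : StronglyMeasurable[G n] Z' :=
      Real.continuous_exp.comp_stronglyMeasurable (hCm.add hSmG)
    have hZA : P[Z | A n] =ᵐ[P] Z' := by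
      rw [hZeq]
      have h1 := condExp_mul_left (m := A n) (bS.add bfn).exp
        (Real.continuous_exp.comp_stronglyMeasurable (hSm.add hfnm)) bw.exp
      filter_upwards [h1, hBe] with ω h1 h2
      rw [h1, h2, ← Real.exp_add]
      simp only [hZ', hfn]
      congr 1; ring
    have towerA : ∀ t, A t ≤ A n → P[Z | A t] =ᵐ[P] P[Z' | A t] := fun t ht =>
      (condExp_condExp_of_le ht (hT.le n)).symm.trans (condExp_congr_ae hZA)
    have towerG : ∀ t, G t ≤ A n → P[Z | G t] =ᵐ[P] P[Z' | G t] := fun t ht =>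
      (condExp_condExp_of_le ht (hT.le n)).symm.trans (condExp_congr_ae hZA)
    refine ⟨γ, F, ?_, ?_, ?_⟩
    · intro t ht
      rcases Nat.lt_succ_iff_lt_or_eq.1 ht with h | rfl
      · rw [hFlt t h]
        obtain ⟨h1, h2, h3, h4⟩ := hf t h
        refine ⟨h1, h2, h3, ?_⟩
        rw [Finset.sum_Ico_succ_top (by omega)]
        filter_upwards [h4] with ω h5
        refine h5.trans (le_of_eq (by ring))
      · rw [hFn]
        refine ⟨hfnm, bfn, ?_, ?_⟩
        · have h2 := condExp_sub (m := G t) bC.integrable bB.integrable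
          rw [condExp_ae_eq_self (hT.G_le t) bC hCm] at h2
          filter_upwards [h2] with ω h2
          have : (P[fun ω => C ω - B ω | G t]) ω = C ω - C ω := h2
          rw [this]; simp
        · simp only [Finset.Ico_self, Finset.sum_empty, add_zero]
          filter_upwards [hCψ, hBψ] with ω h1 h2
          calc |fn ω| = |(C ω - ψ ω) - (B ω - ψ ω)| := by simp only [hfn]; ring_nf
            _ ≤ 2 * r := (abs_sub _ _).trans (by linarith)
    · intro t ht
      rcases Nat.lt_succ_iff_lt_or_eq.1 ht with h | rfl
      · have hAt : A t ≤ A n := (hT.A_le_G h).trans (hT.le_A n)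
        exact (towerA _ hAt).trans ((hZ t h).trans (towerG _ ((hT.le_A t).trans hAt)).symm)
      · have h1 := towerG _ (hT.le_A t)
        rw [condExp_ae_eq_self (hT.G_le t) bZ' hZ'm] at h1
        exact hZA.trans h1.symm
    · rw [← integral_condExp (hT.le n), integral_congr_ae hZA, ← hI]

end Tower

section Ladder

variable {Ω : Type*} [MeasurableSpace Ω] {P : Measure Ω} {c : Ω → ℝ} {M R : ℝ} {J : ℕ}
  {FX GY : ℕ → (Ω → ℝ) → Prop}

/-- Two orthogonal classes `FX 0` and `GY 0` of dual functions, filtered by improving a priori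
bounds: each dual projection gains one level, and functions at level `J` are within `R` of a
constant. -/
structure IsLadder (P : Measure Ω) (c : Ω → ℝ) (M R : ℝ) (J : ℕ)
    (FX GY : ℕ → (Ω → ℝ) → Prop) : Prop where
  bddc : Bdd P c
  lec : ∀ᵐ ω ∂P, |c ω| ≤ M
  classX : IsClass P (FX 0)
  classY : IsClass P (GY 0)
  orth : Orth P (FX 0) (GY 0)
  stepX : ∀ j g, GY j g →
    ∃ f, FX (j + 1) f ∧ Ann P (FX 0) (fun ω => Real.exp (f ω + (g ω - c ω)))
  stepY : ∀ j f, FX j f →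
    ∃ g, GY (j + 1) g ∧ Ann P (GY 0) (fun ω => Real.exp (g ω + (f ω - c ω)))
  antiX : ∀ j f, FX (j + 1) f → FX j f
  antiY : ∀ j g, GY (j + 1) g → GY j g
  shiftX : ∀ j f f' (a : ℝ), FX j f → (∀ᵐ ω ∂P, f' ω = f ω + a) → FX j f'
  shiftY : ∀ j g g' (a : ℝ), GY j g → (∀ᵐ ω ∂P, g' ω = g ω + a) → GY j g'
  constX : ∀ j (a : ℝ), FX j (fun _ => a)
  constY : ∀ j (a : ℝ), GY j (fun _ => a)
  boundX : ∀ f, FX J f → ∃ γ : ℝ, ∀ᵐ ω ∂P, |f ω - γ| ≤ R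
  boundY : ∀ g, GY J g → ∃ γ : ℝ, ∀ᵐ ω ∂P, |g ω - γ| ≤ R

/-- `Q` contains the Gibbs measures annihilating the dual class `F`, and conversely integrates
functions of `F` like `P`. -/
structure IsDualPair (P : Measure Ω) (c : Ω → ℝ) (F : (Ω → ℝ) → Prop) (Q : Set (Measure Ω)) :
    Prop where
  mem : ∀ h, Bdd P h → Ann P F (fun ω => Real.exp (h ω - c ω)) →
    gibbs P (fun ω => h ω - c ω) ∈ Q
  prob : ∀ π ∈ Q, π ≪ P → IsProbabilityMeasure π
  int : ∀ π ∈ Q, π ≪ P → ∀ φ, F φ → ∫ ω, φ ω ∂π = ∫ ω, φ ω ∂P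

lemma IsLadder.antiX_zero (L : IsLadder P c M R J FX GY) : ∀ {j : ℕ} {f}, FX j f → FX 0 f
  | 0, _, h => h
  | _ + 1, _, h => L.antiX_zero (L.antiX _ _ h)

lemma IsLadder.antiY_zero (L : IsLadder P c M R J FX GY) : ∀ {j : ℕ} {g}, GY j g → GY 0 g
  | 0, _, h => h
  | _ + 1, _, h => L.antiY_zero (L.antiY _ _ h)

variable [IsProbabilityMeasure P]

/-- Dual optimizers belong to all levels. -/
lemma IsLadder.level_of_ann (L : IsLadder P c M R J FX GY) {f g : Ω → ℝ} (hf : FX 0 f)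
    (hg : GY 0 g) (hX : Ann P (FX 0) (fun ω => Real.exp (f ω + g ω - c ω)))
    (hY : Ann P (GY 0) (fun ω => Real.exp (f ω + g ω - c ω))) (j : ℕ) : FX j f ∧ GY j g := by
  have bf := L.classX.bdd _ hf
  have bg := L.classY.bdd _ hg
  induction j with
  | zero => exact ⟨hf, hg⟩
  | succ j ih =>
    constructor
    · obtain ⟨f', hf', hA⟩ := L.stepX j g ih.2
      have h1 : f =ᵐ[P] f' := Ann.unique L.classX (bg.sub L.bddc) hf (L.antiX_zero hf')
        (by simpa only [add_sub_assoc] using hX) hA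
      exact L.shiftX _ _ _ 0 hf' (by filter_upwards [h1] with ω h; rw [h, add_zero])
    · obtain ⟨g', hg', hA⟩ := L.stepY j f ih.1
      have h1 : g =ᵐ[P] g' := Ann.unique L.classY (bf.sub L.bddc) hg (L.antiY_zero hg')
        (by simpa only [← add_sub_assoc, add_comm] using hY) hA
      exact L.shiftY _ _ _ 0 hg' (by filter_upwards [h1] with ω h; rw [h, add_zero])

lemma IsLadder.abs_sub_le (L : IsLadder P c M R J FX GY) {f g : Ω → ℝ} (hf : FX J f)
    (hg : GY J g) (h1 : ∫ ω, Real.exp (f ω + g ω - c ω) ∂P = 1) :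
    ∀ᵐ ω ∂P, |f ω + g ω - c ω| ≤ 4 * R + 2 * M := by
  obtain ⟨a, ha⟩ := L.boundX _ hf
  obtain ⟨b, hb⟩ := L.boundY _ hg
  have bd : Bdd P (fun ω => f ω + g ω - c ω) :=
    ((L.classX.bdd _ (L.antiX_zero hf)).add (L.classY.bdd _ (L.antiY_zero hg))).sub L.bddc
  have hi := bd.exp.integrable
  have hle : ∀ᵐ ω ∂P, |f ω + g ω - c ω - (a + b)| ≤ 2 * R + M := by
    filter_upwards [ha, hb, L.lec] with ω h1 h2 h3
    rw [abs_le] at *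
    constructor <;> linarith [h1.1, h1.2, h2.1, h2.2, h3.1, h3.2]
  have hup : 1 ≤ Real.exp (a + b + (2 * R + M)) := by
    rw [← h1]
    calc ∫ ω, Real.exp (f ω + g ω - c ω) ∂P
        ≤ ∫ _, Real.exp (a + b + (2 * R + M)) ∂P := by
          apply integral_mono_ae hi (integrable_const _)
          filter_upwards [hle] with ω h
          exact Real.exp_le_exp.2 (by linarith [(abs_le.1 h).2])
      _ = _ := by simp
  have hlo : Real.exp (a + b - (2 * R + M)) ≤ 1 := by
    rw [← h1]
    calc Real.exp (a + b - (2 * R + M)) = ∫ _, Real.exp (a + b - (2 * R + M)) ∂P := by simp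
      _ ≤ _ := by
          apply integral_mono_ae (integrable_const _) hi
          filter_upwards [hle] with ω h
          exact Real.exp_le_exp.2 (by linarith [(abs_le.1 h).1])
  have h2 := Real.one_le_exp_iff.1 hup
  have h3 := Real.exp_le_one_iff.1 hlo
  filter_upwards [hle] with ω h
  rw [abs_le] at *
  constructor <;> linarith [h.1, h.2]

/-- One full Sinkhorn step, in terms of potentials. -/
lemma IsLadder.exists_step (L : IsLadder P c M R J FX GY) {QX QY : Set (Measure Ω)}
    (DX : IsDualPair P c (FX 0) QX) (DY : IsDualPair P c (GY 0) QY)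
    {full half : ℕ → Measure Ω} (hS : IsSinkhorn QX QY (Pc P c) full half)
    {f g : ℕ → Ω → ℝ} (hf : ∀ k, FX 0 (f k)) (hg : ∀ k, GY 0 (g k))
    (hfull : ∀ k, full k = gibbs P (fun ω => f k ω + g k ω - c ω)) (k : ℕ)
    (hgk : GY J (g k)) (hone : ∫ ω, Real.exp (f k ω + g k ω - c ω) ∂P = 1) :
    ∃ fp : Ω → ℝ, FX J fp ∧ Ann P (FX 0) (fun ω => Real.exp (fp ω + g k ω - c ω)) ∧
      FX J (f (k + 1)) ∧ GY J (g (k + 1)) ∧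
      Ann P (GY 0) (fun ω => Real.exp (f (k + 1) ω + g (k + 1) ω - c ω)) ∧
      ∃ a : ℝ, ∀ᵐ ω ∂P, f (k + 1) ω = fp ω + a := by
  have bf := fun k => L.classX.bdd _ (hf k)
  have bg := fun k => L.classY.bdd _ (hg k)
  obtain ⟨fp, hfp, hA⟩ := L.stepX J _ hgk
  simp only [← add_sub_assoc] at hA
  have hfp0 := L.antiX_zero hfp
  have bfp := L.classX.bdd _ hfp0
  have hfpJ := L.antiX _ _ hfp
  have hone1 := hA.integral_eq_one L.classX
  have hhalf : half k = gibbs P (fun ω => fp ω + g k ω - c ω) := by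
    refine eq_gibbs_of_KL_le (F := FX 0) (h := fun ω => f k ω + g k ω)
      (h' := fun ω => fp ω + g k ω) ((bf k).add (bg k)) (bfp.add (bg k)) L.bddc hone hone1
      (by simpa using L.classX.sub _ _ hfp0 (hf k)) (DX.mem _ (bfp.add (bg k)) hA)
      DX.prob DX.int (hS.half_mem k) ?_
    rw [← hfull k]
    exact hS.half_opt k
  obtain ⟨gp, hgp, hB⟩ := L.stepY J _ hfpJ
  have hBe : (fun ω => Real.exp (gp ω + (fp ω - c ω))) = fun ω => Real.exp (fp ω + gp ω - c ω) := by
    ext ω; congr 1; ring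
  rw [hBe] at hB
  have hgp0 := L.antiY_zero hgp
  have bgp := L.classY.bdd _ hgp0
  have hone2 := hB.integral_eq_one L.classY
  have hfull' : full (k + 1) = gibbs P (fun ω => fp ω + gp ω - c ω) := by
    refine eq_gibbs_of_KL_le (F := GY 0) (h := fun ω => fp ω + g k ω)
      (h' := fun ω => fp ω + gp ω) (bfp.add (bg k)) (bfp.add bgp) L.bddc hone1 hone2
      (by simpa using L.classY.sub _ _ hgp0 (hg k)) (DY.mem _ (bfp.add bgp) hB)
      DY.prob DY.int (hS.full_mem k) ?_
    rw [← hhalf]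
    exact hS.full_opt k
  have heq := gibbs_inj (((bf (k + 1)).add (bg (k + 1))).sub L.bddc) ((bfp.add bgp).sub L.bddc)
    ((hfull (k + 1)).symm.trans hfull')
  obtain ⟨a, ha⟩ := Orth.ae_eq_const L.classX L.orth (L.classX.sub _ _ (hf (k + 1)) hfp0)
    (L.classY.sub _ _ (hg (k + 1)) hgp0) (by filter_upwards [heq] with ω h; linarith)
  refine ⟨fp, hfpJ, hA, ?_, ?_, ?_, a, ?_⟩
  · exact L.shiftX _ _ _ a hfpJ (by filter_upwards [ha] with ω h; linarith [h.1])
  · exact L.shiftY _ _ _ (-a) (L.antiY _ _ hgp) (by filter_upwards [ha] with ω h; linarith [h.2])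
  · intro φ hφ
    rw [← hB φ hφ]
    apply integral_congr_ae
    filter_upwards [heq] with ω h
    rw [h]
  · filter_upwards [ha] with ω h
    linarith [h.1]

/-- Potentials at the beginning of Sinkhorn's algorithm are constant. -/
lemma IsLadder.init_const (L : IsLadder P c M R J FX GY) {f g : Ω → ℝ} (hf : FX 0 f) (hg : GY 0 g)
    (h : Pc P c = gibbs P (fun ω => f ω + g ω - c ω)) :
    ∃ γ : ℝ, (∀ᵐ ω ∂P, f ω + g ω = γ) ∧ FX J f ∧ GY J g ∧
      ∫ ω, Real.exp (f ω + g ω - c ω) ∂P = 1 := by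
  have bf := L.classX.bdd _ hf
  have bg := L.classY.bdd _ hg
  obtain ⟨h1, h2⟩ := Pc_eq_gibbs L.bddc
  set γ := -Real.log (∫ ω, Real.exp (-c ω) ∂P)
  have heq := gibbs_inj ((bf.add bg).sub L.bddc) ((Bdd.const γ).sub L.bddc) (h.symm.trans h1)
  have h0 : ∀ᵐ ω ∂P, f ω + g ω = γ := by filter_upwards [heq] with ω h; linarith
  obtain ⟨a, ha⟩ := Orth.ae_eq_const L.classX L.orth (L.classX.sub _ _ hf (L.classX.const γ)) hg
    (by filter_upwards [h0] with ω h; linarith)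
  refine ⟨γ, h0, ?_, ?_, ?_⟩
  · exact L.shiftX _ _ _ a (L.constX _ γ) (by filter_upwards [ha] with ω h; linarith [h.1])
  · exact L.shiftY _ _ _ 0 (L.constY _ (-a)) (by filter_upwards [ha] with ω h; linarith [h.2])
  · rw [← h2]
    apply integral_congr_ae
    filter_upwards [h0] with ω h
    rw [h]

omit [IsProbabilityMeasure P] in
lemma Ann.congr {F : (Ω → ℝ) → Prop} {Z Z' : Ω → ℝ} (h : Ann P F Z) (hZ : Z =ᵐ[P] Z') :
    Ann P F Z' := by
  intro φ hφ
  rw [← h φ hφ]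
  apply integral_congr_ae
  filter_upwards [hZ] with ω h
  rw [h]

lemma Orth.integral_centered_sq {F G : (Ω → ℝ) → Prop} (hF : IsClass P F) (hG : IsClass P G)
    (hO : Orth P F G) {φ ψ : Ω → ℝ} (hφ : F φ) (hψ : G ψ) (h0 : ∫ ω, φ ω ∂P = 0) :
    ∫ ω, φ ω ^ 2 ∂P + ∫ ω, ψ ω ^ 2 ∂P = ∫ ω, (φ ω + ψ ω) ^ 2 ∂P := by
  have bφ := hF.bdd _ hφ
  have bψ := hG.bdd _ hψ
  have h1 := hO _ _ hφ hψ
  rw [h0, zero_mul] at h1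
  have h2 : ∀ ω, (φ ω + ψ ω) ^ 2 = φ ω ^ 2 + ψ ω ^ 2 + 2 * (φ ω * ψ ω) := fun ω => by ring
  simp_rw [h2]
  rw [integral_add (bφ.sq.add bψ.sq).integrable ((bφ.mul bψ).const_mul 2).integrable,
    integral_add bφ.sq.integrable bψ.sq.integrable, integral_const_mul, h1]
  simp

/-- Linear convergence of alternating entropic projections for a pair of dual classes with a
priori bounds. -/
theorem exists_rate_ladder.{w} (M R : ℝ) : ∃ ρ : ℝ, 0 < ρ ∧ ρ < 1 ∧ ∃ C : ℝ, 0 < C ∧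
    ∀ {Ω : Type w} [MeasurableSpace Ω] {P : Measure Ω} [IsProbabilityMeasure P] {c : Ω → ℝ}
      {J : ℕ} {FX GY : ℕ → (Ω → ℝ) → Prop}, IsLadder P c M R J FX GY →
    ∀ {QX QY : Set (Measure Ω)}, IsDualPair P c (FX 0) QX → IsDualPair P c (GY 0) QY →
    ∀ {full half : ℕ → Measure Ω}, IsSinkhorn QX QY (Pc P c) full half →
    ∀ {f g : ℕ → Ω → ℝ}, (∀ k, FX 0 (f k)) → (∀ k, GY 0 (g k)) →
      (∀ k, full k = gibbs P (fun ω => f k ω + g k ω - c ω)) →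
    ∀ {fs gs : Ω → ℝ}, FX 0 fs → GY 0 gs →
      Ann P (FX 0) (fun ω => Real.exp (fs ω + gs ω - c ω)) →
      Ann P (GY 0) (fun ω => Real.exp (fs ω + gs ω - c ω)) →
    ∀ {E : ℝ}, E = (⨅ π : {π : Measure Ω // π ∈ QX ∩ QY ∧ KL π P ≠ ⊤},
        (∫ ω, c ω ∂π.1 + (KL π.1 P).toReal)) →
    ∀ k : ℕ,
      E - (∫ z, c z ∂(full k) + (KL (full k) P).toReal) ≤
        ρ ^ k * (E - (∫ z, c z ∂(full 0) + (KL (full 0) P).toReal)) ∧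
      ∫ ω, ((f k ω - ∫ ω', f k ω' ∂P) - (fs ω - ∫ ω', fs ω' ∂P)) ^ 2 ∂P +
        ∫ ω, ((g k ω + ∫ ω', f k ω' ∂P) - (gs ω + ∫ ω', fs ω' ∂P)) ^ 2 ∂P ≤
        C * ρ ^ k * (E - (∫ z, c z ∂(full 0) + (KL (full 0) P).toReal)) := by
  obtain ⟨ρ, h0, h1, hρ⟩ := exists_rate_alternating.{w} (4 * R + 2 * M)
  refine ⟨ρ, h0, h1, 4 * Real.exp (4 * R + 2 * M), by positivity, ?_⟩
  intro Ω _ P _ c J FX GY L QX QY DX DY full half hS f g hf hg hfull fs gs hfs hgs hAX hAY E hE k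
  have bf := fun k => L.classX.bdd _ (hf k)
  have bg := fun k => L.classY.bdd _ (hg k)
  have bfs := L.classX.bdd _ hfs
  have bgs := L.classY.bdd _ hgs
  obtain ⟨γ, hγ, hf0, hg0, hone0⟩ := L.init_const (hf 0) (hg 0) (hS.init.symm.trans (hfull 0))
  have good : ∀ k, FX J (f k) ∧ GY J (g k) ∧
      ∫ ω, Real.exp (f k ω + g k ω - c ω) ∂P = 1 := by
    intro k
    induction k with
    | zero => exact ⟨hf0, hg0, hone0⟩
    | succ k ih =>
      obtain ⟨fp, -, -, h3, h4, h5, -⟩ := L.exists_step DX DY hS hf hg hfull k ih.2.1 ih.2.2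
      exact ⟨h3, h4, h5.integral_eq_one L.classY⟩
  have step := fun k => L.exists_step DX DY hS hf hg hfull k (good k).2.1 (good k).2.2
  choose fp hfp hAp _ _ hAG hshift using step
  choose a ha using hshift
  have hfp0 : ∀ k, FX 0 (fp k) := fun k => L.antiX_zero (hfp k)
  have bfp := fun k => L.classX.bdd _ (hfp0 k)
  have hones := hAX.integral_eq_one L.classX
  obtain ⟨hfsJ, hgsJ⟩ := L.level_of_ann hfs hgs hAX hAY J
  have H : IsAlternating P (FX 0) (GY 0) c (4 * R + 2 * M) γ (fun ω => fs ω + gs ω)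
      (fun k ω => f k ω + g k ω) (fun k ω => fp k ω + g k ω) :=
    { classF := L.classX
      classG := L.classY
      orth := L.orth
      bddc := L.bddc
      bdds := bfs.add bgs
      bdd := fun k => (bf k).add (bg k)
      bddm := fun k => (bfp k).add (bg k)
      les := L.abs_sub_le hfsJ hgsJ hones
      le := fun k => L.abs_sub_le (good k).1 (good k).2.1 (good k).2.2
      lem := fun k => L.abs_sub_le (hfp k) (good k).2.1 ((hAp k).integral_eq_one L.classX)
      decs := ⟨fs, gs, hfs, hgs, Eventually.of_forall fun _ => rfl⟩
      dec := fun k => ⟨f k, g k, hf k, hg k, Eventually.of_forall fun _ => rfl⟩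
      decm := fun k => ⟨fp k, g k, hfp0 k, hg k, Eventually.of_forall fun _ => rfl⟩
      subF := fun k => by simpa using L.classX.sub _ _ (hf k) (hfp0 k)
      subG := fun k => by
        refine L.classY.congr _ _
          (L.classY.sub _ _ (L.classY.sub _ _ (hg k) (hg (k + 1))) (L.classY.const (a k))) ?_
        filter_upwards [ha k] with ω h
        rw [h]; ring
      annF := hAp
      annG := hAG
      annFs := hAX
      annGs := hAY
      init := hγ
      one := hone0 }
  have hobj : ∀ k, ∫ z, c z ∂(full k) + (KL (full k) P).toReal
      = ∫ ω, (f k ω + g k ω) * Real.exp (f k ω + g k ω - c ω) ∂P := fun k => by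
    rw [hfull k]
    exact objective_gibbs ((bf k).add (bg k)) L.bddc (good k).2.2
  have hEs : E = ∫ ω, (fs ω + gs ω) ∂P := by
    rw [hE]
    refine iInf_objective_eq (h := fun ω => fs ω + gs ω) (bfs.add bgs) L.bddc hones
      ⟨DX.mem _ (bfs.add bgs) hAX, DY.mem _ (bfs.add bgs) hAY⟩
      (fun π hπ hac => DX.prob π hπ.1 hac) (fun π hπ hac => ?_)
    have := DX.prob π hπ.1 hac
    rw [integral_add (bfs.mono_ac hac).integrable (bgs.mono_ac hac).integrable,
      integral_add bfs.integrable bgs.integrable, DX.int π hπ.1 hac fs hfs,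
      DY.int π hπ.2 hac gs hgs]
  obtain ⟨r1, r2⟩ := hρ H k
  rw [hobj, hobj, hEs]
  refine ⟨r1, le_trans (le_of_eq ?_) r2⟩
  have c1 := L.classX.sub _ _ (L.classX.sub _ _ (hf k) hfs)
    (L.classX.const (∫ ω', f k ω' ∂P - ∫ ω', fs ω' ∂P))
  have c2 := L.classY.add (L.classY.sub _ _ (hg k) hgs)
    (L.classY.const (∫ ω', f k ω' ∂P - ∫ ω', fs ω' ∂P))
  have e := Orth.integral_centered_sq L.classX L.classY L.orth c1 c2 (by
    rw [integral_sub ((bf k).sub bfs).integrable (integrable_const _),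
      integral_sub (bf k).integrable bfs.integrable]
    simp)
  have e1 : ∀ ω, ((f k ω - ∫ ω', f k ω' ∂P) - (fs ω - ∫ ω', fs ω' ∂P))
      = f k ω - fs ω - (∫ ω', f k ω' ∂P - ∫ ω', fs ω' ∂P) := fun ω => by ring
  have e2 : ∀ ω, ((g k ω + ∫ ω', f k ω' ∂P) - (gs ω + ∫ ω', fs ω' ∂P))
      = g k ω - gs ω + (∫ ω', f k ω' ∂P - ∫ ω', fs ω' ∂P) := fun ω => by ring
  simp_rw [e1, e2]
  rw [e]
  congr 1
  ext ω
  ring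

end Ladder

section Adapted

variable {Ω : Type*} {mY : MeasurableSpace Ω} [mΩ : MeasurableSpace Ω] {P : Measure Ω}
  {A B G H : ℕ → MeasurableSpace Ω} {n : ℕ} {M : ℝ} {c : Ω → ℝ}

/-- Sums of a constant and of bounded martingale increments `f t`, `t < n`, measurable with
respect to `A t` and centered given `G t`; at level `j` the last `j` increments are bounded by
explicit multiples of `M`. -/
def AdaptedSum (P : Measure Ω) (A G : ℕ → MeasurableSpace Ω) (n : ℕ) (M : ℝ) (j : ℕ)
    (s : Ω → ℝ) : Prop :=
  ∃ (γ : ℝ) (f : ℕ → Ω → ℝ), (∀ t < n, StronglyMeasurable[A t] (f t) ∧ Bdd P (f t) ∧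
      P[f t | G t] =ᵐ[P] 0 ∧ (n ≤ t + j → ∀ᵐ ω ∂P, |f t ω| ≤ 2 * 3 ^ (n - 1 - t) * M)) ∧
    s =ᵐ[P] fun ω => γ + ∑ t ∈ Finset.range n, f t ω

lemma AdaptedSum.anti {j : ℕ} {s : Ω → ℝ} (h : AdaptedSum P A G n M (j + 1) s) :
    AdaptedSum P A G n M j s := by
  obtain ⟨γ, f, hf, hs⟩ := h
  exact ⟨γ, f, fun t ht => ⟨(hf t ht).1, (hf t ht).2.1, (hf t ht).2.2.1,
    fun hj => (hf t ht).2.2.2 (by omega)⟩, hs⟩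

lemma AdaptedSum.shift {j : ℕ} {s s' : Ω → ℝ} (h : AdaptedSum P A G n M j s) (a : ℝ)
    (hs' : ∀ᵐ ω ∂P, s' ω = s ω + a) : AdaptedSum P A G n M j s' := by
  obtain ⟨γ, f, hf, hs⟩ := h
  refine ⟨γ + a, f, hf, ?_⟩
  filter_upwards [hs, hs'] with ω h1 h2
  rw [h2, h1]; ring

lemma AdaptedSum.const (hM : 0 ≤ M) (j : ℕ) (a : ℝ) : AdaptedSum P A G n M j (fun _ => a) := by
  refine ⟨a, fun _ _ => 0, fun t _ => ⟨stronglyMeasurable_const, Bdd.const 0, ?_, ?_⟩, ?_⟩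
  · exact (condExp_zero (m := G t) (μ := P) (E := ℝ)).eventuallyEq
  · intro _
    exact Eventually.of_forall fun ω => by simp only [abs_zero]; positivity
  · exact Eventually.of_forall fun ω => by simp

lemma AdaptedSum.exists_abs_sub_le {j : ℕ} {s : Ω → ℝ} (h : AdaptedSum P A G n M j s)
    (hM : 0 ≤ M) (hj : n ≤ j) : ∃ γ : ℝ, ∀ᵐ ω ∂P, |s ω - γ| ≤ 3 ^ n * M := by
  obtain ⟨γ, f, hf, hs⟩ := h
  refine ⟨γ, ?_⟩
  have h1 : ∀ᵐ ω ∂P, ∀ t, t < n → |f t ω| ≤ 2 * 3 ^ (n - 1 - t) * M := by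
    rw [ae_all_iff]
    intro t
    by_cases ht : t < n
    · filter_upwards [(hf t ht).2.2.2 (by omega)] with ω h _ using h
    · exact Eventually.of_forall fun ω h => absurd h ht
  have h2 : ∑ t ∈ Finset.range n, (2 * 3 ^ (n - 1 - t) * M : ℝ) ≤ 3 ^ n * M := by
    rw [Finset.sum_range_reflect (fun i => (2 * 3 ^ i * M : ℝ)) n, ← Finset.sum_mul,
      ← Finset.mul_sum, geom_sum_eq (by norm_num)]
    nlinarith
  filter_upwards [hs, h1] with ω h3 h4
  rw [h3, add_sub_cancel_left]
  refine (Finset.abs_sum_le_sum_abs _ _).trans (le_trans (Finset.sum_le_sum fun t ht => ?_) h2)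
  exact h4 t (Finset.mem_range.1 ht)

lemma AdaptedSum.isClass [IsProbabilityMeasure P] (hM : 0 ≤ M) :
    IsClass P (AdaptedSum P A G n M 0) where
  bdd := by
    rintro φ ⟨γ, f, hf, hs⟩
    exact ((Bdd.const γ).add
      (Bdd.sum _ fun t ht => (hf t (Finset.mem_range.1 ht)).2.1)).congr hs.symm
  sub := by
    rintro φ ψ ⟨γ, f, hf, hs⟩ ⟨γ', f', hf', hs'⟩
    refine ⟨γ - γ', fun t ω => f t ω - f' t ω, fun t ht => ⟨(hf t ht).1.sub (hf' t ht).1,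
      (hf t ht).2.1.sub (hf' t ht).2.1, ?_, fun h => absurd h (by omega)⟩, ?_⟩
    · have h := condExp_sub (m := G t) (hf t ht).2.1.integrable (hf' t ht).2.1.integrable
      filter_upwards [h, (hf t ht).2.2.1, (hf' t ht).2.2.1] with ω h1 h2 h3
      have h1' : (P[fun ω => f t ω - f' t ω | G t]) ω = (P[f t | G t]) ω - (P[f' t | G t]) ω := h1
      rw [h1', h2, h3]; simp
    · filter_upwards [hs, hs'] with ω h1 h2
      rw [h1, h2, Finset.sum_sub_distrib]; ring
  smul := by
    rintro a φ ⟨γ, f, hf, hs⟩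
    refine ⟨a * γ, fun t ω => a * f t ω, fun t ht => ⟨(hf t ht).1.const_mul a,
      (hf t ht).2.1.const_mul a, ?_, fun h => absurd h (by omega)⟩, ?_⟩
    · have h := condExp_mul_left (m := G t) (Bdd.const a) stronglyMeasurable_const (hf t ht).2.1
      filter_upwards [h, (hf t ht).2.2.1] with ω h1 h2
      rw [h1, h2]; simp
    · filter_upwards [hs] with ω h1
      rw [h1, mul_add, Finset.mul_sum]
  const := AdaptedSum.const hM 0
  congr := fun φ ψ h he => h.shift 0 (by filter_upwards [he] with ω h; rw [h, add_zero])

/-- Densities whose conditional expectations given `A t` and `G t` agree annihilate adapted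
sums. -/
lemma AdaptedSum.ann [IsProbabilityMeasure P] (hT : IsTower A G) {Z : Ω → ℝ} (bZ : Bdd P Z)
    (hZ : ∀ t < n, P[Z | A t] =ᵐ[P] P[Z | G t]) (h1 : ∫ ω, Z ω ∂P = 1) :
    Ann P (AdaptedSum P A G n M 0) Z := by
  rintro φ ⟨γ, f, hf, hs⟩
  have bf : ∀ t ∈ Finset.range n, Bdd P (f t) := fun t ht => (hf t (Finset.mem_range.1 ht)).2.1
  have e1 : ∫ ω, φ ω ∂P = γ := by
    rw [integral_congr_ae hs, integral_add (integrable_const _) (Bdd.sum _ bf).integrable,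
      integral_finsetSum _ fun t ht => (bf t ht).integrable, Finset.sum_eq_zero]
    · simp
    · intro t ht
      rw [← integral_condExp (hT.G_le t), integral_congr_ae (hf t (Finset.mem_range.1 ht)).2.2.1]
      simp
  have e2 : ∫ ω, φ ω * Z ω ∂P = ∫ ω, (γ * Z ω + ∑ t ∈ Finset.range n, f t ω * Z ω) ∂P := by
    apply integral_congr_ae
    filter_upwards [hs] with ω h
    rw [h, add_mul, Finset.sum_mul]
  rw [e1, e2, integral_add (bZ.const_mul γ).integrable
    (Bdd.sum _ fun t ht => (bf t ht).mul bZ).integrable, integral_const_mul, h1, mul_one,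
    integral_finsetSum _ fun t ht => ((bf t ht).mul bZ).integrable, Finset.sum_eq_zero, add_zero]
  intro t ht
  obtain ⟨hm, hb, h0, -⟩ := hf t (Finset.mem_range.1 ht)
  rw [← integral_mul_condExp (hT.le t) hb hm bZ]
  have h2 : ∫ ω, f t ω * (P[Z | A t]) ω ∂P = ∫ ω, f t ω * (P[Z | G t]) ω ∂P := by
    apply integral_congr_ae
    filter_upwards [hZ t (Finset.mem_range.1 ht)] with ω h
    rw [h]
  rw [h2, integral_condExp_mul_condExp (hT.G_le t) hb bZ]
  rw [← integral_zero Ω ℝ (μ := P)]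
  apply integral_congr_ae
  filter_upwards [h0] with ω h
  rw [h]; simp

/-- Two interlaced filtrations which are conditionally independent, as for the product of the
laws of two processes. -/
structure IsFrame {Ω : Type*} (mY : MeasurableSpace Ω) [mΩ : MeasurableSpace Ω] (P : Measure Ω)
    (A B G H : ℕ → MeasurableSpace Ω) (n : ℕ) : Prop where
  towerA : IsTower A G
  towerB : IsTower B G
  B_le : ∀ t, B t ≤ H t
  Y_le : ∀ t, mY ≤ H t
  H_le : ∀ t, H t ≤ mΩ
  top : mΩ ≤ G n
  ind : ∀ t < n, ∀ a : Ω → ℝ, StronglyMeasurable[A t] a → Bdd P a →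
    P[a | H t] =ᵐ[P] P[a | G t]

variable [IsProbabilityMeasure P]

lemma IsFrame.condExp_A (F : IsFrame mY P A B G H n) {t : ℕ} (ht : t < n) {φ : Ω → ℝ}
    (hφ : StronglyMeasurable[H t] φ) (bφ : Bdd P φ) : P[φ | A t] =ᵐ[P] P[φ | G t] := by
  have hA := F.towerA.le t
  have hG := F.towerA.G_le t
  have hGA := F.towerA.le_A t
  refine (ae_eq_condExp_of_forall_setIntegral_eq hA bφ.integrable
    (fun s _ _ => integrable_condExp.integrableOn) ?_
    (stronglyMeasurable_condExp.mono hGA).aestronglyMeasurable).symm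
  intro s hs _
  have hs' := hA s hs
  set a : Ω → ℝ := s.indicator fun _ => 1 with ha
  have ham : StronglyMeasurable[A t] a := stronglyMeasurable_const.indicator hs
  have bA : Bdd P a := by
    refine ⟨(ham.mono hA).aestronglyMeasurable, 1, Eventually.of_forall fun ω => ?_⟩
    simp only [ha, indicator]
    split_ifs <;> simp
  have e : ∀ ψ : Ω → ℝ, ∫ ω in s, ψ ω ∂P = ∫ ω, ψ ω * a ω ∂P := by
    intro ψ
    rw [← integral_indicator hs']
    congr 1; ext ω
    simp only [ha, indicator]
    split_ifs <;> simp
  rw [e, e]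
  have h1 := F.ind t ht a ham bA
  have h2 := integral_mul_condExp (F.H_le t) bφ hφ bA
  rw [← h2]
  have h3 := integral_condExp_mul_condExp hG bφ bA
  rw [← h3]
  apply integral_congr_ae
  filter_upwards [h1] with ω h
  rw [h]

lemma IsFrame.condExp_B (F : IsFrame mY P A B G H n) {t : ℕ} (ht : t < n) {φ : Ω → ℝ}
    (hφ : StronglyMeasurable[A t] φ) (bφ : Bdd P φ) : P[φ | B t] =ᵐ[P] P[φ | G t] := by
  have h1 := condExp_condExp_of_le (μ := P) (f := φ) (F.B_le t) (F.H_le t)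
  have h2 := condExp_congr_ae (m := B t) (F.ind t ht φ hφ bφ)
  rw [condExp_ae_eq_self (F.towerB.le t) (bφ.condExp (F.towerA.G_le t))
    (stronglyMeasurable_condExp.mono (F.towerB.le_A t))] at h2
  exact h1.symm.trans h2

omit [IsProbabilityMeasure P] in
/-- A bounded function has a bounded version measurable for a finer σ-algebra. -/
lemma Bdd.exists_stronglyMeasurable {w : Ω → ℝ} (bw : Bdd P w) {m : ℕ} (hm : mΩ ≤ G m) :
    ∃ w', StronglyMeasurable[G m] w' ∧ Bdd P w' ∧ w =ᵐ[P] w' :=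
  ⟨_, bw.1.stronglyMeasurable_mk.mono hm, bw.congr bw.1.ae_eq_mk, bw.1.ae_eq_mk⟩

lemma IsTower.exists_ann (hT : IsTower A G) (htop : mΩ ≤ G n) (V : ℕ → Ω → ℝ) (β : ℕ → ℝ)
    (hV : ∀ t, Bdd P (V t))
    (hβ : ∀ t < n, ∃ ψ : Ω → ℝ, StronglyMeasurable[G t] ψ ∧ Bdd P ψ ∧
      (P[fun ω => Real.exp (V (t + 1) ω) | A t] =ᵐ[P] fun ω => Real.exp (ψ ω)) ∧
      ∀ᵐ ω ∂P, |ψ ω - V t ω| ≤ β t) (j : ℕ)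
    (hj : ∀ t < n, n ≤ t + j → β t ≤ 2 * 3 ^ (n - 1 - t) * M)
    {w : Ω → ℝ} (bw : Bdd P w) (hw : ∀ᵐ ω ∂P, |w ω - V n ω| ≤ M) :
    ∃ f, AdaptedSum P A G n M (j + 1) f ∧
      Ann P (AdaptedSum P A G n M 0) (fun ω => Real.exp (f ω + w ω)) := by
  obtain ⟨w', hwm, bw', hww⟩ := bw.exists_stronglyMeasurable htop
  obtain ⟨γ, f, hf, hZ, h1⟩ := hT.exists_projection V β hV n hβ w' M hwm bw'
    (by filter_upwards [hw, hww] with ω h1 h2; rwa [← h2])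
  refine ⟨fun ω => γ + ∑ t ∈ Finset.range n, f t ω, ⟨γ, f, fun t ht => ?_, ?_⟩, ?_⟩
  · obtain ⟨h2, h3, h4, h5⟩ := hf t ht
    refine ⟨h2, h3, h4, fun hn => ?_⟩
    filter_upwards [h5] with ω h6
    refine h6.trans ?_
    have h7 : ∑ s ∈ Finset.Ico (t + 1) n, β s
        ≤ ∑ s ∈ Finset.Ico (t + 1) n, 2 * 3 ^ (n - 1 - s) * M :=
      Finset.sum_le_sum fun s hs => by
        rw [Finset.mem_Ico] at hs
        exact hj s hs.2 (by omega)
    have h8 : ∀ k t : ℕ, n = t + 1 + k → M + ∑ s ∈ Finset.Ico (t + 1) n, 2 * 3 ^ (n - 1 - s) * M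
        = 3 ^ k * M := by
      intro k
      induction k with
      | zero => intro t ht; simp [ht]
      | succ k ih =>
        intro t ht
        rw [← Finset.insert_Ico_add_one_left_eq_Ico (by omega : t + 1 < n),
          Finset.sum_insert (by simp)]
        have := ih (t + 1) (by omega)
        rw [show n - 1 - (t + 1) = k by omega, pow_succ]
        linarith
    have h9 := h8 (n - 1 - t) t (by omega)
    calc 2 * (M + ∑ s ∈ Finset.Ico (t + 1) n, β s) ≤ 2 * (3 ^ (n - 1 - t) * M) := by linarith
      _ = _ := by ring
  · exact ae_eq_rfl
  · have bZ : Bdd P (fun ω => Real.exp (w' ω + (γ + ∑ t ∈ Finset.range n, f t ω))) :=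
      (bw'.add ((Bdd.const γ).add
        (Bdd.sum _ fun t ht => (hf t (Finset.mem_range.1 ht)).2.1))).exp
    refine (AdaptedSum.ann hT bZ hZ h1).congr ?_
    filter_upwards [hww] with ω h
    rw [h, add_comm]

/-- The dual projection for a potential which is itself an adapted sum. -/
lemma AdaptedSum.exists_ann (hA : IsTower A G) (hB : IsTower B G) (htop : mΩ ≤ G n)
    (hAB : ∀ t < n, ∀ φ : Ω → ℝ, StronglyMeasurable[B t] φ → Bdd P φ →
      P[φ | A t] =ᵐ[P] P[φ | G t])
    (bc : Bdd P c) (hc : ∀ᵐ ω ∂P, |c ω| ≤ M) {j : ℕ} {g : Ω → ℝ}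
    (hg : AdaptedSum P B G n M j g) :
    ∃ f, AdaptedSum P A G n M (j + 1) f ∧
      Ann P (AdaptedSum P A G n M 0) (fun ω => Real.exp (f ω + (g ω - c ω))) := by
  obtain ⟨γ, g', hg', hg⟩ := hg
  have bg : Bdd P g := ((Bdd.const γ).add
    (Bdd.sum _ fun t ht => (hg' t (Finset.mem_range.1 ht)).2.1)).congr hg.symm
  set h : ℕ → Ω → ℝ := fun t => if t < n then g' t else 0 with hh
  have hlt : ∀ t < n, h t = g' t := fun t ht => if_pos ht
  have bh : ∀ t, Bdd P (h t) := by
    intro t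
    by_cases ht : t < n
    · rw [hlt t ht]; exact (hg' t ht).2.1
    · simp only [hh, if_neg ht]; exact Bdd.const 0
  have hβ : ∀ t, ∃ β : ℝ, (∀ᵐ ω ∂P, |h t ω| ≤ β) ∧
      (t < n → n ≤ t + j → β ≤ 2 * 3 ^ (n - 1 - t) * M) := by
    intro t
    by_cases ht : t < n ∧ n ≤ t + j
    · refine ⟨2 * 3 ^ (n - 1 - t) * M, ?_, fun _ _ => le_rfl⟩
      rw [hlt t ht.1]
      exact (hg' t ht.1).2.2.2 ht.2
    · obtain ⟨β, h⟩ := (bh t).2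
      exact ⟨β, h, fun h1 h2 => absurd ⟨h1, h2⟩ ht⟩
  choose β hβ hβ' using hβ
  set V : ℕ → Ω → ℝ := fun t ω => γ + ∑ s ∈ Finset.range t, h s ω with hV
  have bV : ∀ t, Bdd P (V t) := fun t => (Bdd.const γ).add (Bdd.sum _ fun s _ => bh s)
  have hVn : g =ᵐ[P] V n := by
    filter_upwards [hg] with ω h1
    rw [h1, hV]
    simp only
    congr 1
    exact Finset.sum_congr rfl fun s hs => by rw [hlt s (Finset.mem_range.1 hs)]
  refine hA.exists_ann htop V β bV ?_ j (fun t ht => hβ' t ht) (bg.sub bc) ?_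
  · intro t ht
    obtain ⟨C, hCm, bC, hC, hCb⟩ := exists_log_condExp (m := G t) (hA.G_le t) (bh t)
    have hVm : StronglyMeasurable[G t] (V t) := by
      refine stronglyMeasurable_const.add (Finset.stronglyMeasurable_fun_sum _ fun s hs => ?_)
      have hs' := Finset.mem_range.1 hs
      rw [hlt s (hs'.trans ht)]
      exact (hg' s (hs'.trans ht)).1.mono (hB.A_le_G hs')
    refine ⟨fun ω => V t ω + C ω, hVm.add hCm, (bV t).add bC, ?_, ?_⟩
    · have e : (fun ω => Real.exp (V (t + 1) ω))
          = fun ω => Real.exp (V t ω) * Real.exp (h t ω) := by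
        ext ω
        rw [← Real.exp_add]
        congr 1
        simp only [hV, Finset.sum_range_succ]; ring
      rw [e]
      have h1 := condExp_mul_left (m := A t) (bV t).exp
        (Real.continuous_exp.comp_stronglyMeasurable (hVm.mono (hA.le_A t))) (bh t).exp
      have h2 := hAB t ht (fun ω => Real.exp (h t ω)) (by
        rw [hlt t ht]
        exact Real.continuous_exp.comp_stronglyMeasurable (hg' t ht).1) (bh t).exp
      filter_upwards [h1, h2, hC] with ω h1 h2 h3
      rw [h1, h2, h3, ← Real.exp_add]
    · have h0 : P[fun ω => Real.exp ((fun _ => (0 : ℝ)) ω) | G t]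
          =ᵐ[P] fun ω => Real.exp ((fun _ => (0 : ℝ)) ω) := by
        rw [condExp_const (hA.G_le t)]
      filter_upwards [hCb (fun _ => 0) (fun _ => 0) (β t) (Bdd.const 0) (by simpa using hβ t) h0]
        with ω h
      simpa using h
  · filter_upwards [hVn, hc] with ω h1 h2
    rw [← h1]
    simpa using h2

/-- The dual projection for a potential depending on the second process only. -/
lemma IsFrame.exists_ann (F : IsFrame mY P A B G H n) (bc : Bdd P c)
    (hc : ∀ᵐ ω ∂P, |c ω| ≤ M) (j : ℕ) {g : Ω → ℝ} (bg : Bdd P g)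
    (hg : ∃ g', StronglyMeasurable[mY] g' ∧ g =ᵐ[P] g') :
    ∃ f, AdaptedSum P A G n M (j + 1) f ∧
      Ann P (AdaptedSum P A G n M 0) (fun ω => Real.exp (f ω + (g ω - c ω))) := by
  have hM : 0 ≤ M := by
    obtain ⟨ω, hω⟩ := hc.exists
    exact (abs_nonneg _).trans hω
  obtain ⟨g', hgm, hgg⟩ := hg
  have bg' := bg.congr hgg
  have hlog := fun t => exists_log_condExp (m := G t) (F.towerA.G_le t) bg'
  choose V hVm bV hV hVb using hlog
  have hVn : V n =ᵐ[P] g' := by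
    obtain ⟨e, he, be, hge⟩ := bg'.exp.exists_stronglyMeasurable F.top
    have h1 := condExp_congr_ae (m := G n) hge
    rw [condExp_ae_eq_self (F.towerA.G_le n) be he] at h1
    filter_upwards [hV n, h1, hge] with ω h2 h3 h4
    exact Real.exp_injective (by rw [← h2, h3, h4])
  refine F.towerA.exists_ann F.top V (fun _ => 0) bV ?_ j (fun t _ _ => by positivity)
    (bg.sub bc) ?_
  · intro t ht
    refine ⟨V t, hVm t, bV t, ?_, by simp⟩
    have h1 := condExp_congr_ae (m := A t) (hV (t + 1))
    have h2 := condExp_condExp_of_le (μ := P) (f := fun ω => Real.exp (g' ω))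
      (F.towerA.le_G t) (F.towerA.G_le (t + 1))
    have h3 := F.condExp_A ht (φ := fun ω => Real.exp (g' ω))
      (Real.continuous_exp.comp_stronglyMeasurable (hgm.mono (F.Y_le t))) bg'.exp
    exact h1.symm.trans (h2.trans (h3.trans (hV t)))
  · filter_upwards [hVn, hgg, hc] with ω h1 h2 h3
    rw [h1, h2]
    simpa using h3

/-- Functions which agree a.e. with a bounded function measurable with respect to `m`, within
`R` of a constant from level `J` on. -/
def VersionOf {Ω : Type*} (m : MeasurableSpace Ω) [mΩ : MeasurableSpace Ω] (P : Measure Ω) (J : ℕ)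
    (R : ℝ) (j : ℕ) (g : Ω → ℝ) : Prop :=
  Bdd P g ∧ (∃ g', StronglyMeasurable[m] g' ∧ g =ᵐ[P] g') ∧
    (J ≤ j → ∃ γ : ℝ, ∀ᵐ ω ∂P, |g ω - γ| ≤ R)

omit [IsProbabilityMeasure P] in
lemma VersionOf.isClass {J : ℕ} {R : ℝ} (hJ : 0 < J) : IsClass P (VersionOf mY P J R 0) where
  bdd := fun φ h => h.1
  sub := by
    rintro φ ψ ⟨b, ⟨φ', hm, he⟩, -⟩ ⟨b', ⟨ψ', hm', he'⟩, -⟩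
    exact ⟨b.sub b', ⟨_, hm.sub hm', he.sub he'⟩, fun h => absurd h (by omega)⟩
  smul := by
    rintro a φ ⟨b, ⟨φ', hm, he⟩, -⟩
    refine ⟨b.const_mul a, ⟨_, hm.const_mul a, ?_⟩, fun h => absurd h (by omega)⟩
    filter_upwards [he] with ω h
    rw [h]
  const := fun a => ⟨Bdd.const a, ⟨_, stronglyMeasurable_const, ae_eq_rfl⟩,
    fun h => absurd h (by omega)⟩
  congr := by
    rintro φ ψ ⟨b, ⟨φ', hm, he⟩, -⟩ h
    exact ⟨b.congr h, ⟨_, hm, h.symm.trans he⟩, fun h => absurd h (by omega)⟩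

omit [IsProbabilityMeasure P] in
lemma VersionOf.shift {J : ℕ} {R : ℝ} {j : ℕ} {g g' : Ω → ℝ} (h : VersionOf mY P J R j g) (a : ℝ)
    (hg' : ∀ᵐ ω ∂P, g' ω = g ω + a) : VersionOf mY P J R j g' := by
  obtain ⟨b, ⟨φ, hm, he⟩, hR⟩ := h
  have e : (fun ω => g ω + a) =ᵐ[P] g' := EventuallyEq.symm hg'
  refine ⟨(b.add (Bdd.const a)).congr e, ⟨fun ω => φ ω + a, hm.add stronglyMeasurable_const, ?_⟩,
    fun hj => ?_⟩
  · filter_upwards [hg', he] with ω h1 h2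
    rw [h1, h2]
  · obtain ⟨γ, hγ⟩ := hR hj
    refine ⟨γ + a, ?_⟩
    filter_upwards [hγ, hg'] with ω h1 h2
    rw [h2]
    simpa using h1

lemma VersionOf.exists_ann (hm : mY ≤ mΩ) (bc : Bdd P c) (hc : ∀ᵐ ω ∂P, |c ω| ≤ M) {J : ℕ}
    {R : ℝ} (j : ℕ) {f : Ω → ℝ} (bf : Bdd P f)
    (hf : J ≤ j + 1 → ∃ γ : ℝ, ∀ᵐ ω ∂P, |f ω - γ| ≤ R - M) :
    ∃ g, VersionOf mY P J R (j + 1) g ∧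
      Ann P (VersionOf mY P J R 0) (fun ω => Real.exp (g ω + (f ω - c ω))) := by
  obtain ⟨C, hCm, bC, hC, hCb⟩ := exists_log_condExp hm (bf.sub bc)
  refine ⟨fun ω => -C ω, ⟨bC.neg, ⟨_, hCm.neg, ae_eq_rfl⟩, fun hj => ?_⟩, ?_⟩
  · obtain ⟨γ, hγ⟩ := hf hj
    have h0 : P[fun ω => Real.exp ((fun _ => γ) ω) | mY]
        =ᵐ[P] fun ω => Real.exp ((fun _ => γ) ω) := by
      rw [condExp_const hm]
    have h1 := hCb (fun _ => γ) (fun _ => γ) R (Bdd.const γ) (by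
      filter_upwards [hγ, hc] with ω h1 h2
      rw [abs_le] at *
      constructor <;> linarith [h1.1, h1.2, h2.1, h2.2]) h0
    refine ⟨-γ, ?_⟩
    filter_upwards [h1] with ω h
    rw [abs_sub_comm] at h
    simpa [sub_eq_add_neg, add_comm] using h
  · rintro φ ⟨bφ, ⟨φ', hφm, hφ⟩, -⟩
    have bφ' := bφ.congr hφ
    set D : Ω → ℝ := fun ω => φ' ω * Real.exp (-C ω) with hD
    have bD : Bdd P D := bφ'.mul bC.neg.exp
    have hDm : StronglyMeasurable[mY] D :=
      hφm.mul (Real.continuous_exp.comp_stronglyMeasurable hCm.neg)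
    have e1 : ∫ ω, φ ω * Real.exp (-C ω + (f ω - c ω)) ∂P
        = ∫ ω, D ω * Real.exp (f ω - c ω) ∂P := by
      apply integral_congr_ae
      filter_upwards [hφ] with ω h
      rw [h, Real.exp_add, hD, mul_assoc]
    rw [e1, ← integral_mul_condExp hm bD hDm (bf.sub bc).exp]
    apply integral_congr_ae
    filter_upwards [hC, hφ] with ω h1 h2
    rw [h1, h2, hD]
    simp only
    rw [mul_assoc, ← Real.exp_add]
    simp

lemma integral_mul_eq_zero_of_condExp {m : ℕ} (hm : G m ≤ mΩ) {φ ψ : Ω → ℝ} (bφ : Bdd P φ)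
    (bψ : Bdd P ψ) (hφ : StronglyMeasurable[G m] φ) (hψ : P[ψ | G m] =ᵐ[P] 0) :
    ∫ ω, φ ω * ψ ω ∂P = 0 := by
  rw [← integral_mul_condExp hm bφ hφ bψ, ← integral_zero Ω ℝ (μ := P)]
  apply integral_congr_ae
  filter_upwards [hψ] with ω h
  rw [h]; simp

lemma IsFrame.orth_bicausal (F : IsFrame mY P A B G H n) :
    Orth P (AdaptedSum P A G n M 0) (AdaptedSum P B G n M 0) := by
  have hcross : ∀ (γ : ℝ) (g : ℕ → Ω → ℝ), (∀ t < n, StronglyMeasurable[B t] (g t) ∧ Bdd P (g t) ∧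
      P[g t | G t] =ᵐ[P] 0) → ∀ s < n, ∀ f : Ω → ℝ, StronglyMeasurable[A s] f → Bdd P f →
      P[f | G s] =ᵐ[P] 0 → ∫ ω, f ω * (γ + ∑ t ∈ Finset.range n, g t ω) ∂P = 0 := by
    intro γ g hg s hs f hf bf h0
    have e : ∀ ω, f ω * (γ + ∑ t ∈ Finset.range n, g t ω)
        = γ * f ω + ∑ t ∈ Finset.range n, f ω * g t ω := fun ω => by
      rw [mul_add, Finset.mul_sum, mul_comm]
    simp_rw [e]
    rw [integral_add (bf.const_mul γ).integrable
      (Bdd.sum _ fun t ht => bf.mul (hg t (Finset.mem_range.1 ht)).2.1).integrable,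
      integral_finsetSum _ fun t ht => (bf.mul (hg t (Finset.mem_range.1 ht)).2.1).integrable,
      Finset.sum_eq_zero]
    · rw [integral_const_mul, ← integral_condExp (F.towerA.G_le s), integral_congr_ae h0]
      simp
    · intro t ht
      obtain ⟨hgm, bg, hg0⟩ := hg t (Finset.mem_range.1 ht)
      rcases lt_trichotomy s t with h | rfl | h
      · exact integral_mul_eq_zero_of_condExp (F.towerA.G_le t) bf bg
          (hf.mono (F.towerA.A_le_G h)) hg0
      · rw [← integral_mul_condExp (F.towerA.le s) bf hf bg, ← integral_zero Ω ℝ (μ := P)]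
        apply integral_congr_ae
        filter_upwards [F.condExp_A hs (hgm.mono (F.B_le s)) bg, hg0] with ω h1 h2
        rw [h1, h2]; simp
      · simp_rw [mul_comm (f _)]
        exact integral_mul_eq_zero_of_condExp (F.towerA.G_le s) bg bf
          (hgm.mono (F.towerB.A_le_G h)) h0
  rintro φ ψ ⟨γ, f, hf, hφ⟩ ⟨γ', g, hg, hψ⟩
  have bf : ∀ t ∈ Finset.range n, Bdd P (f t) := fun t ht => (hf t (Finset.mem_range.1 ht)).2.1
  have bψ : Bdd P ψ := ((Bdd.const γ').add
    (Bdd.sum _ fun t ht => (hg t (Finset.mem_range.1 ht)).2.1)).congr hψ.symm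
  have e1 : ∫ ω, φ ω ∂P = γ := by
    rw [integral_congr_ae hφ, integral_add (integrable_const _) (Bdd.sum _ bf).integrable,
      integral_finsetSum _ fun t ht => (bf t ht).integrable, Finset.sum_eq_zero]
    · simp
    · intro t ht
      rw [← integral_condExp (F.towerA.G_le t),
        integral_congr_ae (hf t (Finset.mem_range.1 ht)).2.2.1]
      simp
  have e2 : ∫ ω, φ ω * ψ ω ∂P = ∫ ω, (γ * ψ ω + ∑ t ∈ Finset.range n, f t ω * ψ ω) ∂P := by
    apply integral_congr_ae
    filter_upwards [hφ] with ω h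
    rw [h, add_mul, Finset.sum_mul]
  rw [e1, e2, integral_add (bψ.const_mul γ).integrable
    (Bdd.sum _ fun t ht => (bf t ht).mul bψ).integrable, integral_const_mul,
    integral_finsetSum _ fun t ht => ((bf t ht).mul bψ).integrable, Finset.sum_eq_zero, add_zero]
  intro t ht
  obtain ⟨hm, hb, h0, -⟩ := hf t (Finset.mem_range.1 ht)
  rw [← hcross γ' g (fun t ht => ⟨(hg t ht).1, (hg t ht).2.1, (hg t ht).2.2.1⟩) t
    (Finset.mem_range.1 ht) (f t) hm hb h0]
  apply integral_congr_ae
  filter_upwards [hψ] with ω h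
  rw [h]

lemma IsFrame.orth_causal (F : IsFrame mY P A B G H n) {J : ℕ} {R : ℝ} :
    Orth P (AdaptedSum P A G n M 0) (VersionOf mY P J R 0) := by
  rintro φ ψ ⟨γ, f, hf, hφ⟩ ⟨bψ, ⟨ψ', hψm, hψ⟩, -⟩
  have bf : ∀ t ∈ Finset.range n, Bdd P (f t) := fun t ht => (hf t (Finset.mem_range.1 ht)).2.1
  have e1 : ∫ ω, φ ω ∂P = γ := by
    rw [integral_congr_ae hφ, integral_add (integrable_const _) (Bdd.sum _ bf).integrable,
      integral_finsetSum _ fun t ht => (bf t ht).integrable, Finset.sum_eq_zero]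
    · simp
    · intro t ht
      rw [← integral_condExp (F.towerA.G_le t),
        integral_congr_ae (hf t (Finset.mem_range.1 ht)).2.2.1]
      simp
  have e2 : ∫ ω, φ ω * ψ ω ∂P = ∫ ω, (γ * ψ ω + ∑ t ∈ Finset.range n, f t ω * ψ ω) ∂P := by
    apply integral_congr_ae
    filter_upwards [hφ] with ω h
    rw [h, add_mul, Finset.sum_mul]
  rw [e1, e2, integral_add (bψ.const_mul γ).integrable
    (Bdd.sum _ fun t ht => (bf t ht).mul bψ).integrable, integral_const_mul,
    integral_finsetSum _ fun t ht => ((bf t ht).mul bψ).integrable, Finset.sum_eq_zero, add_zero]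
  intro t ht
  obtain ⟨hm, hb, h0, -⟩ := hf t (Finset.mem_range.1 ht)
  have e3 : ∫ ω, f t ω * ψ ω ∂P = ∫ ω, ψ' ω * f t ω ∂P := by
    apply integral_congr_ae
    filter_upwards [hψ] with ω h
    rw [h, mul_comm]
  rw [e3]
  exact integral_mul_eq_zero_of_condExp (G := H) (F.H_le t) (bψ.congr hψ) hb
    (hψm.mono (F.Y_le t)) ((F.ind t (Finset.mem_range.1 ht) _ hm hb).trans h0)

lemma IsFrame.isLadder_bicausal (F : IsFrame mY P A B G H n) (bc : Bdd P c)
    (hc : ∀ᵐ ω ∂P, |c ω| ≤ M) (hM : 0 ≤ M) :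
    IsLadder P c M (3 ^ n * M + M) (n + 1) (AdaptedSum P A G n M) (AdaptedSum P B G n M) where
  bddc := bc
  lec := hc
  classX := AdaptedSum.isClass hM
  classY := AdaptedSum.isClass hM
  orth := F.orth_bicausal
  stepX := fun j g hg => hg.exists_ann F.towerA F.towerB F.top
    (fun t ht φ hφ bφ => F.condExp_A ht (hφ.mono (F.B_le t)) bφ) bc hc
  stepY := fun j f hf => hf.exists_ann F.towerB F.towerA F.top
    (fun t ht φ hφ bφ => F.condExp_B ht hφ bφ) bc hc
  antiX := fun _ _ h => h.anti
  antiY := fun _ _ h => h.anti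
  shiftX := fun _ _ _ a h h' => h.shift a h'
  shiftY := fun _ _ _ a h h' => h.shift a h'
  constX := fun j a => AdaptedSum.const hM j a
  constY := fun j a => AdaptedSum.const hM j a
  boundX := fun f hf => by
    obtain ⟨γ, h⟩ := hf.exists_abs_sub_le hM (by omega)
    exact ⟨γ, by filter_upwards [h] with ω h; linarith⟩
  boundY := fun f hf => by
    obtain ⟨γ, h⟩ := hf.exists_abs_sub_le hM (by omega)
    exact ⟨γ, by filter_upwards [h] with ω h; linarith⟩

lemma IsFrame.isLadder_causal (F : IsFrame mY P A B G H n) (bc : Bdd P c)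
    (hc : ∀ᵐ ω ∂P, |c ω| ≤ M) (hM : 0 ≤ M) :
    IsLadder P c M (3 ^ n * M + M) (n + 1) (AdaptedSum P A G n M)
      (VersionOf mY P (n + 1) (3 ^ n * M + M)) where
  bddc := bc
  lec := hc
  classX := AdaptedSum.isClass hM
  classY := VersionOf.isClass (by omega)
  orth := F.orth_causal
  stepX := fun j g hg => F.exists_ann bc hc j hg.1 hg.2.1
  stepY := fun j f hf => by
    refine VersionOf.exists_ann ((F.Y_le 0).trans (F.H_le 0)) bc hc j ?_ fun hj => ?_
    · obtain ⟨γ, f', hf', hs⟩ := hf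
      exact ((Bdd.const γ).add
        (Bdd.sum _ fun t ht => (hf' t (Finset.mem_range.1 ht)).2.1)).congr hs.symm
    · simpa using hf.exists_abs_sub_le hM (by omega)
  antiX := fun _ _ h => h.anti
  antiY := fun _ _ h => ⟨h.1, h.2.1, fun hj => h.2.2 (by omega)⟩
  shiftX := fun _ _ _ a h h' => h.shift a h'
  shiftY := fun _ _ _ a h h' => h.shift a h'
  constX := fun j a => AdaptedSum.const hM j a
  constY := fun j a => ⟨Bdd.const a, ⟨_, stronglyMeasurable_const, ae_eq_rfl⟩, fun _ =>
    ⟨a, Eventually.of_forall fun ω => by simp only [sub_self, abs_zero]; positivity⟩⟩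
  boundX := fun f hf => by
    obtain ⟨γ, h⟩ := hf.exists_abs_sub_le hM (by omega)
    exact ⟨γ, by filter_upwards [h] with ω h; linarith⟩
  boundY := fun g hg => hg.2.2 le_rfl

end Adapted

section CondDistrib

/-- Conditional expectations computed with a regular conditional distribution. -/
lemma condExp_ae_eq_integral_kernel {Ω Ω₁ E : Type*} [mΩ : MeasurableSpace Ω]
    [m₁ : MeasurableSpace Ω₁] [MeasurableSpace E] [StandardBorelSpace E] {π : Measure Ω}
    [IsProbabilityMeasure π] {r : Ω → Ω₁} (hr : Measurable r) {V : Ω → E} (hV : Measurable V)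
    {K : Ω₁ → Measure E} (hK : ∀ ω, IsProbabilityMeasure (K ω))
    (hKm : ∀ A, MeasurableSet A → Measurable fun ω => (K ω A).toReal)
    (hKc : ∀ A, MeasurableSet A → π[(V ⁻¹' A).indicator (fun _ => (1 : ℝ)) | m₁.comap r]
      =ᵐ[π] fun ω => (K (r ω) A).toReal)
    {φ : Ω₁ × E → ℝ} (hφ : StronglyMeasurable φ) (bφ : Bdd π fun ω => φ (r ω, V ω)) :
    StronglyMeasurable (fun ω => ∫ x, φ (ω, x) ∂(K ω)) ∧
      π[fun ω => φ (r ω, V ω) | m₁.comap r] =ᵐ[π] fun ω => ∫ x, φ (r ω, x) ∂(K (r ω)) := by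
  have : Nonempty E := (inferInstance : (ae π).NeBot).nonempty.map V
  let κ : Kernel Ω₁ E := ⟨K, Measure.measurable_of_measurable_coe _ fun A hA => by
    have h := (hKm A hA).ennreal_ofReal
    simpa [ENNReal.ofReal_toReal (measure_ne_top _ _)] using h⟩
  have hκ : ∀ ω, κ ω = K ω := fun _ => rfl
  have : IsMarkovKernel κ := ⟨hK⟩
  refine ⟨hφ.integral_kernel_prod_right' (κ := κ), ?_⟩
  have hcomp : π.map (fun ω => (r ω, V ω)) = π.map r ⊗ₘ κ := by
    have := Measure.isProbabilityMeasure_map (μ := π) hr.aemeasurable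
    have := Measure.isProbabilityMeasure_map (μ := π) (hr.prodMk hV).aemeasurable
    refine Measure.ext_prod fun {s t} hs ht => ?_
    rw [Measure.compProd_apply_prod hs ht, setLIntegral_map hs (κ.measurable_coe ht) hr,
      Measure.map_apply (hr.prodMk hV) (hs.prod ht)]
    have e1 : ∫ ω in r ⁻¹' s, (K (r ω) t).toReal ∂π = π.real (r ⁻¹' s ∩ V ⁻¹' t) := by
      rw [← setIntegral_congr_ae (g := fun ω => (K (r ω) t).toReal) (hr hs)
        ((hKc t ht).mono fun ω h _ => h), setIntegral_condExp hr.comap_le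
          ((integrable_const _).indicator (hV ht)) ⟨s, hs, rfl⟩,
        setIntegral_indicator (hV ht)]
      simp
    have e2 : ∫⁻ ω in r ⁻¹' s, κ (r ω) t ∂π
        = ENNReal.ofReal (∫ ω in r ⁻¹' s, (K (r ω) t).toReal ∂π) := by
      rw [ofReal_integral_eq_lintegral_ofReal]
      · simp [hκ, ENNReal.ofReal_toReal (measure_ne_top _ _)]
      · refine Integrable.of_bound ((hKm t ht).comp hr).aestronglyMeasurable 1
          (Eventually.of_forall fun ω => ?_)
        rw [Real.norm_eq_abs, abs_of_nonneg ENNReal.toReal_nonneg]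
        exact ENNReal.toReal_le_of_le_ofReal zero_le_one (by simpa using prob_le_one)
      · exact Eventually.of_forall fun ω => ENNReal.toReal_nonneg
    rw [e2, e1, Measure.real, ENNReal.ofReal_toReal (measure_ne_top _ _)]
    rfl
  have h1 := condExp_prod_ae_eq_integral_condDistrib hr hV.aemeasurable hφ bφ.integrable
  have h2 := ae_of_ae_map hr.aemeasurable
    (condDistrib_ae_eq_of_measure_eq_compProd r hV.aemeasurable hcomp)
  filter_upwards [h1, h2] with ω h1 h2
  rw [h1, h2]
  rfl

/-- Conditional expectations are compatible with image measures. -/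
lemma condExp_map_comp {Ω Ω' : Type*} [mΩ : MeasurableSpace Ω] {m : MeasurableSpace Ω'}
    [mΩ' : MeasurableSpace Ω'] {π : Measure Ω} [IsProbabilityMeasure π] {e : Ω → Ω'}
    (he : Measurable e) (hm : m ≤ mΩ') {φ : Ω' → ℝ} (bφ : Bdd (π.map e) φ) :
    π[fun ω => φ (e ω) | m.comap e] =ᵐ[π] fun ω => ((π.map e)[φ | m]) (e ω) := by
  have := Measure.isProbabilityMeasure_map (μ := π) he.aemeasurable
  have hme : m.comap e ≤ mΩ := (MeasurableSpace.comap_mono hm).trans he.comap_le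
  have hc : StronglyMeasurable[m] ((π.map e)[φ | m]) := stronglyMeasurable_condExp
  have hi : Integrable (fun ω => ((π.map e)[φ | m]) (e ω)) π :=
    integrable_condExp.comp_measurable he
  refine (ae_eq_condExp_of_forall_setIntegral_eq hme (bφ.integrable.comp_measurable he)
    (fun s _ _ => hi.integrableOn) ?_ ?_).symm
  · rintro _ ⟨s, hs, rfl⟩ -
    rw [← setIntegral_map (hm s hs) (hc.mono hm).aestronglyMeasurable he.aemeasurable,
      setIntegral_condExp hm bφ.integrable hs,
      setIntegral_map (hm s hs) bφ.1 he.aemeasurable]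
    rfl
  · exact (hc.comp_measurable (comap_measurable e)).aestronglyMeasurable

lemma sup_eq_generateFrom_inter {Ω : Type*} (m₁ m₂ : MeasurableSpace Ω) :
    m₁ ⊔ m₂ = MeasurableSpace.generateFrom
      {u | ∃ s t, MeasurableSet[m₁] s ∧ MeasurableSet[m₂] t ∧ s ∩ t = u} := by
  apply le_antisymm
  · refine sup_le (fun s hs => ?_) (fun s hs => ?_)
    · exact MeasurableSpace.measurableSet_generateFrom
        ⟨s, univ, hs, MeasurableSet.univ, inter_univ s⟩
    · exact MeasurableSpace.measurableSet_generateFrom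
        ⟨univ, s, MeasurableSet.univ, hs, univ_inter s⟩
  · refine MeasurableSpace.generateFrom_le ?_
    rintro _ ⟨s, t, hs, ht, rfl⟩
    exact MeasurableSet.inter (m := m₁ ⊔ m₂) ((le_sup_left : m₁ ≤ m₁ ⊔ m₂) s hs)
      ((le_sup_right : m₂ ≤ m₁ ⊔ m₂) t ht)

lemma isPiSystem_inter {Ω : Type*} (m₁ m₂ : MeasurableSpace Ω) :
    IsPiSystem {u : Set Ω | ∃ s t, MeasurableSet[m₁] s ∧ MeasurableSet[m₂] t ∧ s ∩ t = u} := by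
  rintro _ ⟨s, t, hs, ht, rfl⟩ _ ⟨s', t', hs', ht', rfl⟩ -
  exact ⟨s ∩ s', t ∩ t', hs.inter hs', ht.inter ht', inter_inter_inter_comm _ _ _ _⟩

/-- A conditional expectation given a supremum of two σ-algebras is determined on rectangles. -/
lemma condExp_sup_ae_eq {Ω : Type*} {m₁ m₂ : MeasurableSpace Ω} [mΩ : MeasurableSpace Ω]
    {π : Measure Ω} [IsProbabilityMeasure π] (h₁ : m₁ ≤ mΩ) (h₂ : m₂ ≤ mΩ) {φ ψ : Ω → ℝ}
    (bφ : Bdd π φ) (bψ : Bdd π ψ) (hψ : StronglyMeasurable[m₁ ⊔ m₂] ψ)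
    (h : ∀ s t, MeasurableSet[m₁] s → MeasurableSet[m₂] t →
      ∫ ω in s ∩ t, φ ω ∂π = ∫ ω in s ∩ t, ψ ω ∂π) :
    π[φ | m₁ ⊔ m₂] =ᵐ[π] ψ := by
  refine (ae_eq_condExp_of_forall_setIntegral_eq (sup_le h₁ h₂) bφ.integrable
    (fun s _ _ => bψ.integrable.integrableOn) ?_ hψ.aestronglyMeasurable).symm
  intro s hs _
  have hle := sup_le h₁ h₂
  have hall : ∫ ω, ψ ω ∂π = ∫ ω, φ ω ∂π := by
    simpa using (h univ univ MeasurableSet.univ MeasurableSet.univ).symm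
  induction s, hs using
    MeasurableSpace.induction_on_inter (sup_eq_generateFrom_inter m₁ m₂) (isPiSystem_inter m₁ m₂) with
  | empty => simp
  | basic u hu =>
    obtain ⟨s, t, hs, ht, rfl⟩ := hu
    exact (h s t hs ht).symm
  | compl u hu ih =>
    have e1 := integral_add_compl (hle u hu) bφ.integrable
    have e2 := integral_add_compl (hle u hu) bψ.integrable
    have := ih (measure_lt_top _ _)
    linarith
  | iUnion u hd hu ih =>
    rw [integral_iUnion (fun i => hle _ (hu i)) hd bψ.integrable.integrableOn,
      integral_iUnion (fun i => hle _ (hu i)) hd bφ.integrable.integrableOn]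
    exact tsum_congr fun i => ih i (measure_lt_top _ _)

end CondDistrib

section Past

lemma pastσOf_zero {A : Type*} (m : Fin N → MeasurableSpace A) : pastσOf m 0 = ⊥ := by
  simp [pastσOf]

lemma pastσOf_succ {A : Type*} (m : Fin N → MeasurableSpace A) (τ : Fin N) :
    pastσOf m (τ + 1) = pastσOf m τ ⊔ m τ := by
  apply le_antisymm
  · refine iSup₂_le fun s hs => ?_
    rcases Nat.lt_succ_iff_lt_or_eq.1 hs with h | h
    · exact le_sup_of_le_left (le_iSup₂_of_le s h le_rfl)
    · rw [Fin.ext h]; exact le_sup_right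
  · exact sup_le (iSup₂_le fun s hs => le_iSup₂_of_le s (Nat.lt_succ_of_lt hs) le_rfl)
      (le_iSup₂_of_le τ (Nat.lt_succ_self _) le_rfl)

lemma pastσOf_mono {A : Type*} (m : Fin N → MeasurableSpace A) : Monotone (pastσOf m) :=
  fun _ _ hst => iSup₂_le fun s hs => le_iSup₂_of_le s (lt_of_lt_of_le hs hst) le_rfl

lemma pastσ_le (t : ℕ) : pastσ X t ≤ MeasurableSpace.pi :=
  iSup₂_le fun s _ => (measurable_pi_apply s).comap_le

lemma le_pastσ {t : ℕ} (ht : N ≤ t) : MeasurableSpace.pi ≤ pastσ X t :=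
  iSup_le fun s => le_iSup₂_of_le (f := fun (s : Fin N) (_ : (s : ℕ) < t) => coordσ X s) s
    (s.2.trans_le ht) le_rfl

variable {Ω E : Type*} {m m' : MeasurableSpace Ω} {mq : MeasurableSpace E}

/-- The σ-algebra generated by the coordinates before time `t` of a process `p`. -/
@[reducible]
def past (p : Ω → ∀ t, X t) (t : ℕ) : MeasurableSpace Ω := (pastσ X t).comap p

lemma past_zero (p : Ω → ∀ t, X t) : past p 0 = ⊥ := by
  rw [past, pastσ, pastσOf_zero, MeasurableSpace.comap_bot]

lemma past_mono (p : Ω → ∀ t, X t) : Monotone (past p) :=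
  fun _ _ h => MeasurableSpace.comap_mono (pastσOf_mono _ h)

lemma past_eq_iSup (p : Ω → ∀ t, X t) (t : ℕ) : past p t
    = ⨆ s : Fin N, ⨆ _ : (s : ℕ) < t, MeasurableSpace.comap (fun ω => p ω s) inferInstance := by
  simp only [past, pastσ, pastσOf, coordσ, MeasurableSpace.comap_iSup, MeasurableSpace.comap_comp]
  rfl

variable [mΩ : MeasurableSpace Ω] [mE : MeasurableSpace E]

lemma past_le {p : Ω → ∀ t, X t} (hp : Measurable p) (t : ℕ) : past p t ≤ mΩ :=
  (MeasurableSpace.comap_mono (pastσ_le t)).trans hp.comap_le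

omit mΩ in
lemma measurable_apply_past (p : Ω → ∀ t, X t) {τ : Fin N} {t : ℕ} (h : (τ : ℕ) < t) :
    Measurable[past p t] fun ω => p ω τ := by
  rw [measurable_iff_comap_le, past_eq_iSup]
  exact le_iSup₂_of_le (f := fun (s : Fin N) (_ : (s : ℕ) < t) =>
    MeasurableSpace.comap (fun ω => p ω s) inferInstance) τ h le_rfl

/-- `upd` modifies one coordinate of the process `p` and leaves the random element `q`
unchanged. -/
structure IsUpdate (p : Ω → ∀ t, X t) (q : Ω → E) (upd : ∀ τ, Ω → X τ → Ω) : Prop where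
  measp : Measurable p
  measq : Measurable q
  upd_p : ∀ τ ω x, p (upd τ ω x) = Function.update (p ω) τ x
  upd_q : ∀ τ ω x, q (upd τ ω x) = q ω
  ext : ∀ ω ω', p ω = p ω' → q ω = q ω' → ω = ω'

variable {p : Ω → ∀ t, X t} {q : Ω → E} {upd : ∀ τ, Ω → X τ → Ω}

lemma IsUpdate.upd_self (U : IsUpdate p q upd) (τ : Fin N) (ω : Ω) : upd τ ω (p ω τ) = ω :=
  U.ext _ _ (by rw [U.upd_p, Function.update_eq_self]) (U.upd_q _ _ _)

lemma IsUpdate.measurable_upd (U : IsUpdate p q upd) (τ : Fin N) :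
    @Measurable (Ω × X τ) Ω
      (@Prod.instMeasurableSpace Ω (X τ) (past p τ ⊔ mq.comap q) inferInstance)
      (past p (τ + 1) ⊔ mq.comap q) (fun z => upd τ z.1 z.2) := by
  have hp := U.upd_p
  have hq := U.upd_q
  clear U
  have hpast : ∀ s : Fin N, (s : ℕ) < τ → Measurable[past p τ ⊔ mq.comap q] fun ω => p ω s :=
    fun s hs => (measurable_apply_past p hs).mono le_sup_left le_rfl
  have hq' : @Measurable _ _ (past p τ ⊔ mq.comap q) mq q :=
    (comap_measurable q).mono le_sup_right le_rfl
  rw [measurable_iff_le_map, past_eq_iSup p (τ + 1)]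
  refine sup_le (iSup₂_le fun s hs => ?_) ?_
  · rw [← measurable_iff_le_map, measurable_comap_iff]
    by_cases h : s = τ
    · subst h
      have e : (fun ω => p ω s) ∘ (fun z : Ω × X s => upd s z.1 z.2) = Prod.snd := by
        ext z; simp [hp]
      rw [e]; exact @measurable_snd _ _ (_) _
    · have e : (fun ω => p ω s) ∘ (fun z : Ω × X τ => upd τ z.1 z.2)
          = (fun ω => p ω s) ∘ Prod.fst := by
        ext z; simp [hp, h]
      rw [e]
      have hs' : (s : ℕ) < τ := lt_of_le_of_ne (Nat.lt_succ_iff.1 hs) fun h' => h (Fin.ext h')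
      exact (hpast s hs').comp (@measurable_fst _ _ (_) _)
  · rw [← measurable_iff_le_map, measurable_comap_iff]
    have e : q ∘ (fun z : Ω × X τ => upd τ z.1 z.2) = q ∘ Prod.fst := by
      ext z; simp [hq]
    rw [e]
    exact hq'.comp (@measurable_fst _ _ (_) _)

variable {π P : Measure Ω} [IsProbabilityMeasure π] [IsProbabilityMeasure P] {τ : Fin N}

lemma IsUpdate.condExp_update [StandardBorelSpace (X τ)] (U : IsUpdate p q upd)
    (hm : mq ≤ mE) {K : (∀ s, X s) → Measure (X τ)}
    (hK : IsCondDistrib' π (fun ω => p ω τ) (past p τ ⊔ mq.comap q) fun ω => K (p ω))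
    {a : Ω → ℝ} (ha : StronglyMeasurable[past p (τ + 1) ⊔ mq.comap q] a) (ba : Bdd π a) :
    StronglyMeasurable[past p τ ⊔ mq.comap q] (fun ω => ∫ x, a (upd τ ω x) ∂(K (p ω))) ∧
      π[a | past p τ ⊔ mq.comap q] =ᵐ[π] fun ω => ∫ x, a (upd τ ω x) ∂(K (p ω)) := by
  have hle : past p τ ⊔ mq.comap q ≤ mΩ :=
    sup_le (past_le U.measp _) ((MeasurableSpace.comap_mono hm).trans U.measq.comap_le)
  have hV : Measurable fun ω => p ω τ := (measurable_pi_apply τ).comp U.measp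
  have h := condExp_ae_eq_integral_kernel (m₁ := past p τ ⊔ mq.comap q) (π := π) (r := id)
    (measurable_id'' hle) hV (K := fun ω => K (p ω)) hK.1 hK.2.1
    (by rw [MeasurableSpace.comap_id]; exact hK.2.2)
    (φ := fun z => a (upd τ z.1 z.2))
    (@StronglyMeasurable.comp_measurable _ _ _ _ _ _ _ _ ha (U.measurable_upd τ))
    (by simpa only [id, U.upd_self] using ba)
  simpa only [id, U.upd_self, MeasurableSpace.comap_id] using h

lemma toReal_mem_Icc {E : Type*} [MeasurableSpace E] {κ : Measure E} (h : IsProbabilityMeasure κ)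
    (A : Set E) : |(κ A).toReal| ≤ 1 := by
  rw [abs_of_nonneg ENNReal.toReal_nonneg]
  exact ENNReal.toReal_le_of_le_ofReal zero_le_one (by simpa using prob_le_one)

omit [IsProbabilityMeasure π] in
lemma bdd_indicator_one {s : Set Ω} (hs : MeasurableSet s) :
    Bdd π (s.indicator fun _ => (1 : ℝ)) :=
  ⟨(measurable_const.indicator hs).aestronglyMeasurable, 1, Eventually.of_forall fun ω => by
    by_cases h : ω ∈ s <;> simp [h]⟩

omit [IsProbabilityMeasure π] in
lemma IsCondDistrib'.bdd {V : Ω → E} (hm : m ≤ mΩ) {K : Ω → Measure E}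
    (hK : IsCondDistrib' π V m K) {A : Set E} (hA : MeasurableSet A) :
    Bdd π fun ω => (K ω A).toReal :=
  ⟨((hK.2.1 A hA).mono hm le_rfl).aestronglyMeasurable, 1,
    Eventually.of_forall fun ω => toReal_mem_Icc (hK.1 ω) A⟩

/-- Regular conditional distributions pass to smaller σ-algebras with respect to which they are
measurable. -/
lemma IsCondDistrib'.mono {V : Ω → E} (hm : m ≤ m')
    (hm' : m' ≤ mΩ) {K : Ω → Measure E} (hK : IsCondDistrib' π V m' K)
    (hKm : ∀ A, MeasurableSet A → Measurable[m] fun ω => (K ω A).toReal) :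
    IsCondDistrib' π V m K := by
  refine ⟨hK.1, hKm, fun A hA => ?_⟩
  have h1 := condExp_condExp_of_le (μ := π) (f := (V ⁻¹' A).indicator fun _ => (1 : ℝ)) hm hm'
  have h2 := condExp_congr_ae (m := m) (hK.2.2 A hA)
  rw [condExp_ae_eq_self (hm.trans hm') (hK.bdd hm' hA) (hKm A hA).stronglyMeasurable] at h2
  exact h1.symm.trans h2

lemma isCondDistrib_map_iff (hp : Measurable p) {K : (∀ s, X s) → Measure (X τ)}
    (hK : ∀ x, IsProbabilityMeasure (K x))
    (hKm : ∀ A, MeasurableSet A → Measurable[pastσ X τ] fun x => (K x A).toReal) :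
    IsCondDistrib' (π.map p) (fun x => x τ) (pastσ X τ) K ↔
      IsCondDistrib' π (fun ω => p ω τ) (past p τ) (fun ω => K (p ω)) := by
  have := Measure.isProbabilityMeasure_map (μ := π) hp.aemeasurable
  have key : ∀ A, MeasurableSet A → (π[((fun ω => p ω τ) ⁻¹' A).indicator (fun _ => (1 : ℝ)) |
      past p τ] =ᵐ[π] fun ω => ((π.map p)[((fun x : ∀ s, X s => x τ) ⁻¹' A).indicator
        (fun _ => (1 : ℝ)) | pastσ X τ]) (p ω)) := fun A hA =>
    condExp_map_comp (m := pastσ X τ) hp (pastσ_le _)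
      (bdd_indicator_one (measurable_pi_apply τ hA))
  constructor
  · intro h
    refine ⟨fun ω => hK _, fun A hA => (hKm A hA).comp (comap_measurable p), fun A hA => ?_⟩
    filter_upwards [key A hA, ae_of_ae_map hp.aemeasurable (h.2.2 A hA)] with ω h1 h2
    rw [h1, h2]
  · intro h
    refine ⟨hK, hKm, fun A hA => ?_⟩
    refine (ae_map_iff hp.aemeasurable (measurableSet_eq_fun
      (stronglyMeasurable_condExp.measurable.mono (pastσ_le _) le_rfl)
      ((hKm A hA).mono (pastσ_le _) le_rfl))).2 ?_
    filter_upwards [key A hA, h.2.2 A hA] with ω h1 h2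
    rw [← h1, h2]

/-- A law on a path space is determined by its disintegration. -/
lemma IsDisintegration.eq {μ μ' : Measure (∀ t, X t)} [IsProbabilityMeasure μ]
    [IsProbabilityMeasure μ'] {K : ∀ t : Fin N, (∀ s, X s) → Measure (X t)}
    (h : IsDisintegration μ K) (h' : IsDisintegration μ' K) : μ = μ' := by
  have main : ∀ n ≤ N, μ.trim (pastσ_le n) = μ'.trim (pastσ_le (X := X) n) := by
    intro n
    induction n with
    | zero =>
      intro _
      refine @Measure.ext _ (pastσ X 0) _ _ fun s hs => ?_
      rw [pastσ, pastσOf_zero] at hs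
      rw [trim_measurableSet_eq _ (by rwa [pastσ, pastσOf_zero]),
        trim_measurableSet_eq _ (by rwa [pastσ, pastσOf_zero])]
      rcases MeasurableSpace.measurableSet_bot_iff.1 hs with rfl | rfl <;> simp
    | succ n ih =>
      intro hn
      have ih := ih (by omega)
      set τ : Fin N := ⟨n, hn⟩
      have hsucc : pastσ X (n + 1) = pastσ X n ⊔ coordσ X τ := pastσOf_succ _ τ
      have val : ∀ (ρ : Measure (∀ t, X t)) [IsProbabilityMeasure ρ], IsDisintegration ρ K →
          ∀ s (A : Set (X τ)), MeasurableSet[pastσ X n] s → MeasurableSet A →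
          ρ.real (s ∩ (fun x => x τ) ⁻¹' A)
            = ∫ x in s, (K τ x A).toReal ∂(ρ.trim (pastσ_le n)) := by
        intro ρ _ hρ s A hs hA
        rw [← setIntegral_trim (pastσ_le n) ((hρ τ).2.1 A hA).stronglyMeasurable hs,
          ← setIntegral_congr_ae (pastσ_le n s hs) (((hρ τ).2.2 A hA).mono fun ω h _ => h),
          setIntegral_condExp (pastσ_le _) ((integrable_const _).indicator
            (measurable_pi_apply τ hA)) hs, setIntegral_indicator (measurable_pi_apply τ hA)]
        simp
      refine ext_of_generate_finite (m0 := pastσ X (n + 1)) _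
        (hsucc.trans (sup_eq_generateFrom_inter _ _)) (isPiSystem_inter _ _) ?_
        (by rw [trim_measurableSet_eq _ MeasurableSet.univ, trim_measurableSet_eq _ MeasurableSet.univ,
          measure_univ, measure_univ])
      rintro _ ⟨s, _, hs, ⟨A, hA, rfl⟩, rfl⟩
      have hm : MeasurableSet[pastσ X (n + 1)] (s ∩ (fun x : ∀ t, X t => x τ) ⁻¹' A) := by
        rw [hsucc]
        exact MeasurableSet.inter (m := pastσ X n ⊔ coordσ X τ)
          ((le_sup_left : pastσ X n ≤ _) s hs)
          ((le_sup_right : coordσ X τ ≤ pastσ X n ⊔ _) _ ⟨A, hA, rfl⟩)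
      rw [trim_measurableSet_eq _ hm, trim_measurableSet_eq _ hm]
      have h1 := val μ h s A hs hA
      have h2 := val μ' h' s A hs hA
      rw [ih, ← h2] at h1
      exact (measureReal_eq_measureReal_iff).1 h1
  ext s hs
  have hs' := le_pastσ le_rfl s hs
  rw [← trim_measurableSet_eq (pastσ_le N) hs', main N le_rfl, trim_measurableSet_eq _ hs']

/-- Under an independent coupling the transition kernels of `p` are not affected by the
knowledge of `q`. -/
lemma IsUpdate.isCondDistrib_of_indepFun (U : IsUpdate p q upd) (hind : IndepFun p q P)
    {K : (∀ s, X s) → Measure (X τ)}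
    (hK : IsCondDistrib' (P.map p) (fun x => x τ) (pastσ X τ) K)
    (hm : mq ≤ mE) :
    IsCondDistrib' P (fun ω => p ω τ) (past p τ ⊔ mq.comap q) fun ω => K (p ω) := by
  have := Measure.isProbabilityMeasure_map (μ := P) U.measp.aemeasurable
  have hmq : mq.comap q ≤ mΩ := (MeasurableSpace.comap_mono hm).trans U.measq.comap_le
  have hKm : ∀ A, MeasurableSet A →
      Measurable[past p τ ⊔ mq.comap q] fun ω => (K (p ω) A).toReal := fun A hA =>
    ((hK.2.1 A hA).comp (comap_measurable p)).mono le_sup_left le_rfl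
  have hle : past p τ ⊔ mq.comap q ≤ mΩ := sup_le (past_le U.measp _) hmq
  refine ⟨fun ω => hK.1 _, hKm, fun A hA => ?_⟩
  have hV : MeasurableSet ((fun x : ∀ s, X s => x τ) ⁻¹' A) := measurable_pi_apply τ hA
  refine condExp_sup_ae_eq (past_le U.measp _) hmq (bdd_indicator_one (U.measp hV))
    ⟨((hKm A hA).mono hle le_rfl).aestronglyMeasurable, 1,
      Eventually.of_forall fun ω => toReal_mem_Icc (hK.1 _) A⟩ (hKm A hA).stronglyMeasurable ?_
  rintro _ _ ⟨s, hs, rfl⟩ ⟨t, ht, rfl⟩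
  have hs' := pastσ_le _ s hs
  have ht' := hm t ht
  have prod : ∀ u : (∀ t, X t) → ℝ, Measurable u →
      ∫ ω in p ⁻¹' s ∩ q ⁻¹' t, u (p ω) ∂P
        = (∫ x in s, u x ∂(P.map p)) * ∫ ω, t.indicator (fun _ => 1) (q ω) ∂P := by
    intro u hu
    rw [← integral_indicator ((U.measp hs').inter (U.measq ht')),
      ← integral_indicator hs', integral_map U.measp.aemeasurable
        (hu.indicator hs').aestronglyMeasurable,
      ← hind.integral_fun_comp_mul_comp U.measp.aemeasurable U.measq.aemeasurable
        (hu.indicator hs').aestronglyMeasurable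
        (measurable_const.indicator ht').aestronglyMeasurable]
    congr 1; ext ω
    by_cases h1 : p ω ∈ s <;> by_cases h2 : q ω ∈ t <;> simp [indicator, h1, h2]
  have e1 := prod (((fun x : ∀ s, X s => x τ) ⁻¹' A).indicator fun _ => 1)
    (measurable_const.indicator hV)
  have e2 := prod (fun x => (K x A).toReal) ((hK.2.1 A hA).mono (pastσ_le _) le_rfl)
  rw [e2, ← setIntegral_congr_ae hs' ((hK.2.2 A hA).mono fun ω h _ => h),
    setIntegral_condExp (pastσ_le _) ((integrable_const _).indicator hV) hs, ← e1]
  rfl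

/-- The causality condition at time `τ` in terms of transition kernels. -/
lemma IsUpdate.isCondDistrib_of_condIndepσ (U : IsUpdate p q upd)
    {K : (∀ s, X s) → Measure (X τ)}
    (hK : IsCondDistrib' (π.map p) (fun x => x τ) (pastσ X τ) K)
    (hm : mq ≤ mE)
    (hci : CondIndepσ ((coordσ X τ).comap p) (mq.comap q) (past p τ) π) :
    IsCondDistrib' π (fun ω => p ω τ) (past p τ ⊔ mq.comap q) fun ω => K (p ω) := by
  have hmq : mq.comap q ≤ mΩ := (MeasurableSpace.comap_mono hm).trans U.measq.comap_le
  have hp := past_le U.measp τ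
  have hK' := (isCondDistrib_map_iff U.measp hK.1 hK.2.1).1 hK
  refine ⟨hK'.1, fun A hA => (hK'.2.1 A hA).mono le_sup_left le_rfl, fun A hA => ?_⟩
  have hV : MeasurableSet ((fun ω => p ω τ) ⁻¹' A) := U.measp (measurable_pi_apply τ hA)
  have bK := hK'.bdd hp hA
  refine condExp_sup_ae_eq hp hmq (bdd_indicator_one hV) bK
    ((hK'.2.1 A hA).stronglyMeasurable.mono le_sup_left) fun s t hs ht => ?_
  have ht' := hmq t ht
  have h1 := hci ((fun ω => p ω τ) ⁻¹' A) t ⟨(fun x => x τ) ⁻¹' A, ⟨A, hA, rfl⟩, rfl⟩ ht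
  have h2 := condExp_mul_left (m := past p τ) bK (hK'.2.1 A hA).stronglyMeasurable
    (bdd_indicator_one (π := π) ht')
  have b2 := bK.mul (bdd_indicator_one (π := π) ht')
  rw [← setIntegral_indicator ht', ← setIntegral_indicator ht',
    show (t.indicator fun ω => (K (p ω) A).toReal)
      = fun ω => (K (p ω) A).toReal * t.indicator (fun _ => 1) ω from by
        ext ω; by_cases h : ω ∈ t <;> simp [h],
    show (t.indicator fun ω => ((fun ω => p ω τ) ⁻¹' A).indicator (fun _ => (1 : ℝ)) ω)
      = ((fun ω => p ω τ) ⁻¹' A ∩ t).indicator (fun _ => (1 : ℝ)) from by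
        rw [inter_comm, ← indicator_indicator],
    ← setIntegral_condExp hp (bdd_indicator_one (hV.inter ht')).integrable hs,
    ← setIntegral_condExp hp b2.integrable hs]
  refine setIntegral_congr_ae (hp s hs) ?_
  filter_upwards [h1, h2, hK'.2.2 A hA] with ω h1 h2 h3 _
  rw [h1, h2, Pi.mul_apply, h3]

lemma IsUpdate.condIndepσ_of_isCondDistrib (U : IsUpdate p q upd)
    {K : (∀ s, X s) → Measure (X τ)}
    (hKm : ∀ A, MeasurableSet A → Measurable[pastσ X τ] fun x => (K x A).toReal)
    (hm : mq ≤ mE)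
    (hK : IsCondDistrib' π (fun ω => p ω τ) (past p τ ⊔ mq.comap q) fun ω => K (p ω)) :
    CondIndepσ ((coordσ X τ).comap p) (mq.comap q) (past p τ) π := by
  have hmq : mq.comap q ≤ mΩ := (MeasurableSpace.comap_mono hm).trans U.measq.comap_le
  have hp := past_le U.measp τ
  have hle := sup_le hp hmq
  have hK' := hK.mono le_sup_left hle fun A hA => (hKm A hA).comp (comap_measurable p)
  rintro _ t ⟨_, ⟨A, hA, rfl⟩, rfl⟩ ht
  have ht' := hmq t ht
  have hV : MeasurableSet ((fun ω => p ω τ) ⁻¹' A) := U.measp (measurable_pi_apply τ hA)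
  have bK := hK'.bdd hp hA
  have e : (p ⁻¹' ((fun x => x τ) ⁻¹' A) ∩ t).indicator (fun _ => (1 : ℝ))
      = fun ω => t.indicator (fun _ => (1 : ℝ)) ω
        * ((fun ω => p ω τ) ⁻¹' A).indicator (fun _ => (1 : ℝ)) ω := by
    ext ω
    by_cases h1 : ω ∈ t <;> by_cases h2 : p ω τ ∈ A <;> simp [indicator, h1, h2]
  have h1 := condExp_mul_left (m := past p τ ⊔ mq.comap q) (bdd_indicator_one (π := π) ht')
    (stronglyMeasurable_const.indicator ((le_sup_right : mq.comap q ≤ _) t ht))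
    (bdd_indicator_one (π := π) hV)
  have h2 : π[fun ω => t.indicator (fun _ => (1 : ℝ)) ω
        * ((fun ω => p ω τ) ⁻¹' A).indicator (fun _ => (1 : ℝ)) ω | past p τ ⊔ mq.comap q]
      =ᵐ[π] fun ω => (K (p ω) A).toReal * t.indicator (fun _ => (1 : ℝ)) ω := by
    filter_upwards [h1, hK.2.2 A hA] with ω h1 h2
    rw [h1, h2, mul_comm]
  have h3 := condExp_congr_ae (m := past p τ) h2
  have h4 := condExp_condExp_of_le (μ := π) (f := fun ω => t.indicator (fun _ => (1 : ℝ)) ω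
        * ((fun ω => p ω τ) ⁻¹' A).indicator (fun _ => (1 : ℝ)) ω)
    (le_sup_left : past p τ ≤ past p τ ⊔ mq.comap q) hle
  have h5 := condExp_mul_left (m := past p τ) bK (hK'.2.1 A hA).stronglyMeasurable
    (bdd_indicator_one (π := π) ht')
  rw [e]
  filter_upwards [h3, h4, h5, hK'.2.2 A hA] with ω h3 h4 h5 h6
  rw [← h4, h3, h5, Pi.mul_apply]
  congr 1
  exact h6.symm

end Past

section Increments

variable {Ω : Type*} {m : MeasurableSpace Ω} [mΩ : MeasurableSpace Ω]

/-- The σ-algebra of the past of `p` up to and including time `t` and of the past of `q` strictly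
before time `t`. -/
@[reducible]
def pastA (p : Ω → ∀ t, X t) (q : Ω → ∀ t, Y t) (t : ℕ) : MeasurableSpace Ω :=
  past p (t + 1) ⊔ past q t

/-- The σ-algebra of the common past of `p` and `q` strictly before time `t`. -/
@[reducible]
def pastG (p : Ω → ∀ t, X t) (q : Ω → ∀ t, Y t) (t : ℕ) : MeasurableSpace Ω :=
  past p t ⊔ past q t

omit mΩ in
lemma pastG_comm (p : Ω → ∀ t, X t) (q : Ω → ∀ t, Y t) : pastG q p = pastG p q :=
  funext fun _ => sup_comm _ _

lemma isTower_past {p : Ω → ∀ t, X t} {q : Ω → ∀ t, Y t} (hp : Measurable p)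
    (hq : Measurable q) : IsTower (pastA p q) (pastG p q) where
  le _ := sup_le (past_le hp _) (past_le hq _)
  bot := by rw [pastG, past_zero, past_zero, sup_bot_eq]
  le_A t := sup_le_sup_right (past_mono p t.le_succ) _
  le_G t := sup_le_sup_left (past_mono q t.le_succ) _

/-- The increments at time `τ` of the dual class attached to the process `p` with transition
kernels `K`. -/
def MemIncr (p : Ω → ∀ t, X t) (q : Ω → ∀ t, Y t) (upd : ∀ τ, Ω → X τ → Ω)
    (K : ∀ t : Fin N, (∀ s, X s) → Measure (X t)) (τ : Fin N) (f : Ω → ℝ) : Prop :=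
  ∃ a : Ω → ℝ, (∃ R, ∀ ω, |a ω| ≤ R) ∧
    (((τ : ℕ) = 0 ∧ Measurable[(coordσ X τ).comap p] a ∧ f = a) ∨
      ((τ : ℕ) ≠ 0 ∧ Measurable[pastA p q τ] a ∧
        f = fun ω => a ω - ∫ x, a (upd τ ω x) ∂(K τ (p ω))))

variable {p : Ω → ∀ t, X t} {q : Ω → ∀ t, Y t} {upd : ∀ τ, Ω → X τ → Ω} {π P : Measure Ω}
  [IsProbabilityMeasure π] [IsProbabilityMeasure P]
  {K : ∀ t : Fin N, (∀ s, X s) → Measure (X t)} {M : ℝ} {c : Ω → ℝ}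

omit mΩ in
lemma coordσ_comap_le_pastA (τ : Fin N) : (coordσ X τ).comap p ≤ pastA p q τ :=
  le_sup_of_le_left (MeasurableSpace.comap_mono (by
    rw [pastσ, pastσOf_succ]; exact le_sup_right))

omit mΩ in
lemma pastA_le_coordσ_comap {τ : Fin N} (hτ : (τ : ℕ) = 0) :
    pastA p q τ ≤ (coordσ X τ).comap p := by
  rw [pastA, hτ, past_zero, sup_bot_eq, ← hτ, past, pastσ, pastσOf_succ, hτ, pastσOf_zero,
    bot_sup_eq]

omit [IsProbabilityMeasure P] in
/-- Bounded functions have everywhere bounded versions. -/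
lemma Bdd.exists_version {f : Ω → ℝ} (hf : Bdd P f)
    (hm : StronglyMeasurable[m] f) :
    ∃ a : Ω → ℝ, StronglyMeasurable[m] a ∧ (∃ R, ∀ ω, |a ω| ≤ R) ∧ a =ᵐ[P] f := by
  obtain ⟨-, R, hR⟩ := hf
  refine ⟨fun ω => max (-|R|) (min |R| (f ω)), ?_, ⟨|R|, fun ω => ?_⟩, ?_⟩
  · exact (measurable_const.max (measurable_const.min hm.measurable)).stronglyMeasurable
  · exact abs_le.2 ⟨le_max_left _ _,
      max_le (by linarith [abs_nonneg R]) (min_le_left _ _)⟩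
  · filter_upwards [hR] with ω h
    have h' := abs_le.1 (h.trans (le_abs_self R))
    rw [min_eq_right h'.2, max_eq_right h'.1]

variable [∀ t, StandardBorelSpace (X t)]

lemma IsUpdate.exists_increment (U : IsUpdate p q upd)
    (hK : ∀ τ, IsCondDistrib' P (fun ω => p ω τ) (pastG p q τ) fun ω => K τ (p ω))
    {τ : Fin N} {f : Ω → ℝ} (hf : MemIncr p q upd K τ f) :
    ∃ (γ : ℝ) (f' : Ω → ℝ), StronglyMeasurable[pastA p q τ] f' ∧ Bdd P f' ∧
      P[f' | pastG p q τ] =ᵐ[P] 0 ∧ f = fun ω => γ + f' ω := by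
  have T := isTower_past U.measp U.measq
  obtain ⟨a, ⟨R, hR⟩, ⟨hτ, ha, rfl⟩ | ⟨hτ, ha, rfl⟩⟩ := hf
  · have ha' : StronglyMeasurable[pastA p q τ] f :=
      (ha.mono (coordσ_comap_le_pastA τ) le_rfl).stronglyMeasurable
    have ba : Bdd P f := .of_bound (ha'.mono (T.le τ)).aestronglyMeasurable
      (Eventually.of_forall hR)
    refine ⟨∫ ω, f ω ∂P, fun ω => f ω - ∫ ω, f ω ∂P, ha'.sub stronglyMeasurable_const,
      ba.sub (Bdd.const _), ?_, by ext; ring⟩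
    rw [hτ, T.bot, condExp_bot, integral_sub ba.integrable (integrable_const _)]
    simp
    rfl
  · have ha' : StronglyMeasurable[pastA p q τ] a := ha.stronglyMeasurable
    have ba : Bdd P a := .of_bound (ha'.mono (T.le τ)).aestronglyMeasurable
      (Eventually.of_forall hR)
    obtain ⟨h1, h2⟩ := U.condExp_update (pastσ_le τ) (hK τ) ha' ba
    have bI := (ba.condExp (T.G_le τ)).congr h2
    refine ⟨0, _, ha'.sub (h1.mono (T.le_A τ)), ba.sub bI, ?_, by ext; simp⟩
    filter_upwards [condExp_sub (m := pastG p q τ) ba.integrable bI.integrable, h2] with ω h3 h4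
    refine Eq.trans h3 ?_
    rw [Pi.sub_apply, h4, condExp_ae_eq_self (T.G_le τ) bI h1]
    simp

lemma IsUpdate.adaptedSum_of_memIncr (U : IsUpdate p q upd)
    (hK : ∀ τ, IsCondDistrib' P (fun ω => p ω τ) (pastG p q τ) fun ω => K τ (p ω))
    {F : Fin N → Ω → ℝ} (hF : ∀ τ, MemIncr p q upd K τ (F τ)) :
    AdaptedSum P (pastA p q) (pastG p q) N M 0 (fun ω => ∑ τ, F τ ω) := by
  choose γ f h1 h2 h3 h4 using fun τ => U.exists_increment hK (hF τ)
  refine ⟨∑ τ, γ τ, fun t ω => if h : t < N then f ⟨t, h⟩ ω else 0, fun t ht => ?_,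
    Eventually.of_forall fun ω => ?_⟩
  · simp only [ht, dif_pos]
    exact ⟨h1 ⟨t, ht⟩, h2 ⟨t, ht⟩, h3 ⟨t, ht⟩, fun h => absurd h (by omega)⟩
  · simp only [h4]
    rw [Finset.sum_add_distrib, Finset.sum_range]
    simp

lemma IsUpdate.exists_memIncr (U : IsUpdate p q upd)
    (hK : ∀ τ, IsCondDistrib' P (fun ω => p ω τ) (pastG p q τ) fun ω => K τ (p ω))
    (hN : 0 < N) {s : Ω → ℝ} (hs : AdaptedSum P (pastA p q) (pastG p q) N M 0 s) :
    ∃ F : Fin N → Ω → ℝ, (∀ τ, MemIncr p q upd K τ (F τ)) ∧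
      (fun ω => ∑ τ, F τ ω) =ᵐ[P] s := by
  have T := isTower_past U.measp U.measq
  obtain ⟨γ, f, hf, hs⟩ := hs
  have key : ∀ τ : Fin N, ∃ F, MemIncr p q upd K τ F ∧
      ∀ᵐ ω ∂P, F ω = (if (τ : ℕ) = 0 then γ else 0) + f τ ω := by
    intro τ
    obtain ⟨h1, h2, h3, -⟩ := hf τ τ.2
    obtain ⟨a, ha, ⟨R, hR⟩, hfa⟩ := h2.exists_version h1
    by_cases hτ : (τ : ℕ) = 0
    · refine ⟨fun ω => γ + a ω, ⟨_, ⟨|γ| + R, fun ω => ?_⟩, Or.inl ⟨hτ, ?_, rfl⟩⟩, ?_⟩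
      · exact (abs_add_le _ _).trans (add_le_add_right (hR ω) _)
      · exact (measurable_const.add ha.measurable).mono (pastA_le_coordσ_comap hτ) le_rfl
      · filter_upwards [hfa] with ω h
        rw [if_pos hτ, h]
    · refine ⟨_, ⟨a, ⟨R, hR⟩, Or.inr ⟨hτ, ha.measurable, rfl⟩⟩, ?_⟩
      have ba : Bdd P a := .of_bound (ha.mono (T.le τ)).aestronglyMeasurable
        (Eventually.of_forall hR)
      obtain ⟨-, h4⟩ := U.condExp_update (pastσ_le τ) (hK τ) ha ba
      filter_upwards [hfa, h3, h4, condExp_congr_ae (m := pastG p q τ) hfa] with ω h5 h6 h7 h8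
      rw [if_neg hτ, h5, ← h7, h8, h6]
      simp
  choose F hF1 hF2 using key
  refine ⟨F, hF1, ?_⟩
  filter_upwards [ae_all_iff.2 hF2, hs] with ω h1 h2
  rw [h2]
  simp only [h1]
  rw [Finset.sum_add_distrib, Finset.sum_range]
  congr 1
  rw [Fin.sum_univ_eq_sum_range (fun t => if t = 0 then γ else 0) N]
  simp [hN]

/-- The law of `p` together with the causality constraint with respect to `q`. -/
def lawCausal (μ : Measure (∀ t, X t)) (p : Ω → ∀ t, X t) (q : Ω → ∀ t, Y t) :
    Set (Measure Ω) :=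
  {π | π.map p = μ ∧ ∀ τ : Fin N, CondIndepσ ((coordσ X τ).comap p) (past q τ) (past p τ) π}

lemma IsUpdate.integral_increment (U : IsUpdate p q upd)
    (hK : ∀ τ, IsCondDistrib' P (fun ω => p ω τ) (pastG p q τ) fun ω => K τ (p ω))
    (hK' : ∀ τ, IsCondDistrib' π (fun ω => p ω τ) (pastG p q τ) fun ω => K τ (p ω))
    (hac : π ≪ P) {τ : Fin N} {f : Ω → ℝ} (hm : StronglyMeasurable[pastA p q τ] f)
    (bf : Bdd P f) (h0 : P[f | pastG p q τ] =ᵐ[P] 0) : ∫ ω, f ω ∂π = 0 := by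
  have T := isTower_past U.measp U.measq
  obtain ⟨a, ha, ⟨R, hR⟩, hfa⟩ := bf.exists_version hm
  have ba : ∀ (ρ : Measure Ω), Bdd ρ a := fun ρ =>
    .of_bound (ha.mono (T.le τ)).aestronglyMeasurable (Eventually.of_forall hR)
  have h1 := (U.condExp_update (pastσ_le τ) (hK τ) ha (ba P)).2
  have h2 := (U.condExp_update (pastσ_le τ) (hK' τ) ha (ba π)).2
  have h3 : (fun ω => ∫ x, a (upd τ ω x) ∂(K τ (p ω))) =ᵐ[P] 0 :=
    (EventuallyEq.symm h1).trans ((condExp_congr_ae hfa).trans h0)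
  rw [← integral_congr_ae (hac.ae_eq hfa), ← integral_condExp (T.G_le τ),
    integral_congr_ae (h2.trans (hac.ae_eq h3))]
  simp

lemma IsUpdate.isDualPair (U : IsUpdate p q upd) (hind : IndepFun p q P)
    (hμ : IsDisintegration (P.map p) K) (hM : 0 ≤ M) (bc : Bdd P c) :
    IsDualPair P c (AdaptedSum P (pastA p q) (pastG p q) N M 0) (lawCausal (P.map p) p q) := by
  have T := isTower_past U.measp U.measq
  have hK : ∀ τ, IsCondDistrib' P (fun ω => p ω τ) (pastG p q τ) fun ω => K τ (p ω) :=
    fun τ => U.isCondDistrib_of_indepFun hind (hμ τ) (pastσ_le τ)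
  have hprob : IsProbabilityMeasure (P.map p) :=
    Measure.isProbabilityMeasure_map U.measp.aemeasurable
  have prob : ∀ π ∈ lawCausal (P.map p) p q, IsProbabilityMeasure π := by
    rintro π ⟨h, -⟩
    rw [← h] at hprob
    exact (Measure.isProbabilityMeasure_map_iff U.measp.aemeasurable).1 hprob
  refine ⟨fun h bh hann => ?_, fun π hπ _ => prob π hπ, fun π hπ hac φ hφ => ?_⟩
  · have h1 := hann.integral_eq_one (AdaptedSum.isClass hM)
    have bw := bh.sub bc
    set w : Ω → ℝ := fun ω => h ω - c ω
    have : IsProbabilityMeasure (gibbs P w) := isProbabilityMeasure_gibbs bw h1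
    have hK' : ∀ τ, IsCondDistrib' (gibbs P w) (fun ω => p ω τ) (pastG p q τ)
        fun ω => K τ (p ω) := by
      intro τ
      refine ⟨(hK τ).1, (hK τ).2.1, fun B hB => ?_⟩
      have hV : MeasurableSet ((fun ω => p ω τ) ⁻¹' B) :=
        ((measurable_pi_apply τ).comp U.measp) hB
      have hVA : MeasurableSet[pastA p q τ] ((fun ω => p ω τ) ⁻¹' B) :=
        coordσ_comap_le_pastA τ _ ⟨(fun x => x τ) ⁻¹' B, ⟨B, hB, rfl⟩, rfl⟩
      have bK : ∀ (ρ : Measure Ω), Bdd ρ fun ω => (K τ (p ω) B).toReal := fun ρ =>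
        .of_bound (((hK τ).2.1 B hB).mono (T.G_le τ) le_rfl).aestronglyMeasurable
          (Eventually.of_forall fun ω => toReal_mem_Icc ((hK τ).1 ω) B)
      have b1 : ∀ (ρ : Measure Ω), Bdd ρ
          (((fun ω => p ω τ) ⁻¹' B).indicator fun _ => (1 : ℝ)) := fun ρ =>
        bdd_indicator_one hV
      refine EventuallyEq.symm (ae_eq_condExp_of_forall_setIntegral_eq (T.G_le τ)
        (b1 _).integrable (fun s _ _ => (bK _).integrable.integrableOn) (fun s hs _ => ?_)
        ((hK τ).2.1 B hB).aestronglyMeasurable)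
      have hs' := T.G_le τ s hs
      set φ : Ω → ℝ := fun ω => s.indicator (fun _ => (1 : ℝ)) ω *
        (((fun ω => p ω τ) ⁻¹' B).indicator (fun _ => (1 : ℝ)) ω - (K τ (p ω) B).toReal) with hφ
      have bφ : ∀ ρ, Bdd ρ φ := fun ρ => (bdd_indicator_one hs').mul ((b1 ρ).sub (bK ρ))
      have hφ0 : P[φ | pastG p q τ] =ᵐ[P] 0 := by
        have e1 := condExp_mul_left (m := pastG p q τ) (bdd_indicator_one (π := P) hs')
          (stronglyMeasurable_const.indicator hs) ((b1 P).sub (bK P))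
        have e2 := condExp_sub (m := pastG p q τ) (b1 P).integrable (bK P).integrable
        rw [condExp_ae_eq_self (T.G_le τ) (bK P) ((hK τ).2.1 B hB).stronglyMeasurable] at e2
        filter_upwards [e1, e2, (hK τ).2.2 B hB] with ω e1 e2 e3
        rw [e1]
        have e4 := e2.trans (by rw [Pi.sub_apply, e3, sub_self])
        exact mul_eq_zero_of_right _ e4
      have hφS : AdaptedSum P (pastA p q) (pastG p q) N M 0 φ := by
        refine ⟨0, fun t => if t = τ then φ else 0, fun t ht => ?_,
          Eventually.of_forall fun ω => ?_⟩
        · by_cases h : t = τ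
          · subst h
            simp only [if_true]
            refine ⟨?_, bφ P, hφ0, fun h => absurd h (by have := τ.2; omega)⟩
            exact (stronglyMeasurable_const.indicator (T.le_A τ s hs)).mul
              ((stronglyMeasurable_const.indicator hVA).sub
                (((hK τ).2.1 B hB).mono (T.le_A τ) le_rfl).stronglyMeasurable)
          · simp only [if_neg h]
            exact ⟨stronglyMeasurable_const, Bdd.const 0,
              (condExp_zero (m := pastG p q t) (μ := P) (E := ℝ)).eventuallyEq,
              fun h => absurd h (by omega)⟩
        · simp only [zero_add]
          rw [Finset.sum_eq_single_of_mem (τ : ℕ) (Finset.mem_range.2 τ.2)]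
          · simp
          · intro t _ h; simp [h]
      have h2 : ∫ ω, φ ω ∂(gibbs P w) = 0 := by
        rw [integral_gibbs h1, hann φ hφS, ← integral_condExp (T.G_le τ),
          integral_congr_ae hφ0]
        simp
      have h3 : ∫ ω, φ ω ∂(gibbs P w)
          = ∫ ω in s, ((fun ω => p ω τ) ⁻¹' B).indicator (fun _ => (1 : ℝ)) ω ∂(gibbs P w)
            - ∫ ω in s, (K τ (p ω) B).toReal ∂(gibbs P w) := by
        rw [← integral_sub (b1 _).integrable.integrableOn (bK _).integrable.integrableOn,
          ← integral_indicator hs']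
        congr 1; ext ω
        by_cases h : ω ∈ s <;> simp [hφ, h]
      linarith
    refine ⟨?_, fun τ => U.condIndepσ_of_isCondDistrib (hμ τ).2.1 (pastσ_le τ) (hK' τ)⟩
    have := Measure.isProbabilityMeasure_map (μ := gibbs P w) U.measp.aemeasurable
    refine IsDisintegration.eq (K := K) (fun τ => ?_) hμ
    exact (isCondDistrib_map_iff U.measp (hμ τ).1 (hμ τ).2.1).2 ((hK' τ).mono le_sup_left
      (T.G_le τ) fun B hB => ((hμ τ).2.1 B hB).comp (comap_measurable p))
  · have := prob π hπ
    have hK' : ∀ τ, IsCondDistrib' π (fun ω => p ω τ) (pastG p q τ) fun ω => K τ (p ω) :=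
      fun τ => U.isCondDistrib_of_condIndepσ (by rw [hπ.1]; exact hμ τ) (pastσ_le τ) (hπ.2 τ)
    obtain ⟨γ, f, hf, hs⟩ := hφ
    have val : ∀ (ρ : Measure Ω) [IsProbabilityMeasure ρ], ρ ≪ P →
        (∀ τ, IsCondDistrib' ρ (fun ω => p ω τ) (pastG p q τ) fun ω => K τ (p ω)) →
        ∫ ω, φ ω ∂ρ = γ := by
      intro ρ _ hac hρ
      have bf : ∀ t ∈ Finset.range N, Bdd ρ (f t) := fun t ht =>
        (hf t (Finset.mem_range.1 ht)).2.1.mono_ac hac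
      rw [integral_congr_ae (hac.ae_eq hs), integral_add (integrable_const _)
        (Bdd.sum _ bf).integrable, integral_finsetSum _ fun t ht => (bf t ht).integrable,
        Finset.sum_eq_zero]
      · simp
      · intro t ht
        obtain ⟨h1, h2, h3, -⟩ := hf t (Finset.mem_range.1 ht)
        exact U.integral_increment (τ := ⟨t, Finset.mem_range.1 ht⟩) hK hρ hac h1 h2 h3
    rw [val π hac hK', val P .rfl hK]

lemma IsUpdate.isFrame (U : IsUpdate p q upd) (hind : IndepFun p q P)
    (hμ : IsDisintegration (P.map p) K)
    (htop : mΩ ≤ MeasurableSpace.pi.comap p ⊔ MeasurableSpace.pi.comap q) :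
    IsFrame (MeasurableSpace.pi.comap q) P (pastA p q) (pastA q p) (pastG p q)
      (fun t => past p t ⊔ MeasurableSpace.pi.comap q) N where
  towerA := isTower_past U.measp U.measq
  towerB := by
    rw [← pastG_comm]
    exact isTower_past U.measq U.measp
  B_le t := sup_le (le_sup_of_le_right (MeasurableSpace.comap_mono (pastσ_le _))) le_sup_left
  Y_le t := le_sup_right
  H_le t := sup_le (past_le U.measp t) U.measq.comap_le
  top := htop.trans (sup_le_sup (MeasurableSpace.comap_mono (le_pastσ le_rfl))
    (MeasurableSpace.comap_mono (le_pastσ le_rfl)))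
  ind := by
    intro t ht a ha ba
    have h1 := (U.condExp_update (τ := ⟨t, ht⟩) (le_refl MeasurableSpace.pi)
      (U.isCondDistrib_of_indepFun hind (hμ ⟨t, ht⟩) le_rfl)
      (ha.mono (sup_le_sup_left (MeasurableSpace.comap_mono (pastσ_le t)) _)) ba).2
    have h2 := (U.condExp_update (τ := ⟨t, ht⟩) (pastσ_le t)
      (U.isCondDistrib_of_indepFun hind (hμ ⟨t, ht⟩) (pastσ_le t)) ha ba).2
    exact h1.trans (EventuallyEq.symm h2)

end Increments

section Marginal

variable {Ω E : Type*} [mΩ : MeasurableSpace Ω] [mE : MeasurableSpace E] {q : Ω → E}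
  {P : Measure Ω} [IsProbabilityMeasure P] {c : Ω → ℝ} {R : ℝ} {J : ℕ}

omit [IsProbabilityMeasure P] in
lemma VersionOf.exists_comp {φ : Ω → ℝ} (h : VersionOf (mE.comap q) P J R 0 φ) :
    ∃ g : E → ℝ, Measurable g ∧ (∃ r, ∀ y, |g y| ≤ r) ∧ (fun ω => g (q ω)) =ᵐ[P] φ := by
  obtain ⟨bφ, ⟨φ', hm, he⟩, -⟩ := h
  obtain ⟨a, ha, ⟨r, hr⟩, hae⟩ := (bφ.congr he).exists_version hm
  obtain ⟨g, hg, rfl⟩ := ha.exists_eq_measurable_comp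
  refine ⟨fun y => max (-|r|) (min |r| (g y)),
    measurable_const.max (measurable_const.min hg.measurable), ⟨|r|, fun y => ?_⟩, ?_⟩
  · exact abs_le.2 ⟨le_max_left _ _, max_le (by linarith [abs_nonneg r]) (min_le_left _ _)⟩
  · filter_upwards [hae, he] with ω h1 h2
    have h' := abs_le.1 ((hr ω).trans (le_abs_self r))
    simp only [Function.comp_apply] at h' h1
    rw [min_eq_right h'.2, max_eq_right h'.1, h1, h2]

omit [IsProbabilityMeasure P] in
lemma versionOf_comp (hq : Measurable q) (hJ : 0 < J) {g : E → ℝ} (hg : Measurable g)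
    (hr : ∃ r, ∀ y, |g y| ≤ r) : VersionOf (mE.comap q) P J R 0 (fun ω => g (q ω)) := by
  obtain ⟨r, hr⟩ := hr
  exact ⟨.of_bound (hg.comp hq).aestronglyMeasurable (Eventually.of_forall fun ω => hr _),
    ⟨_, (hg.comp (comap_measurable q)).stronglyMeasurable, EventuallyEq.rfl⟩,
    fun h => absurd h (by omega)⟩

/-- Prescribing the law of `q` is dual to the functions of `q`. -/
lemma isDualPair_marginal (hq : Measurable q) (hJ : 0 < J) (bc : Bdd P c) :
    IsDualPair P c (VersionOf (mE.comap q) P J R 0) {π | π.map q = P.map q} where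
  mem := by
    intro h bh hann
    have h1 := hann.integral_eq_one (VersionOf.isClass hJ)
    have := isProbabilityMeasure_gibbs (bh.sub bc) h1
    ext B hB
    rw [Measure.map_apply hq hB, Measure.map_apply hq hB]
    have e := hann _ (versionOf_comp (g := B.indicator fun _ => (1 : ℝ)) hq hJ
      (measurable_const.indicator hB) ⟨1, fun y => by by_cases h : y ∈ B <;> simp [h]⟩)
    rw [← integral_gibbs h1] at e
    have key : ∀ ρ : Measure Ω, ∫ ω, B.indicator (fun _ => (1 : ℝ)) (q ω) ∂ρ
        = ρ.real (q ⁻¹' B) := fun ρ => by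
      rw [← integral_indicator_one (hq hB)]
      rfl
    rw [key, key] at e
    exact (measureReal_eq_measureReal_iff).1 e
  prob := by
    intro π hπ _
    have hprob : IsProbabilityMeasure (P.map q) :=
      Measure.isProbabilityMeasure_map hq.aemeasurable
    rw [← show π.map q = P.map q from hπ] at hprob
    exact (Measure.isProbabilityMeasure_map_iff hq.aemeasurable).1 hprob
  int := by
    intro π hπ hac φ hφ
    obtain ⟨g, hg, -, he⟩ := hφ.exists_comp
    rw [← integral_congr_ae he, ← integral_congr_ae (hac.ae_eq he),
      ← integral_map hq.aemeasurable hg.aestronglyMeasurable,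
      ← integral_map hq.aemeasurable hg.aestronglyMeasurable, show π.map q = P.map q from hπ]

lemma ann_versionOf_of_optimal (hJ : 0 < J) (bc : Bdd P c) {fs gs : Ω → ℝ}
    (bf : Bdd P fs) (hgs : VersionOf (mE.comap q) P J R 0 gs)
    (hopt : ∀ g : E → ℝ, Measurable g → (∃ r, ∀ y, |g y| ≤ r) →
      ∫ ω, (fs ω + g (q ω) - Real.exp (fs ω + g (q ω) - c ω)) ∂P ≤
        ∫ ω, (fs ω + gs ω - Real.exp (fs ω + gs ω - c ω)) ∂P) :
    Ann P (VersionOf (mE.comap q) P J R 0) (fun ω => Real.exp (fs ω + gs ω - c ω)) := by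
  have hC := VersionOf.isClass (P := P) (mY := mE.comap q) (R := R) hJ
  refine ann_of_optimal (h := fun ω => fs ω + gs ω) hC (bf.add (hC.bdd _ hgs)) bc fun φ hφ => ?_
  obtain ⟨g, hg, hr, he⟩ := (hC.add hgs hφ).exists_comp
  refine le_of_eq_of_le (integral_congr_ae ?_) (hopt g hg hr)
  filter_upwards [he] with ω h
  rw [h, add_assoc]

end Marginal

section Dual

variable {Ω : Type*} [mΩ : MeasurableSpace Ω] {p : Ω → ∀ t, X t} {q : Ω → ∀ t, Y t}
  {upd : ∀ τ, Ω → X τ → Ω} {P : Measure Ω} [IsProbabilityMeasure P]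
  {K : ∀ t : Fin N, (∀ s, X s) → Measure (X t)} {M : ℝ} {c : Ω → ℝ}

lemma IsUpdate.ann_of_optimal [∀ t, StandardBorelSpace (X t)] (U : IsUpdate p q upd)
    (hK : ∀ τ, IsCondDistrib' P (fun ω => p ω τ) (pastG p q τ) fun ω => K τ (p ω))
    (hM : 0 ≤ M) (bc : Bdd P c) {fs gs : Ω → ℝ}
    (hfs : AdaptedSum P (pastA p q) (pastG p q) N M 0 fs) (bg : Bdd P gs)
    (h0 : N = 0 → ∫ ω, Real.exp (fs ω + gs ω - c ω) ∂P = 1)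
    (hopt : ∀ F : Fin N → Ω → ℝ, (∀ τ, MemIncr p q upd K τ (F τ)) →
      ∫ ω, ((∑ τ, F τ ω) + gs ω - Real.exp ((∑ τ, F τ ω) + gs ω - c ω)) ∂P ≤
        ∫ ω, (fs ω + gs ω - Real.exp (fs ω + gs ω - c ω)) ∂P) :
    Ann P (AdaptedSum P (pastA p q) (pastG p q) N M 0)
      (fun ω => Real.exp (fs ω + gs ω - c ω)) := by
  have hC := AdaptedSum.isClass (P := P) (A := pastA p q) (G := pastG p q) (n := N) hM
  have bf := hC.bdd _ hfs
  rcases Nat.eq_zero_or_pos N with hN | hN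
  · exact AdaptedSum.ann (isTower_past U.measp U.measq) ((bf.add bg).sub bc).exp
      (fun t ht => absurd ht (by omega)) (h0 hN)
  · refine AOT.ann_of_optimal (h := fun ω => fs ω + gs ω) hC (bf.add bg) bc fun φ hφ => ?_
    obtain ⟨F, hF, he⟩ := U.exists_memIncr hK hN (hC.add hfs hφ)
    refine le_of_eq_of_le (integral_congr_ae ?_) (hopt F hF)
    filter_upwards [he] with ω h
    rw [h, add_right_comm]

end Dual

section Product

lemma isUpdate_fst : IsUpdate (Prod.fst : (∀ t, X t) × (∀ t, Y t) → ∀ t, X t) Prod.snd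
    (fun τ ω x => (Function.update ω.1 τ x, ω.2)) where
  measp := measurable_fst
  measq := measurable_snd
  upd_p _ _ _ := rfl
  upd_q _ _ _ := rfl
  ext _ _ h h' := Prod.ext h h'

lemma isUpdate_snd : IsUpdate (Prod.snd : (∀ t, X t) × (∀ t, Y t) → ∀ t, Y t) Prod.fst
    (fun τ ω y => (ω.1, Function.update ω.2 τ y)) where
  measp := measurable_snd
  measq := measurable_fst
  upd_p _ _ _ := rfl
  upd_q _ _ _ := rfl
  ext _ _ h h' := Prod.ext h' h

lemma pastσ_sup_coordσ (τ : Fin N) : pastσ X τ ⊔ coordσ X τ = pastσ X (τ + 1) :=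
  (pastσOf_succ _ τ).symm

lemma memAX_iff {Kμ : ∀ t : Fin N, (∀ s, X s) → Measure (X t)} {τ : Fin N}
    {f : (∀ t, X t) × (∀ t, Y t) → ℝ} : MemAX Kμ τ f ↔
      MemIncr Prod.fst Prod.snd (fun τ ω x => (Function.update ω.1 τ x, ω.2)) Kμ τ f := by
  unfold MemAX MemIncr
  rw [pastσ_sup_coordσ]
  split_ifs with h
  · simp only [h, true_and, ne_eq, not_true, false_and, or_false]
    exact exists_congr fun a => by tauto
  · simp only [h, false_and, ne_eq, not_false_eq_true, true_and, false_or]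
    exact exists_congr fun a => by tauto

lemma memAY_iff {Kν : ∀ t : Fin N, (∀ s, Y s) → Measure (Y t)} {τ : Fin N}
    {f : (∀ t, X t) × (∀ t, Y t) → ℝ} : MemAY Kν τ f ↔
      MemIncr Prod.snd Prod.fst (fun τ ω y => (ω.1, Function.update ω.2 τ y)) Kν τ f := by
  unfold MemAY MemIncr
  rw [pastσ_sup_coordσ, sup_comm]
  split_ifs with h
  · simp only [h, true_and, ne_eq, not_true, false_and, or_false]
    exact exists_congr fun a => by tauto
  · simp only [h, false_and, ne_eq, not_false_eq_true, true_and, false_or]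
    exact exists_congr fun a => by tauto

lemma condIndepσ_map_iff {Ω Ω' : Type*} [mΩ : MeasurableSpace Ω] {m₁ m₂ m₃ : MeasurableSpace Ω'}
    [mΩ' : MeasurableSpace Ω'] {π : Measure Ω} [IsProbabilityMeasure π] {e : Ω → Ω'}
    (he : Measurable e) (h₁ : m₁ ≤ mΩ') (h₂ : m₂ ≤ mΩ') (h₃ : m₃ ≤ mΩ') :
    CondIndepσ m₁ m₂ m₃ (π.map e) ↔
      CondIndepσ (m₁.comap e) (m₂.comap e) (m₃.comap e) π := by
  have := Measure.isProbabilityMeasure_map (μ := π) he.aemeasurable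
  have key : ∀ B : Set Ω', MeasurableSet B →
      π[(e ⁻¹' B).indicator (fun _ => (1 : ℝ)) | m₃.comap e] =ᵐ[π]
        fun ω => ((π.map e)[B.indicator (fun _ => (1 : ℝ)) | m₃]) (e ω) := fun B hB =>
    condExp_map_comp he h₃ (bdd_indicator_one hB)
  have meas : ∀ φ : Ω' → ℝ, Measurable ((π.map e)[φ | m₃]) := fun φ =>
    stronglyMeasurable_condExp.measurable.mono h₃ le_rfl
  have step : ∀ B C, MeasurableSet B → MeasurableSet C →
      (((π.map e)[(B ∩ C).indicator (fun _ => (1 : ℝ)) | m₃] =ᵐ[π.map e]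
        (π.map e)[B.indicator (fun _ => (1 : ℝ)) | m₃]
          * (π.map e)[C.indicator (fun _ => (1 : ℝ)) | m₃]) ↔
      (π[(e ⁻¹' B ∩ e ⁻¹' C).indicator (fun _ => (1 : ℝ)) | m₃.comap e] =ᵐ[π]
        π[(e ⁻¹' B).indicator (fun _ => (1 : ℝ)) | m₃.comap e]
          * π[(e ⁻¹' C).indicator (fun _ => (1 : ℝ)) | m₃.comap e])) := by
    intro B C hB hC
    refine (ae_map_iff he.aemeasurable
      (measurableSet_eq_fun (meas _) ((meas _).mul (meas _)))).trans ?_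
    have e1 := key _ (hB.inter hC)
    have e2 := key _ hB
    have e3 := key _ hC
    constructor
    · intro h
      filter_upwards [e1, e2, e3, h] with ω e1 e2 e3 h
      rw [← preimage_inter, e1, h, Pi.mul_apply, Pi.mul_apply, e2, e3]
    · intro h
      filter_upwards [e1, e2, e3, h] with ω e1 e2 e3 h
      rw [← preimage_inter, e1, Pi.mul_apply, e2, e3] at h
      exact h
  constructor
  · rintro h _ _ ⟨B, hB, rfl⟩ ⟨C, hC, rfl⟩
    exact (step B C (h₁ B hB) (h₂ C hC)).1 (h B C hB hC)
  · intro h B C hB hC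
    exact (step B C (h₁ B hB) (h₂ C hC)).2 (h _ _ ⟨B, hB, rfl⟩ ⟨C, hC, rfl⟩)

lemma isAnticausal_iff {π : Measure ((∀ t, X t) × (∀ t, Y t))} [IsProbabilityMeasure π] :
    IsAnticausal π ↔ ∀ τ : Fin N,
      CondIndepσ ((coordσ Y τ).comap Prod.snd) (past Prod.fst τ) (past Prod.snd τ) π := by
  refine forall_congr' fun τ => ?_
  have h1 : (coordσ Y τ).comap (Prod.fst : (∀ t, Y t) × (∀ t, X t) → _) ≤
      (Prod.instMeasurableSpace : MeasurableSpace ((∀ t, Y t) × (∀ t, X t))) :=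
    (MeasurableSpace.comap_mono (measurable_pi_apply τ).comap_le).trans measurable_fst.comap_le
  have h2 : past (Prod.snd : (∀ t, Y t) × (∀ t, X t) → _) τ ≤
      (Prod.instMeasurableSpace : MeasurableSpace ((∀ t, Y t) × (∀ t, X t))) :=
    past_le measurable_snd τ
  have h3 : past (Prod.fst : (∀ t, Y t) × (∀ t, X t) → _) τ ≤
      (Prod.instMeasurableSpace : MeasurableSpace ((∀ t, Y t) × (∀ t, X t))) :=
    past_le measurable_fst τ
  refine (condIndepσ_map_iff measurable_swap h1 h2 h3).trans ?_
  rw [MeasurableSpace.comap_comp, MeasurableSpace.comap_comp, MeasurableSpace.comap_comp]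
  rfl

lemma anticausalSecond_eq (ν : Measure (∀ t, Y t)) [IsProbabilityMeasure ν] :
    (anticausalSecond ν : Set (Measure ((∀ t, X t) × (∀ t, Y t)))) =
      lawCausal ν Prod.snd Prod.fst := by
  ext π
  refine and_congr_right fun h => ?_
  have hprob : IsProbabilityMeasure π := by
    rw [← Measure.isProbabilityMeasure_map_iff measurable_snd.aemeasurable, h]
    infer_instance
  exact isAnticausal_iff

lemma aCouplings_causal (μ : Measure (∀ t, X t)) (ν : Measure (∀ t, Y t)) :
    aCouplings .causal μ ν = causalFirst μ ∩ secondMarg ν := by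
  ext π
  simp only [aCouplings, IsCoupling, IsAdapted, causalFirst, secondMarg, mem_ofPred_eq, mem_inter_iff]
  tauto

lemma aCouplings_bicausal (μ : Measure (∀ t, X t)) (ν : Measure (∀ t, Y t)) :
    aCouplings .bicausal μ ν = causalFirst μ ∩ anticausalSecond ν := by
  ext π
  simp only [aCouplings, IsCoupling, IsAdapted, IsBicausal, causalFirst, anticausalSecond,
    mem_ofPred_eq, mem_inter_iff]
  tauto

end Product

lemma MemSXμ.eq_zero {Kμ : ∀ t : Fin N, (∀ s, X s) → Measure (X t)}
    {s : (∀ t, X t) × (∀ t, Y t) → ℝ} (h : MemSXμ Kμ s) (hN : N = 0) : s = 0 := by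
  obtain ⟨f, -, rfl⟩ := h
  have : IsEmpty (Fin N) := hN ▸ Fin.isEmpty
  exact funext fun ω => Finset.sum_of_isEmpty _

lemma MemSYν.eq_zero {Kν : ∀ t : Fin N, (∀ s, Y s) → Measure (Y t)}
    {s : (∀ t, X t) × (∀ t, Y t) → ℝ} (h : MemSYν Kν s) (hN : N = 0) : s = 0 := by
  obtain ⟨f, -, rfl⟩ := h
  have : IsEmpty (Fin N) := hN ▸ Fin.isEmpty
  exact funext fun ω => Finset.sum_of_isEmpty _

/-- Linear convergence of the adapted Sinkhorn algorithm: there are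
constants `ρ ∈ (0, 1)` and `C > 0` depending only on `‖c‖_∞` (here: on an upper bound `M`
for `‖c‖_∞`) and `N` such that `E_• − E⁽ᵏ⁾ ≤ ρᵏ (E_• − E⁽⁰⁾)` and
`‖f̃⁽ᵏ⁾ − f̃*‖²_{L²(P)} + ‖g̃⁽ᵏ⁾ − g̃*‖²_{L²(P)} ≤ C ρᵏ (E_• − E⁽⁰⁾)`. -/
theorem stmt_19.{u, v} (N : ℕ) (M : ℝ) :
    ∃ ρ : ℝ, 0 < ρ ∧ ρ < 1 ∧ ∃ C : ℝ, 0 < C ∧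
    ∀ (X : Fin N → Type u) (Y : Fin N → Type v)
      [∀ t, MeasurableSpace (X t)] [∀ t, TopologicalSpace (X t)]
      [∀ t, PolishSpace (X t)] [∀ t, BorelSpace (X t)]
      [∀ t, MeasurableSpace (Y t)] [∀ t, TopologicalSpace (Y t)]
      [∀ t, PolishSpace (Y t)] [∀ t, BorelSpace (Y t)]
      (μ : Measure (∀ t, X t)) (ν : Measure (∀ t, Y t))
      [IsProbabilityMeasure μ] [IsProbabilityMeasure ν]
      (Kμ : ∀ t : Fin N, (∀ s, X s) → Measure (X t))
      (Kν : ∀ t : Fin N, (∀ s, Y s) → Measure (Y t)),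
      IsDisintegration μ Kμ → IsDisintegration ν Kν →
      ∀ c : (∀ t, X t) × (∀ t, Y t) → ℝ, Measurable c → (∀ ω, |c ω| ≤ M) →
      ∀ b : Flavor, b = Flavor.causal ∨ b = Flavor.bicausal →
      ∀ full half : ℕ → Measure ((∀ t, X t) × (∀ t, Y t)),
        IsSinkhorn (causalFirst μ) (sinkQ2 b ν) (Pc (μ.prod ν) c) full half →
      ∀ f g : ℕ → ((∀ t, X t) × (∀ t, Y t) → ℝ),
        (∀ k, MemSXμ Kμ (f k)) → (∀ k, MemG Kν b (g k)) →
        (∀ k, full k = (μ.prod ν).withDensity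
          (fun ω => ENNReal.ofReal (Real.exp (f k ω + g k ω - c ω)))) →
      ∀ fstar gstar : (∀ t, X t) × (∀ t, Y t) → ℝ,
        MemSXμ Kμ fstar → MemG Kν b gstar →
        (∀ f' g' : (∀ t, X t) × (∀ t, Y t) → ℝ, MemSXμ Kμ f' → MemG Kν b g' →
          ∫ ω, (f' ω + g' ω - Real.exp (f' ω + g' ω - c ω)) ∂(μ.prod ν) ≤
            ∫ ω, (fstar ω + gstar ω - Real.exp (fstar ω + gstar ω - c ω)) ∂(μ.prod ν)) →
      ∀ k : ℕ,
        Efin b μ ν c - (∫ z, c z ∂(full k) + (KL (full k) (μ.prod ν)).toReal) ≤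
          ρ ^ k * (Efin b μ ν c -
            (∫ z, c z ∂(full 0) + (KL (full 0) (μ.prod ν)).toReal)) ∧
        ∫ ω, ((f k ω - ∫ ω', f k ω' ∂(μ.prod ν))
            - (fstar ω - ∫ ω', fstar ω' ∂(μ.prod ν))) ^ 2 ∂(μ.prod ν) +
          ∫ ω, ((g k ω + ∫ ω', f k ω' ∂(μ.prod ν))
            - (gstar ω + ∫ ω', fstar ω' ∂(μ.prod ν))) ^ 2 ∂(μ.prod ν) ≤
          C * ρ ^ k * (Efin b μ ν c -
            (∫ z, c z ∂(full 0) + (KL (full 0) (μ.prod ν)).toReal)) := by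
  obtain ⟨ρ, h0, h1, C, hC, key⟩ := exists_rate_ladder.{max u v} |M| (3 ^ N * |M| + |M|)
  refine ⟨ρ, h0, h1, C, hC, ?_⟩
  intro X Y _ _ _ _ _ _ _ _ μ ν _ _ Kμ Kν hKμ hKν c hc hcM b hb full half hS f g hf hg hfull
    fstar gstar hfs hgs hopt k
  set P := μ.prod ν with hP
  have hPX : P.map Prod.fst = μ := by
    rw [hP, Measure.map_fst_prod, measure_univ, one_smul]
  have hPY : P.map Prod.snd = ν := by
    rw [hP, Measure.map_snd_prod, measure_univ, one_smul]
  have hindX : IndepFun Prod.fst Prod.snd P := indepFun_prod measurable_id measurable_id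
  have hindY : IndepFun Prod.snd Prod.fst P := hindX.symm
  have hM : 0 ≤ |M| := abs_nonneg M
  have hcM' : ∀ᵐ ω ∂P, |c ω| ≤ |M| :=
    Eventually.of_forall fun ω => (hcM ω).trans (le_abs_self M)
  have bc : Bdd P c := .of_bound hc.aestronglyMeasurable hcM'
  have UX := isUpdate_fst (X := X) (Y := Y)
  have UY := isUpdate_snd (X := X) (Y := Y)
  have hμ : IsDisintegration (P.map Prod.fst) Kμ := by rwa [hPX]
  have hν : IsDisintegration (P.map Prod.snd) Kν := by rwa [hPY]
  have hKX : ∀ τ, IsCondDistrib' P (fun ω => ω.1 τ) (pastG Prod.fst Prod.snd τ)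
      fun ω => Kμ τ ω.1 := fun τ => UX.isCondDistrib_of_indepFun hindX (hμ τ) (pastσ_le τ)
  have hKY : ∀ τ, IsCondDistrib' P (fun ω => ω.2 τ) (pastG Prod.snd Prod.fst τ)
      fun ω => Kν τ ω.2 := fun τ => UY.isCondDistrib_of_indepFun hindY (hν τ) (pastσ_le τ)
  have memX : ∀ s, MemSXμ Kμ s →
      AdaptedSum P (pastA Prod.fst Prod.snd) (pastG Prod.fst Prod.snd) N |M| 0 s := by
    rintro s ⟨F, hF, rfl⟩
    exact UX.adaptedSum_of_memIncr hKX fun τ => memAX_iff.1 (hF τ)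
  have memX' : ∀ F : Fin N → (∀ t, X t) × (∀ t, Y t) → ℝ, (∀ τ, MemIncr Prod.fst Prod.snd
      (fun τ ω x => (Function.update ω.1 τ x, ω.2)) Kμ τ (F τ)) →
      MemSXμ Kμ fun ω => ∑ τ, F τ ω := fun F hF => ⟨F, fun τ => memAX_iff.2 (hF τ), rfl⟩
  have F := UX.isFrame hindX hμ le_rfl
  have DX := UX.isDualPair hindX hμ hM bc
  have bf : Bdd P fstar := (AdaptedSum.isClass hM).bdd _ (memX _ hfs)
  rw [hPX] at DX
  rcases hb with rfl | rfl
  · have L := F.isLadder_causal bc hcM' hM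
    have memY : ∀ s, MemSY s → VersionOf (MeasurableSpace.pi.comap Prod.snd) P (N + 1)
        (3 ^ N * |M| + |M|) 0 s := by
      rintro s ⟨s, hs, hr, rfl⟩
      exact versionOf_comp measurable_snd N.succ_pos hs hr
    have DY := isDualPair_marginal (R := 3 ^ N * |M| + |M|) (q := Prod.snd) measurable_snd
      N.succ_pos bc
    rw [hPY] at DY
    have AY := ann_versionOf_of_optimal (q := Prod.snd) N.succ_pos bc bf (memY _ hgs)
      fun g' h1 h2 => hopt _ _ hfs ⟨g', h1, h2, rfl⟩
    have AX := UX.ann_of_optimal hKX hM bc (memX _ hfs) (L.classY.bdd _ (memY _ hgs))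
      (fun _ => AY.integral_eq_one L.classY) fun F hF => hopt _ _ (memX' F hF) hgs
    refine key L DX DY hS (fun k => memX _ (hf k)) (fun k => memY _ (hg k)) hfull (memX _ hfs)
      (memY _ hgs) AX AY ?_ k
    rw [Efin, aCouplings_causal]
    rfl
  · have L := F.isLadder_bicausal bc hcM' hM
    have memY : ∀ s, MemSYν Kν s →
        AdaptedSum P (pastA Prod.snd Prod.fst) (pastG Prod.fst Prod.snd) N |M| 0 s := by
      rintro s ⟨F, hF, rfl⟩
      have := UY.adaptedSum_of_memIncr (M := |M|) hKY fun τ => memAY_iff.1 (hF τ)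
      rwa [pastG_comm] at this
    have DY := UY.isDualPair hindY hν hM bc
    rw [hPY, pastG_comm, ← anticausalSecond_eq] at DY
    have bg : Bdd P gstar := L.classY.bdd _ (memY _ hgs)
    have hone : N = 0 → ∫ ω, Real.exp (fstar ω + gstar ω - c ω) ∂P = 1 := by
      intro hN
      have e : fstar = f 0 ∧ gstar = g 0 :=
        ⟨(hfs.eq_zero hN).trans ((hf 0).eq_zero hN).symm,
          (MemSYν.eq_zero hgs hN).trans (MemSYν.eq_zero (hg 0) hN).symm⟩
      rw [e.1] at bf
      rw [e.2] at bg
      rw [e.1, e.2]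
      have e' : Pc P c = gibbs P (fun ω => f 0 ω + g 0 ω - c ω) := hS.init.symm.trans (hfull 0)
      have hprob := isProbabilityMeasure_gibbs ((Bdd.const _).sub bc) (Pc_eq_gibbs bc).2
      rw [← (Pc_eq_gibbs bc).1, e'] at hprob
      exact integral_exp_eq_one_of_gibbs ((bf.add bg).sub bc)
    have AX := UX.ann_of_optimal hKX hM bc (memX _ hfs) bg hone
      fun F hF => hopt _ _ (memX' F hF) hgs
    have AY : Ann P (AdaptedSum P (pastA Prod.snd Prod.fst) (pastG Prod.fst Prod.snd) N |M| 0)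
        (fun ω => Real.exp (fstar ω + gstar ω - c ω)) := by
      have h := memY _ hgs
      rw [← pastG_comm] at h ⊢
      simp only [add_comm (fstar _)] at hone hopt ⊢
      refine UY.ann_of_optimal hKY hM bc h bf hone fun F hF => ?_
      have := hopt _ (fun ω => ∑ τ, F τ ω) hfs ⟨F, fun τ => memAY_iff.2 (hF τ), rfl⟩
      simpa only [add_comm (fstar _)] using this
    refine key L DX DY hS (fun k => memX _ (hf k)) (fun k => memY _ (hg k)) hfull (memX _ hfs)
      (memY _ hgs) AX AY ?_ k
    rw [Efin, aCouplings_bicausal]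
    rfl

end AOT
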